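/- Let D₁ ⊆ B(H₁) and D₂ ⊆ B(H₂) be masas on separable Hilbert spaces, let B₁, …, B_r ⊆ B(H₁,H₂) be masa-bimodules of finite width, let U, U₁, …, U_r ⊆ B(K₁,K₂) be weak* closed subspaces, and set W = B₁ ⊗̄ U₁ + ⋯ + B_r ⊗̄ U_r. Let C₁, …, C_m ⊆ B(H₁,H₂) be masa-bimodules of finite width. Then ∩_{j=1}^m cl(C_j ⊗̄ U + W) = cl((∩_{j=1}^m C_j) ⊗̄ U + W), where cl denotes weak* closure. -/

import Mathlib

open scoped ComplexInnerProductSpace Pointwise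
open Set MeasureTheory

noncomputable section

namespace OpSynth

/-! ### The σ-weak (weak*) topology on `B(H,K)` -/

/-- The σ-weak (weak*) topology on the space of bounded operators between Hilbert
spaces: the initial topology with respect to the functionals
`T ↦ ∑' n, ⟪η n, T (ξ n)⟫` associated to square-summable sequences `ξ`, `η`.
This is the weak* topology arising from the identification of `B(H,K)` with the
dual of the trace class operators. -/
def sigmaWeak (H K : Type*) [NormedAddCommGroup H] [InnerProductSpace ℂ H]
    [NormedAddCommGroup K] [InnerProductSpace ℂ K] :
    TopologicalSpace (H →L[ℂ] K) :=
  ⨅ (ξ : ℕ → H) (η : ℕ → K) (_ : Summable fun n => ‖ξ n‖ ^ 2)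
    (_ : Summable fun n => ‖η n‖ ^ 2),
    TopologicalSpace.induced
      (fun T : H →L[ℂ] K => ∑' n, ⟪η n, T (ξ n)⟫) inferInstance

section Basic

variable {H K H₁ H₂ H₃ K₁ K₂ T₁ T₂ : Type*}
  [NormedAddCommGroup H] [InnerProductSpace ℂ H]
  [NormedAddCommGroup K] [InnerProductSpace ℂ K]
  [NormedAddCommGroup H₁] [InnerProductSpace ℂ H₁]
  [NormedAddCommGroup H₂] [InnerProductSpace ℂ H₂]
  [NormedAddCommGroup H₃] [InnerProductSpace ℂ H₃]
  [NormedAddCommGroup K₁] [InnerProductSpace ℂ K₁]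
  [NormedAddCommGroup K₂] [InnerProductSpace ℂ K₂]
  [NormedAddCommGroup T₁] [InnerProductSpace ℂ T₁]
  [NormedAddCommGroup T₂] [InnerProductSpace ℂ T₂]

/-- A set of operators is weak* closed if it is closed in the σ-weak topology. -/
def WkClosed (S : Set (H →L[ℂ] K)) : Prop :=
  @IsClosed _ (sigmaWeak H K) S

/-- The weak* closure of a set of operators. -/
def wkClosure (S : Set (H →L[ℂ] K)) : Set (H →L[ℂ] K) :=
  @closure _ (sigmaWeak H K) S

/-- A weak* closed (linear) subspace of `B(H,K)`. -/
def IsWkClosedSubspace (S : Set (H →L[ℂ] K)) : Prop :=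
  (∃ M : Submodule ℂ (H →L[ℂ] K), (M : Set (H →L[ℂ] K)) = S) ∧ WkClosed S

/-- A map between operator spaces is weak* continuous if it is continuous with
respect to the σ-weak topologies. -/
def WkContinuous (φ : (H₁ →L[ℂ] H₂) → (K₁ →L[ℂ] K₂)) : Prop :=
  @Continuous _ _ (sigmaWeak H₁ H₂) (sigmaWeak K₁ K₂) φ

/-- The norm of an `n × n` matrix of operators, viewed as an operator on the
column Hilbert space `ℓ²(Fin n, H)`: the supremum over the unit ball of the
ℓ²-norm of the image. -/
def blockNorm {n : ℕ} (M : Matrix (Fin n) (Fin n) (H →L[ℂ] K)) : ℝ :=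
  sSup { r | ∃ v : Fin n → H, (∑ j, ‖v j‖ ^ 2) ≤ 1 ∧
    r = Real.sqrt (∑ i, ‖∑ j, M i j (v j)‖ ^ 2) }

/-- A map `φ : B(H₁,H₂) → B(K₁,K₂)` is completely bounded if its matrix
amplifications are uniformly bounded. -/
def CompletelyBounded (φ : (H₁ →L[ℂ] H₂) → (K₁ →L[ℂ] K₂)) : Prop :=
  ∃ C : ℝ, 0 ≤ C ∧ ∀ (n : ℕ) (M : Matrix (Fin n) (Fin n) (H₁ →L[ℂ] H₂)),
    blockNorm (M.map φ) ≤ C * blockNorm M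

/-- `t : H → K → T₁` realizes `T₁` as the Hilbertian tensor product `H ⊗ K`:
`t` is bilinear, multiplicative for inner products, and has total range. -/
def IsTensorEmbedding (t : H → K → T₁) : Prop :=
  (∀ x x' y, t (x + x') y = t x y + t x' y) ∧
  (∀ x y y', t x (y + y') = t x y + t x y') ∧
  (∀ (c : ℂ) x y, t (c • x) y = c • t x y) ∧
  (∀ (c : ℂ) x y, t x (c • y) = c • t x y) ∧
  (∀ x x' y y', ⟪t x y, t x' y'⟫ = ⟪x, x'⟫ * ⟪y, y'⟫) ∧
  (Submodule.span ℂ { z | ∃ x y, z = t x y }).topologicalClosure = ⊤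

/-- `W` is the elementary tensor `S ⊗ R` of the operators `S` and `R`, relative
to the tensor product realizations `t₁`, `t₂`. -/
def IsElemTensor (t₁ : H₁ → K₁ → T₁) (t₂ : H₂ → K₂ → T₂)
    (W : T₁ →L[ℂ] T₂) (S : H₁ →L[ℂ] H₂) (R : K₁ →L[ℂ] K₂) : Prop :=
  ∀ x y, W (t₁ x y) = t₂ (S x) (R y)

/-- The weak* closed tensor product `V ⊗̄ U`: the weak* closed subspace generated
by the elementary tensors `S ⊗ R` with `S ∈ V`, `R ∈ U`. -/
def wTensor (t₁ : H₁ → K₁ → T₁) (t₂ : H₂ → K₂ → T₂)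
    (V : Set (H₁ →L[ℂ] H₂)) (U : Set (K₁ →L[ℂ] K₂)) : Set (T₁ →L[ℂ] T₂) :=
  wkClosure ↑(Submodule.span ℂ
    { W : T₁ →L[ℂ] T₂ | ∃ S ∈ V, ∃ R ∈ U, IsElemTensor t₁ t₂ W S R })

/-- The Fubini product `F(V,U) = (V ⊗̄ B(K₁,K₂)) ∩ (B(H₁,H₂) ⊗̄ U)`. -/
def Fubini (t₁ : H₁ → K₁ → T₁) (t₂ : H₂ → K₂ → T₂)
    (V : Set (H₁ →L[ℂ] H₂)) (U : Set (K₁ →L[ℂ] K₂)) : Set (T₁ →L[ℂ] T₂) :=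
  wTensor t₁ t₂ V univ ∩ wTensor t₁ t₂ univ U

/-- Sum of finitely many subsets of an additive monoid. -/
def setSum {α : Type*} [AddCommMonoid α] {n : ℕ} (S : Fin n → Set α) : Set α :=
  { x | ∃ f : Fin n → α, (∀ i, f i ∈ S i) ∧ x = ∑ i, f i }

/-- The reflexive hull `Ref W = {T : Tx ∈ closure (W x) for all x}`. -/
def RefHull (W : Set (H →L[ℂ] K)) : Set (H →L[ℂ] K) :=
  { T | ∀ x : H, T x ∈ closure ((fun S : H →L[ℂ] K => S x) '' W) }

end Basic

/-- Property `S_σ`: `F(V,U) = V ⊗̄ U` for every weak* closed subspace `U` of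
`B(K₁,K₂)`, all Hilbert spaces `K₁`, `K₂`, and all realizations of the
corresponding Hilbertian tensor products. -/
def HasSsigma {H₁ H₂ : Type*}
    [NormedAddCommGroup H₁] [InnerProductSpace ℂ H₁]
    [NormedAddCommGroup H₂] [InnerProductSpace ℂ H₂]
    (V : Set (H₁ →L[ℂ] H₂)) : Prop :=
  ∀ (K₁ K₂ T₁ T₂ : Type)
    [NormedAddCommGroup K₁] [InnerProductSpace ℂ K₁] [CompleteSpace K₁]
    [NormedAddCommGroup K₂] [InnerProductSpace ℂ K₂] [CompleteSpace K₂]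
    [NormedAddCommGroup T₁] [InnerProductSpace ℂ T₁] [CompleteSpace T₁]
    [NormedAddCommGroup T₂] [InnerProductSpace ℂ T₂] [CompleteSpace T₂]
    (t₁ : H₁ → K₁ → T₁) (t₂ : H₂ → K₂ → T₂),
    IsTensorEmbedding t₁ → IsTensorEmbedding t₂ →
    ∀ U : Set (K₁ →L[ℂ] K₂), IsWkClosedSubspace U →
      Fubini t₁ t₂ V U = wTensor t₁ t₂ V U

section Masa

variable {H H₁ H₂ H₃ : Type*}
  [NormedAddCommGroup H] [InnerProductSpace ℂ H] [CompleteSpace H]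
  [NormedAddCommGroup H₁] [InnerProductSpace ℂ H₁] [CompleteSpace H₁]
  [NormedAddCommGroup H₂] [InnerProductSpace ℂ H₂] [CompleteSpace H₂]
  [NormedAddCommGroup H₃] [InnerProductSpace ℂ H₃] [CompleteSpace H₃]

/-- A masa: a maximal abelian selfadjoint subalgebra of `B(H)`. -/
def IsMasa (D : StarSubalgebra ℂ (H →L[ℂ] H)) : Prop :=
  (∀ a ∈ D, ∀ b ∈ D, a * b = b * a) ∧
  ∀ E : StarSubalgebra ℂ (H →L[ℂ] H),
    (∀ a ∈ E, ∀ b ∈ E, a * b = b * a) → D ≤ E → E = D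

/-- A (weak* closed) `D₂,D₁`-masa-bimodule. -/
def IsMasaBimodule (D₁ : StarSubalgebra ℂ (H₁ →L[ℂ] H₁))
    (D₂ : StarSubalgebra ℂ (H₂ →L[ℂ] H₂)) (V : Set (H₁ →L[ℂ] H₂)) : Prop :=
  IsWkClosedSubspace V ∧
  ∀ X ∈ V, ∀ A ∈ D₁, ∀ B ∈ D₂, B ∘L X ∘L A ∈ V

/-- A ternary set of operators: closed under the triple product `T S* R`. -/
def IsTernary (M : Set (H₁ →L[ℂ] H₂)) : Prop :=
  ∀ T ∈ M, ∀ S ∈ M, ∀ R ∈ M, T ∘L (ContinuousLinearMap.adjoint S) ∘L R ∈ M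

/-- An orthogonal projection. -/
def IsProj (p : H →L[ℂ] H) : Prop := p ∘L p = p ∧ IsSelfAdjoint p

/-- A minimal non-zero projection of a masa. -/
def IsMinimalProjOf (D : StarSubalgebra ℂ (H →L[ℂ] H)) (p : H →L[ℂ] H) : Prop :=
  p ∈ D ∧ IsProj p ∧ p ≠ 0 ∧
    ∀ q ∈ D, IsProj q → p ∘L q = q → q = 0 ∨ q = p

/-- A projection in a masa is non-atomic if it dominates no minimal non-zero
projection of the masa. -/
def IsNonAtomicProj (D : StarSubalgebra ℂ (H →L[ℂ] H)) (E : H →L[ℂ] H) : Prop :=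
  ∀ p, IsMinimalProjOf D p → ¬ (E ∘L p = p)

/-- A `D₂,D₁`-masa-bimodule map. -/
def IsMasaBimoduleMap (D₁ : StarSubalgebra ℂ (H₁ →L[ℂ] H₁))
    (D₂ : StarSubalgebra ℂ (H₂ →L[ℂ] H₂))
    (φ : (H₁ →L[ℂ] H₂) → (H₁ →L[ℂ] H₂)) : Prop :=
  ∀ (X : H₁ →L[ℂ] H₂), ∀ A ∈ D₁, ∀ B ∈ D₂,
    φ (B ∘L X ∘L A) = B ∘L (φ X) ∘L A

/-- A Schur idempotent: a weak* continuous completely bounded idempotent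
masa-bimodule map. -/
def IsSchurIdempotent (D₁ : StarSubalgebra ℂ (H₁ →L[ℂ] H₁))
    (D₂ : StarSubalgebra ℂ (H₂ →L[ℂ] H₂))
    (φ : (H₁ →L[ℂ] H₂) → (H₁ →L[ℂ] H₂)) : Prop :=
  IsLinearMap ℂ φ ∧ WkContinuous φ ∧ CompletelyBounded φ ∧ φ ∘ φ = φ ∧
    IsMasaBimoduleMap D₁ D₂ φ

/-- A nest: a totally ordered family of closed subspaces containing the
intersection and the closed linear span of any of its subsets. -/
def IsNest (N : Set (Submodule ℂ H)) : Prop :=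
  (∀ p ∈ N, IsClosed (p : Set H)) ∧ IsChain (· ≤ ·) N ∧
  ∀ S : Set (Submodule ℂ H), S ⊆ N →
    sInf S ∈ N ∧ (sSup S).topologicalClosure ∈ N

/-- The nest algebra of a nest: all operators leaving each subspace invariant. -/
def nestAlg (N : Set (Submodule ℂ H)) : Set (H →L[ℂ] H) :=
  { T | ∀ p ∈ N, ∀ x ∈ p, T x ∈ p }

/-- A (weak* closed) nest algebra bimodule. -/
def IsNestBimodule (V : Set (H₁ →L[ℂ] H₂)) : Prop :=
  IsWkClosedSubspace V ∧
  ∃ (N₁ : Set (Submodule ℂ H₁)) (N₂ : Set (Submodule ℂ H₂)),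
    IsNest N₁ ∧ IsNest N₂ ∧
    ∀ X ∈ V, ∀ A ∈ nestAlg N₁, ∀ B ∈ nestAlg N₂, B ∘L X ∘L A ∈ V

/-- A masa-bimodule of finite width: a finite intersection of masa-bimodules
each of which is a nest algebra bimodule. -/
def HasFiniteWidth (D₁ : StarSubalgebra ℂ (H₁ →L[ℂ] H₁))
    (D₂ : StarSubalgebra ℂ (H₂ →L[ℂ] H₂)) (V : Set (H₁ →L[ℂ] H₂)) : Prop :=
  ∃ (k : ℕ) (Vs : Fin k → Set (H₁ →L[ℂ] H₂)),
    (∀ j, IsMasaBimodule D₁ D₂ (Vs j) ∧ IsNestBimodule (Vs j)) ∧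
    V = ⋂ j, Vs j

end Masa

section Algebras

variable {H H₁ H₂ H₃ K : Type*}
  [NormedAddCommGroup H] [InnerProductSpace ℂ H] [CompleteSpace H]
  [NormedAddCommGroup H₁] [InnerProductSpace ℂ H₁] [CompleteSpace H₁]
  [NormedAddCommGroup H₂] [InnerProductSpace ℂ H₂] [CompleteSpace H₂]
  [NormedAddCommGroup H₃] [InnerProductSpace ℂ H₃] [CompleteSpace H₃]

/-- A weak* closed unital operator algebra in `B(H)`. -/
def IsWkClosedUnitalAlg (A : Set (H →L[ℂ] H)) : Prop :=
  IsWkClosedSubspace A ∧ (1 : H →L[ℂ] H) ∈ A ∧ ∀ a ∈ A, ∀ b ∈ A, a ∘L b ∈ A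

/-- `[X Y]`: the weak* closed linear span of the products `x ∘ y`. -/
def mulSpan (X : Set (H₂ →L[ℂ] H₃)) (Y : Set (H₁ →L[ℂ] H₂)) :
    Set (H₁ →L[ℂ] H₃) :=
  wkClosure ↑(Submodule.span ℂ { T : H₁ →L[ℂ] H₃ | ∃ x ∈ X, ∃ y ∈ Y, T = x ∘L y })

/-- The data witnessing a spatial embedding of `A` into `B`. -/
def SpatialPair (A : Set (H₁ →L[ℂ] H₁)) (B : Set (H₂ →L[ℂ] H₂))
    (X : Set (H₁ →L[ℂ] H₂)) (Y : Set (H₂ →L[ℂ] H₁)) : Prop :=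
  IsWkClosedSubspace X ∧ IsWkClosedSubspace Y ∧
  (∀ x ∈ X, ∀ b ∈ B, ∀ a ∈ A, b ∘L x ∘L a ∈ X) ∧
  (∀ y ∈ Y, ∀ a ∈ A, ∀ b ∈ B, a ∘L y ∘L b ∈ Y) ∧
  mulSpan X Y ⊆ B ∧ mulSpan Y X = A

/-- `A` is spatially embedded in `B`. -/
def SpatiallyEmbedded (A : Set (H₁ →L[ℂ] H₁)) (B : Set (H₂ →L[ℂ] H₂)) : Prop :=
  ∃ X Y, SpatialPair A B X Y

/-- `A` and `B` are spatially Morita equivalent. -/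
def SpatiallyMorita (A : Set (H₁ →L[ℂ] H₁)) (B : Set (H₂ →L[ℂ] H₂)) : Prop :=
  ∃ X Y, SpatialPair A B X Y ∧ mulSpan X Y = B

/-- The strong operator topology on `B(H,K)`. -/
def sot (H K : Type*) [NormedAddCommGroup H] [InnerProductSpace ℂ H]
    [NormedAddCommGroup K] [InnerProductSpace ℂ K] :
    TopologicalSpace (H →L[ℂ] K) :=
  TopologicalSpace.induced (fun T : H →L[ℂ] K => (T : H → K)) Pi.topologicalSpace

/-- A commutative subspace lattice (CSL): a strongly closed lattice of mutually
commuting orthogonal projections containing `0` and `1`. -/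
def IsCSL (L : Set (H →L[ℂ] H)) : Prop :=
  (∀ P ∈ L, IsProj P) ∧
  (∀ P ∈ L, ∀ Q ∈ L, P ∘L Q = Q ∘L P) ∧
  (0 : H →L[ℂ] H) ∈ L ∧ (1 : H →L[ℂ] H) ∈ L ∧
  (∀ P ∈ L, ∀ Q ∈ L, P ∘L Q ∈ L ∧ P + Q - P ∘L Q ∈ L) ∧
  @IsClosed _ (sot H H) L

/-- The CSL algebra `Alg L = {T : (1 - P) T P = 0 for all P ∈ L}`. -/
def cslAlg (L : Set (H →L[ℂ] H)) : Set (H →L[ℂ] H) :=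
  { T | ∀ P ∈ L, (1 - P) ∘L T ∘L P = 0 }

/-- A lattice homomorphism between CSLs (preserving meets and joins). -/
def IsLatticeHom (L₁ : Set (H₁ →L[ℂ] H₁)) (L₂ : Set (H₂ →L[ℂ] H₂))
    (φ : (H₁ →L[ℂ] H₁) → (H₂ →L[ℂ] H₂)) : Prop :=
  MapsTo φ L₁ L₂ ∧
  (∀ P ∈ L₁, ∀ Q ∈ L₁, φ (P ∘L Q) = φ P ∘L φ Q) ∧
  (∀ P ∈ L₁, ∀ Q ∈ L₁, φ (P + Q - P ∘L Q) = φ P + φ Q - φ P ∘L φ Q)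

end Algebras

section MeasurePart

variable {X X₁ X₂ : Type*} [MeasurableSpace X] [MeasurableSpace X₁] [MeasurableSpace X₂]

/-- A subset of a product of measure spaces is marginally null if it is
contained in `(M₁ × X₂) ∪ (X₁ × M₂)` with `μ₁ M₁ = μ₂ M₂ = 0`. -/
def MargNull (μ₁ : Measure X₁) (μ₂ : Measure X₂) (E : Set (X₁ × X₂)) : Prop :=
  ∃ (M₁ : Set X₁) (M₂ : Set X₂), MeasurableSet M₁ ∧ MeasurableSet M₂ ∧
    μ₁ M₁ = 0 ∧ μ₂ M₂ = 0 ∧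
    E ⊆ (M₁ ×ˢ (univ : Set X₂)) ∪ ((univ : Set X₁) ×ˢ M₂)

/-- Marginal equivalence: the symmetric difference is marginally null. -/
def MargEquiv (μ₁ : Measure X₁) (μ₂ : Measure X₂) (E F : Set (X₁ × X₂)) : Prop :=
  MargNull μ₁ μ₂ ((E \ F) ∪ (F \ E))

/-- ω-open sets: marginally equivalent to a countable union of measurable
rectangles. -/
def OmegaOpen (μ₁ : Measure X₁) (μ₂ : Measure X₂) (E : Set (X₁ × X₂)) : Prop :=
  ∃ (α : ℕ → Set X₁) (β : ℕ → Set X₂),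
    (∀ n, MeasurableSet (α n)) ∧ (∀ n, MeasurableSet (β n)) ∧
    MargEquiv μ₁ μ₂ E (⋃ n, (α n) ×ˢ (β n))

/-- ω-closed sets: complements of ω-open sets. -/
def OmegaClosed (μ₁ : Measure X₁) (μ₂ : Measure X₂) (E : Set (X₁ × X₂)) : Prop :=
  OmegaOpen μ₁ μ₂ Eᶜ

/-- `A` is a multiplication operator on `L²(X,μ)`: `A f = φ · f` for some
essentially bounded function `φ`.  The collection `{A | IsMultOp μ A}` is the
multiplication masa of `L^∞(X,μ)`. -/
def IsMultOp (μ : Measure X) (A : Lp ℂ 2 μ →L[ℂ] Lp ℂ 2 μ) : Prop :=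
  ∃ φ : X → ℂ, AEStronglyMeasurable φ μ ∧ (∃ C, ∀ᵐ x ∂μ, ‖φ x‖ ≤ C) ∧
    ∀ f : Lp ℂ 2 μ, ⇑(A f) =ᵐ[μ] fun x => φ x * f x

/-- A (weak* closed) masa-bimodule over the multiplication masas. -/
def IsMultBimodule (μ₁ : Measure X₁) (μ₂ : Measure X₂)
    (V : Set (Lp ℂ 2 μ₁ →L[ℂ] Lp ℂ 2 μ₂)) : Prop :=
  IsWkClosedSubspace V ∧
  ∀ X ∈ V, ∀ (A : Lp ℂ 2 μ₁ →L[ℂ] Lp ℂ 2 μ₁) (B : Lp ℂ 2 μ₂ →L[ℂ] Lp ℂ 2 μ₂),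
    IsMultOp μ₁ A → IsMultOp μ₂ B → B ∘L X ∘L A ∈ V

/-- `T` is supported on `κ`: `M_{χ_β} T M_{χ_α} = 0` (equivalently,
`⟪T f, g⟫ = 0` whenever `f` vanishes off `α` and `g` vanishes off `β`)
whenever the rectangle `α × β` intersects `κ` marginally nullly. -/
def SupportedOn (μ₁ : Measure X₁) (μ₂ : Measure X₂) (κ : Set (X₁ × X₂))
    (T : Lp ℂ 2 μ₁ →L[ℂ] Lp ℂ 2 μ₂) : Prop :=
  ∀ (α : Set X₁) (β : Set X₂), MeasurableSet α → MeasurableSet β →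
    MargNull μ₁ μ₂ ((α ×ˢ β) ∩ κ) →
    ∀ (f : Lp ℂ 2 μ₁) (g : Lp ℂ 2 μ₂),
      (∀ᵐ x ∂μ₁, x ∉ α → f x = 0) → (∀ᵐ y ∂μ₂, y ∉ β → g y = 0) →
      ⟪T f, g⟫ = (0 : ℂ)

/-- `M_max κ`: the space of all operators supported on `κ` — the largest
masa-bimodule with support `κ`. -/
def Mmax (μ₁ : Measure X₁) (μ₂ : Measure X₂) (κ : Set (X₁ × X₂)) :
    Set (Lp ℂ 2 μ₁ →L[ℂ] Lp ℂ 2 μ₂) :=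
  { T | SupportedOn μ₁ μ₂ κ T }

/-- `U` has support `κ`: `κ` is ω-closed and `Ref U = M_max κ`. -/
def HasSupport (μ₁ : Measure X₁) (μ₂ : Measure X₂)
    (U : Set (Lp ℂ 2 μ₁ →L[ℂ] Lp ℂ 2 μ₂)) (κ : Set (X₁ × X₂)) : Prop :=
  OmegaClosed μ₁ μ₂ κ ∧ RefHull U = Mmax μ₁ μ₂ κ

/-- `M_min κ`: the smallest weak* closed masa-bimodule with support `κ`,
realized as the intersection of all weak* closed masa-bimodules with support `κ`. -/
def Mmin (μ₁ : Measure X₁) (μ₂ : Measure X₂) (κ : Set (X₁ × X₂)) :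
    Set (Lp ℂ 2 μ₁ →L[ℂ] Lp ℂ 2 μ₂) :=
  ⋂₀ { U | IsMultBimodule μ₁ μ₂ U ∧ HasSupport μ₁ μ₂ U κ }

/-- `κ` is operator synthetic if it is ω-closed and `M_min κ = M_max κ`. -/
def OperatorSynthetic (μ₁ : Measure X₁) (μ₂ : Measure X₂)
    (κ : Set (X₁ × X₂)) : Prop :=
  OmegaClosed μ₁ μ₂ κ ∧ Mmin μ₁ μ₂ κ = Mmax μ₁ μ₂ κ

/-- A masa-bimodule of finite width over the multiplication masas. -/
def MultFiniteWidth (μ₁ : Measure X₁) (μ₂ : Measure X₂)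
    (V : Set (Lp ℂ 2 μ₁ →L[ℂ] Lp ℂ 2 μ₂)) : Prop :=
  ∃ (k : ℕ) (Vs : Fin k → Set (Lp ℂ 2 μ₁ →L[ℂ] Lp ℂ 2 μ₂)),
    (∀ j, IsMultBimodule μ₁ μ₂ (Vs j) ∧ IsNestBimodule (Vs j)) ∧
    V = ⋂ j, Vs j

/-- A set of finite width: the support of a masa-bimodule of finite width. -/
def FiniteWidthSet (μ₁ : Measure X₁) (μ₂ : Measure X₂)
    (κ : Set (X₁ × X₂)) : Prop :=
  ∃ V, MultFiniteWidth μ₁ μ₂ V ∧ HasSupport μ₁ μ₂ V κ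

end MeasurePart

/-- The flip `ρ : (X₁ × X₂) × (Y₁ × Y₂) → (X₁ × Y₁) × (X₂ × Y₂)`. -/
def flipProd {X₁ X₂ Y₁ Y₂ : Type*} :
    (X₁ × X₂) × (Y₁ × Y₂) → (X₁ × Y₁) × (X₂ × Y₂) :=
  fun q => ((q.1.1, q.2.1), (q.1.2, q.2.2))

end OpSynth



open scoped ComplexInnerProductSpace Pointwise
open Set OpSynth

set_option linter.unusedSectionVars false
set_option linter.unusedSimpArgs false
set_option linter.unusedVariables false
namespace OSH
noncomputable section

/-- `ℓ²` sums of copies of a Hilbert space. -/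
abbrev L2 (ι : Type*) (H : Type*) [NormedAddCommGroup H] := lp (fun _ : ι => H) 2

section Amp
variable {ι : Type*} {H K J : Type*}
  [NormedAddCommGroup H] [InnerProductSpace ℂ H]
  [NormedAddCommGroup K] [InnerProductSpace ℂ K]
  [NormedAddCommGroup J] [InnerProductSpace ℂ J]

theorem memL2 {f : ι → H} (hf : Summable fun i => ‖f i‖ ^ 2) : Memℓp f 2 := by
  apply memℓp_gen
  simpa using hf

theorem L2.summable (f : L2 ι H) : Summable fun i => ‖f i‖ ^ 2 := by
  have := lp.memℓp f
  rw [memℓp_gen_iff (by norm_num)] at this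
  simpa using this

theorem L2.norm_sq (f : L2 ι H) : ‖f‖ ^ 2 = ∑' i, ‖f i‖ ^ 2 := by
  have := lp.norm_rpow_eq_tsum (p := 2) (by norm_num) f
  simpa using this

def mkL2 (f : ι → H) (hf : Summable fun i => ‖f i‖ ^ 2) : L2 ι H := ⟨f, memL2 hf⟩

@[simp] theorem mkL2_apply (f : ι → H) (hf : Summable fun i => ‖f i‖ ^ 2) (i : ι) :
    mkL2 f hf i = f i := rfl

theorem amp_summable (A : H →L[ℂ] K) (f : L2 ι H) : Summable fun i => ‖A (f i)‖ ^ 2 := by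
  refine Summable.of_nonneg_of_le (fun i => by positivity) (fun i => ?_)
    ((L2.summable f).mul_left (‖A‖ ^ 2))
  rw [← mul_pow]
  exact pow_le_pow_left₀ (norm_nonneg _) (A.le_opNorm _) 2

/-- Amplification of an operator. -/
def amp (ι : Type*) (A : H →L[ℂ] K) : L2 ι H →L[ℂ] L2 ι K :=
  LinearMap.mkContinuous
    { toFun := fun f => mkL2 (fun i => A (f i)) (amp_summable A f)
      map_add' := fun f g => by ext i; simp
      map_smul' := fun c f => by ext i; simp } ‖A‖ (fun f => by
        refine le_of_sq_le_sq ?_ (by positivity)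
        rw [L2.norm_sq, mul_pow, L2.norm_sq, ← tsum_mul_left]
        refine (amp_summable A f).tsum_le_tsum (fun i => ?_) ((L2.summable f).mul_left _)
        rw [← mul_pow]
        exact pow_le_pow_left₀ (norm_nonneg _) (A.le_opNorm _) 2)

@[simp] theorem amp_apply (A : H →L[ℂ] K) (f : L2 ι H) (i : ι) : amp ι A f i = A (f i) := rfl

theorem amp_norm_le (A : H →L[ℂ] K) : ‖amp ι A‖ ≤ ‖A‖ :=
  LinearMap.mkContinuous_norm_le _ (norm_nonneg _) _

theorem amp_comp (A : K →L[ℂ] J) (B : H →L[ℂ] K) : amp ι (A ∘L B) = amp ι A ∘L amp ι B := by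
  ext; simp

theorem amp_add (A B : H →L[ℂ] K) : amp ι (A + B) = amp ι A + amp ι B := by
  ext; simp
theorem amp_sub (A B : H →L[ℂ] K) : amp ι (A - B) = amp ι A - amp ι B := by
  ext; simp
theorem amp_smul (c : ℂ) (A : H →L[ℂ] K) : amp ι (c • A) = c • amp ι A := by
  ext; simp
theorem amp_one : amp ι (1 : H →L[ℂ] H) = 1 := by
  ext; simp
theorem amp_zero : amp ι (0 : H →L[ℂ] K) = 0 := by
  ext; simp

theorem amp_inner_adj [CompleteSpace H] [CompleteSpace K] (A : H →L[ℂ] K) (f : L2 ι H)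
    (g : L2 ι K) : ⟪g, amp ι A f⟫ = ⟪amp ι (ContinuousLinearMap.adjoint A) g, f⟫ := by
  rw [lp.inner_eq_tsum, lp.inner_eq_tsum]
  simp [ContinuousLinearMap.adjoint_inner_left]

theorem amp_adjoint [CompleteSpace H] [CompleteSpace K] (A : H →L[ℂ] K) :
    ContinuousLinearMap.adjoint (amp ι A) = amp ι (ContinuousLinearMap.adjoint A) := by
  symm
  rw [ContinuousLinearMap.eq_adjoint_iff]
  intro x y
  rw [amp_inner_adj]

/-- Normal functionals. -/
def Normal (f : (H →L[ℂ] K) → ℂ) : Prop :=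
  ∃ (ξ : L2 ℕ H) (η : L2 ℕ K), ∀ T, f T = ⟪η, amp ℕ T ξ⟫

theorem normal_tsum {ξ : ℕ → H} {η : ℕ → K} (hξ : Summable fun n => ‖ξ n‖ ^ 2)
    (hη : Summable fun n => ‖η n‖ ^ 2) :
    Normal (fun T : H →L[ℂ] K => ∑' n, ⟪η n, T (ξ n)⟫) :=
  ⟨mkL2 ξ hξ, mkL2 η hη, fun T => by rw [lp.inner_eq_tsum]; rfl⟩

theorem extend_summable {e : ι → ℕ} (he : Function.Injective e) (f : L2 ι H) :
    Summable fun n => ‖Function.extend e f 0 n‖ ^ 2 := by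
  rw [← he.summable_iff]
  · convert L2.summable f using 2 with i
    simp [he.extend_apply]
  · intro x hx
    rw [Function.extend_apply' _ _ _ (by simpa using hx)]; simp

theorem normal_of_countable [Countable ι] (ξ : L2 ι H) (η : L2 ι K) :
    Normal (fun T : H →L[ℂ] K => ⟪η, amp ι T ξ⟫) := by
  obtain ⟨e, he⟩ := exists_injective_nat ι
  refine ⟨mkL2 _ (extend_summable he ξ), mkL2 _ (extend_summable he η), fun T => ?_⟩
  beta_reduce
  rw [lp.inner_eq_tsum, lp.inner_eq_tsum]
  rw [← he.tsum_eq (f := fun n => ⟪mkL2 _ (extend_summable he η) n,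
    amp ℕ T (mkL2 _ (extend_summable he ξ)) n⟫)]
  · simp [he.extend_apply]
  · intro x hx
    by_contra h
    apply hx
    simp [Function.extend_apply' _ _ _ (by simpa using h)]

theorem Normal.add {f g : (H →L[ℂ] K) → ℂ} (hf : Normal f) (hg : Normal g) :
    Normal (fun T => f T + g T) := by
  obtain ⟨ξ, η, h⟩ := hf
  obtain ⟨ξ', η', h'⟩ := hg
  have s1 : Summable fun i : ℕ ⊕ ℕ => ‖Sum.elim ξ ξ' i‖ ^ 2 :=
    Summable.sum _ (by simpa [Function.comp_def] using L2.summable ξ)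
      (by simpa [Function.comp_def] using L2.summable ξ')
  have s2 : Summable fun i : ℕ ⊕ ℕ => ‖Sum.elim η η' i‖ ^ 2 :=
    Summable.sum _ (by simpa [Function.comp_def] using L2.summable η)
      (by simpa [Function.comp_def] using L2.summable η')
  convert normal_of_countable (mkL2 _ s1) (mkL2 _ s2) using 2 with T
  rw [h, h', lp.inner_eq_tsum, lp.inner_eq_tsum, lp.inner_eq_tsum]
  rw [Summable.tsum_sum]
  · simp
  · simpa [Function.comp_def] using lp.summable_inner (𝕜 := ℂ) η (amp ℕ T ξ)
  · simpa [Function.comp_def] using lp.summable_inner (𝕜 := ℂ) η' (amp ℕ T ξ')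

theorem Normal.smul {f : (H →L[ℂ] K) → ℂ} (hf : Normal f) (c : ℂ) :
    Normal (fun T => c * f T) := by
  obtain ⟨ξ, η, h⟩ := hf
  refine ⟨c • ξ, η, fun T => ?_⟩
  beta_reduce
  rw [h, map_smul, inner_smul_right]

theorem Normal.zero : Normal (fun _ : H →L[ℂ] K => (0 : ℂ)) :=
  ⟨0, 0, fun T => by simp⟩

theorem Normal.sum {α : Type*} (s : Finset α) {f : α → (H →L[ℂ] K) → ℂ}
    (hf : ∀ i ∈ s, Normal (f i)) : Normal (fun T => ∑ i ∈ s, f i T) := by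
  classical
  induction s using Finset.induction_on with
  | empty => simpa using Normal.zero
  | insert a s ha ih =>
    simp only [Finset.sum_insert ha]
    exact (hf a (by simp)).add (ih fun i hi => hf i (by simp [hi]))

theorem Normal.map_add {f : (H →L[ℂ] K) → ℂ} (hf : Normal f) (S T) : f (S + T) = f S + f T := by
  obtain ⟨ξ, η, h⟩ := hf
  simp [h, amp_add, inner_add_right]

theorem Normal.map_smul {f : (H →L[ℂ] K) → ℂ} (hf : Normal f) (c : ℂ) (T) :
    f (c • T) = c * f T := by
  obtain ⟨ξ, η, h⟩ := hf
  simp [h, amp_smul, inner_smul_right]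

/-- The bipolar. -/
def Hull (G : Set (H →L[ℂ] K)) : Submodule ℂ (H →L[ℂ] K) where
  carrier := {T | ∀ f, Normal f → (∀ X ∈ G, f X = 0) → f T = 0}
  add_mem' := fun {a b} ha hb f hf h => by
    rw [hf.map_add, ha f hf h, hb f hf h, add_zero]
  zero_mem' := fun f hf _ => by
    have := hf.map_smul 0 0
    simpa using this
  smul_mem' := fun c x hx f hf h => by rw [hf.map_smul, hx f hf h, mul_zero]

theorem mem_Hull {G : Set (H →L[ℂ] K)} {T} :
    T ∈ Hull G ↔ ∀ f, Normal f → (∀ X ∈ G, f X = 0) → f T = 0 := Iff.rfl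

theorem mem_Hull' {G : Set (H →L[ℂ] K)} {T} :
    T ∈ Hull G ↔ ∀ (ξ : L2 ℕ H) (η : L2 ℕ K), (∀ X ∈ G, ⟪η, amp ℕ X ξ⟫ = 0) →
      ⟪η, amp ℕ T ξ⟫ = 0 :=
  ⟨fun h ξ η hx => h _ ⟨ξ, η, fun _ => rfl⟩ hx, fun h f ⟨ξ, η, hf⟩ hX => by
    rw [hf]; exact h ξ η fun X hx => by rw [← hf]; exact hX X hx⟩

theorem subset_Hull (G : Set (H →L[ℂ] K)) : G ⊆ Hull G := fun _ hT _ _ h => h _ hT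

theorem Hull_le {G G' : Set (H →L[ℂ] K)} (h : G ⊆ Hull G') : Hull G ≤ Hull G' :=
  fun _ hT f hf h' => hT f hf fun X hX => h hX f hf h'

theorem Hull_mono {G G' : Set (H →L[ℂ] K)} (h : G ⊆ G') : Hull G ≤ Hull G' :=
  Hull_le (h.trans (subset_Hull _))

theorem Hull_map {H' K' : Type*} [NormedAddCommGroup H'] [InnerProductSpace ℂ H']
    [NormedAddCommGroup K'] [InnerProductSpace ℂ K']
    {G : Set (H →L[ℂ] K)} {G' : Set (H' →L[ℂ] K')} (Φ : (H →L[ℂ] K) → (H' →L[ℂ] K'))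
    (hΦ : ∀ f, Normal f → Normal (fun T => f (Φ T)))
    (h : ∀ X ∈ G, Φ X ∈ Hull G') {T} (hT : T ∈ Hull G) : Φ T ∈ Hull G' :=
  fun f hf h' => hT _ (hΦ f hf) fun X hX => h X hX f hf h'

theorem Normal.comp {f : (H →L[ℂ] K) → ℂ} (hf : Normal f)
    {H' K' : Type*} [NormedAddCommGroup H'] [InnerProductSpace ℂ H']
    [NormedAddCommGroup K'] [InnerProductSpace ℂ K'] [CompleteSpace K] [CompleteSpace K']
    (A : H →L[ℂ] H') (B : K' →L[ℂ] K) :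
    Normal (fun T : H' →L[ℂ] K' => f (B ∘L T ∘L A)) := by
  obtain ⟨ξ, η, h⟩ := hf
  refine ⟨amp ℕ A ξ, amp ℕ (ContinuousLinearMap.adjoint B) η, fun T => ?_⟩
  beta_reduce
  rw [h, amp_comp, amp_comp, ContinuousLinearMap.comp_apply, amp_inner_adj,
    ContinuousLinearMap.comp_apply]

theorem Hull_cut {H' K' : Type*} [NormedAddCommGroup H'] [InnerProductSpace ℂ H']
    [NormedAddCommGroup K'] [InnerProductSpace ℂ K'] [CompleteSpace K] [CompleteSpace K']
    (A : H →L[ℂ] H') (B : K' →L[ℂ] K)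
    {G : Set (H' →L[ℂ] K')} {G' : Set (H →L[ℂ] K)}
    (h : ∀ X ∈ G, B ∘L X ∘L A ∈ Hull G') {T} (hT : T ∈ Hull G) : B ∘L T ∘L A ∈ Hull G' :=
  Hull_map (fun T => B ∘L T ∘L A) (fun _ hf => hf.comp A B) h hT

end Amp
end
end OSH

namespace OSH
noncomputable section
section Sep
variable {H K : Type*}
  [NormedAddCommGroup H] [InnerProductSpace ℂ H]
  [NormedAddCommGroup K] [InnerProductSpace ℂ K]

/-- Evaluation against all normal functionals. -/
def evN (T : H →L[ℂ] K) : {f : (H →L[ℂ] K) → ℂ // Normal f} → ℂ := fun f => f.1 T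

theorem sigmaWeak_eq : sigmaWeak H K = TopologicalSpace.induced evN Pi.topologicalSpace := by
  apply le_antisymm
  · rw [← continuous_iff_le_induced, @continuous_pi_iff]
    rintro ⟨f, ξ, η, hf⟩
    rw [continuous_iff_le_induced]
    unfold sigmaWeak
    refine (iInf_le _ (ξ : ℕ → H)).trans <| (iInf_le _ (η : ℕ → K)).trans <|
      (iInf_le _ (L2.summable ξ)).trans <| (iInf_le _ (L2.summable η)).trans (le_of_eq ?_)
    congr 1
    ext T
    simp only [evN, hf, lp.inner_eq_tsum, amp_apply]
  · unfold sigmaWeak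
    refine le_iInf fun ξ => le_iInf fun η => le_iInf fun hξ => le_iInf fun hη => ?_
    rw [← continuous_iff_le_induced]
    let _ := TopologicalSpace.induced (evN (H := H) (K := K)) Pi.topologicalSpace
    have h1 : Continuous (evN (H := H) (K := K)) := continuous_induced_dom
    exact (continuous_apply (⟨_, normal_tsum hξ hη⟩ :
      {f : (H →L[ℂ] K) → ℂ // Normal f})).comp h1

theorem exists_match (M : Submodule ℂ (H →L[ℂ] K)) {T : H →L[ℂ] K} (hT : T ∈ Hull (M : Set _))
    (F : Finset {f : (H →L[ℂ] K) → ℂ // Normal f}) :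
    ∃ X ∈ M, ∀ f ∈ F, f.1 X = f.1 T := by
  let L : (H →L[ℂ] K) →ₗ[ℂ] (F → ℂ) :=
    { toFun := fun T f => f.1.1 T
      map_add' := fun S T => by ext f; exact f.1.2.map_add S T
      map_smul' := fun c T => by ext f; exact f.1.2.map_smul c T }
  classical
  by_contra hcon
  have hn : L T ∉ M.map L := by
    rintro ⟨X, hX, h⟩
    exact hcon ⟨X, hX, fun f hf => congrFun h ⟨f, hf⟩⟩
  obtain ⟨φ, hφ, hM⟩ := Submodule.exists_le_ker_of_notMem hn
  apply hφ
  have key : ∀ S, φ (L S) = ∑ i : F, φ (Pi.single i 1) * i.1.1 S := by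
    intro S
    conv_lhs => rw [← Finset.univ_sum_single (L S)]
    rw [map_sum]
    refine Finset.sum_congr rfl fun i _ => ?_
    have : Pi.single i (L S i) = (L S i) • (Pi.single i 1 : F → ℂ) := by
      rw [← Pi.single_smul]; simp
    rw [this, map_smul, smul_eq_mul, mul_comm]; rfl
  have hN : Normal (fun S => φ (L S)) := by
    simp_rw [key]
    exact Normal.sum _ fun i _ => i.1.2.smul _
  exact hT _ hN fun X hX => hM ⟨X, hX, rfl⟩

theorem wkClosure_submodule (M : Submodule ℂ (H →L[ℂ] K)) :
    wkClosure (M : Set (H →L[ℂ] K)) = Hull (M : Set (H →L[ℂ] K)) := by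
  unfold wkClosure
  rw [sigmaWeak_eq]
  ext T
  rw [closure_induced]
  constructor
  · intro h f hf hM
    have hc : IsClosed {y : {f : (H →L[ℂ] K) → ℂ // Normal f} → ℂ | y ⟨f, hf⟩ = 0} :=
      isClosed_eq (continuous_apply _) continuous_const
    have : closure (evN '' (M : Set (H →L[ℂ] K))) ⊆ {y | y ⟨f, hf⟩ = 0} := by
      refine closure_minimal ?_ hc
      rintro _ ⟨X, hX, rfl⟩
      exact hM X hX
    exact this h
  · intro h
    rw [mem_closure_iff]
    intro o ho hy
    obtain ⟨I, u, hu, hs⟩ := isOpen_pi_iff.1 ho _ hy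
    obtain ⟨X, hX, hm⟩ := exists_match M h I
    refine ⟨evN X, hs fun f hf => ?_, X, hX, rfl⟩
    have := (hu f hf).2
    simp only [evN] at this ⊢
    rw [hm f hf]; exact this

theorem Hull_eq_of_wkClosed {V : Set (H →L[ℂ] K)} (hV : IsWkClosedSubspace V) :
    (Hull V : Set (H →L[ℂ] K)) = V := by
  obtain ⟨⟨M, rfl⟩, h⟩ := hV
  rw [← wkClosure_submodule]
  let _ := sigmaWeak H K
  exact IsClosed.closure_eq h

theorem Hull_span (G : Set (H →L[ℂ] K)) :
    Hull (Submodule.span ℂ G : Set (H →L[ℂ] K)) = Hull G := by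
  apply le_antisymm
  · apply Hull_le
    exact Submodule.span_le.2 (subset_Hull G)
  · exact Hull_mono Submodule.subset_span

end Sep

section Main0
variable {H₁ H₂ K₁ K₂ T₁ T₂ : Type*}
  [NormedAddCommGroup H₁] [InnerProductSpace ℂ H₁]
  [NormedAddCommGroup H₂] [InnerProductSpace ℂ H₂]
  [NormedAddCommGroup K₁] [InnerProductSpace ℂ K₁]
  [NormedAddCommGroup K₂] [InnerProductSpace ℂ K₂]
  [NormedAddCommGroup T₁] [InnerProductSpace ℂ T₁]
  [NormedAddCommGroup T₂] [InnerProductSpace ℂ T₂]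

/-- Elementary tensors. -/
def Elem (t₁ : H₁ → K₁ → T₁) (t₂ : H₂ → K₂ → T₂)
    (V : Set (H₁ →L[ℂ] H₂)) (U : Set (K₁ →L[ℂ] K₂)) : Set (T₁ →L[ℂ] T₂) :=
  { W : T₁ →L[ℂ] T₂ | ∃ S ∈ V, ∃ R ∈ U, IsElemTensor t₁ t₂ W S R }

theorem wTensor_eq (t₁ : H₁ → K₁ → T₁) (t₂ : H₂ → K₂ → T₂)
    (V : Set (H₁ →L[ℂ] H₂)) (U : Set (K₁ →L[ℂ] K₂)) :
    wTensor t₁ t₂ V U = Hull (Elem t₁ t₂ V U) := by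
  unfold wTensor
  rw [wkClosure_submodule, Hull_span]; rfl

theorem big_eq (t₁ : H₁ → K₁ → T₁) (t₂ : H₂ → K₂ → T₂)
    (C : Set (H₁ →L[ℂ] H₂)) (U : Set (K₁ →L[ℂ] K₂)) {r : ℕ}
    (Bs : Fin r → Set (H₁ →L[ℂ] H₂)) (Us : Fin r → Set (K₁ →L[ℂ] K₂)) :
    wkClosure (wTensor t₁ t₂ C U + setSum fun i => wTensor t₁ t₂ (Bs i) (Us i)) =
      Hull (Elem t₁ t₂ C U ∪ ⋃ i, Elem t₁ t₂ (Bs i) (Us i)) := by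
  have h1 : (wTensor t₁ t₂ C U + setSum fun i => wTensor t₁ t₂ (Bs i) (Us i)) =
      ((Hull (Elem t₁ t₂ C U) ⊔ ⨆ i, Hull (Elem t₁ t₂ (Bs i) (Us i)) :
        Submodule ℂ (T₁ →L[ℂ] T₂)) : Set (T₁ →L[ℂ] T₂)) := by
    rw [Submodule.coe_sup, wTensor_eq]
    congr 1
    ext X
    simp only [setSum, wTensor_eq, mem_ofPred_eq, SetLike.mem_coe]
    rw [Submodule.mem_iSup_iff_exists_finsupp]
    constructor
    · rintro ⟨f, hf, rfl⟩
      exact ⟨Finsupp.equivFunOnFinite.symm f, fun i => hf i, by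
        rw [Finsupp.sum_fintype]; simp; simp⟩
    · rintro ⟨f, hf, rfl⟩
      exact ⟨f, hf, by rw [Finsupp.sum_fintype]; simp⟩
  rw [h1, wkClosure_submodule]
  congr 1
  apply le_antisymm
  · apply Hull_le
    have : (Hull (Elem t₁ t₂ C U) ⊔ ⨆ i, Hull (Elem t₁ t₂ (Bs i) (Us i)) :
        Submodule ℂ (T₁ →L[ℂ] T₂)) ≤
        Hull (Elem t₁ t₂ C U ∪ ⋃ i, Elem t₁ t₂ (Bs i) (Us i)) := by
      refine sup_le (Hull_mono subset_union_left) (iSup_le fun i => Hull_mono ?_)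
      exact (subset_iUnion (fun i => Elem t₁ t₂ (Bs i) (Us i)) i).trans subset_union_right
    exact this
  · apply Hull_mono
    refine union_subset ?_ (iUnion_subset fun i => ?_)
    · exact (subset_Hull _).trans (SetLike.coe_subset_coe.2 le_sup_left)
    · exact (subset_Hull _).trans (SetLike.coe_subset_coe.2 <|
        (le_iSup (fun i => Hull (Elem t₁ t₂ (Bs i) (Us i))) i).trans le_sup_right)
end Main0
end
end OSH

open ContinuousLinearMap (adjoint)
namespace OSH
noncomputable section
section Ten
variable {H K T H' K' T' : Type*}
  [NormedAddCommGroup H] [InnerProductSpace ℂ H] [CompleteSpace H]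
  [NormedAddCommGroup K] [InnerProductSpace ℂ K] [CompleteSpace K]
  [NormedAddCommGroup T] [InnerProductSpace ℂ T] [CompleteSpace T]
  [NormedAddCommGroup H'] [InnerProductSpace ℂ H'] [CompleteSpace H']
  [NormedAddCommGroup K'] [InnerProductSpace ℂ K'] [CompleteSpace K']
  [NormedAddCommGroup T'] [InnerProductSpace ℂ T'] [CompleteSpace T']
  {t : H → K → T} {t' : H' → K → T'}

theorem te_flip (ht : IsTensorEmbedding t) : IsTensorEmbedding (fun y x => t x y) := by
  obtain ⟨h1, h2, h3, h4, h5, h6⟩ := ht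
  refine ⟨fun x x' y => h2 _ _ _, fun x y y' => h1 _ _ _, fun c x y => h4 _ _ _,
    fun c x y => h3 _ _ _, fun x x' y y' => by rw [h5, mul_comm], ?_⟩
  rw [← h6]
  congr 2
  ext z
  constructor
  · rintro ⟨x, y, h⟩; exact ⟨y, x, h⟩
  · rintro ⟨x, y, h⟩; exact ⟨y, x, h⟩

theorem te_inner (ht : IsTensorEmbedding t) (x x' y y') :
    ⟪t x y, t x' y'⟫ = ⟪x, x'⟫ * ⟪y, y'⟫ := ht.2.2.2.2.1 x x' y y'

theorem te_norm (ht : IsTensorEmbedding t) (x y) : ‖t x y‖ = ‖x‖ * ‖y‖ := by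
  have h := te_inner ht x x y y
  rw [inner_self_eq_norm_sq_to_K, inner_self_eq_norm_sq_to_K, inner_self_eq_norm_sq_to_K] at h
  norm_cast at h
  rw [← mul_pow] at h
  exact (sq_eq_sq₀ (norm_nonneg _) (by positivity)).1 (by exact_mod_cast h)

/-- `x ↦ t x y`. -/
def tL (ht : IsTensorEmbedding t) (y : K) : H →L[ℂ] T :=
  LinearMap.mkContinuous
    { toFun := fun x => t x y
      map_add' := fun x x' => ht.1 x x' y
      map_smul' := fun c x => ht.2.2.1 c x y } ‖y‖ (fun x => by
        simp [te_norm ht, mul_comm])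

@[simp] theorem tL_apply (ht : IsTensorEmbedding t) (y : K) (x : H) : tL ht y x = t x y := rfl

/-- `y ↦ t x y`. -/
def tR (ht : IsTensorEmbedding t) (x : H) : K →L[ℂ] T := tL (te_flip ht) x

@[simp] theorem tR_apply (ht : IsTensorEmbedding t) (y : K) (x : H) : tR ht x y = t x y := rfl

theorem tL_norm (ht : IsTensorEmbedding t) (y : K) : ‖tL ht y‖ ≤ ‖y‖ :=
  LinearMap.mkContinuous_norm_le _ (norm_nonneg _) _

theorem tR_norm (ht : IsTensorEmbedding t) (x : H) : ‖tR ht x‖ ≤ ‖x‖ :=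
  tL_norm _ _

@[simp] theorem tL_adj (ht : IsTensorEmbedding t) (y y' : K) (x : H) :
    adjoint (tL ht y) (t x y') = ⟪y, y'⟫ • x := by
  apply ext_inner_left ℂ
  intro v
  rw [ContinuousLinearMap.adjoint_inner_right, tL_apply, te_inner ht, inner_smul_right, mul_comm]

@[simp] theorem tR_adj (ht : IsTensorEmbedding t) (x x' : H) (y : K) :
    adjoint (tR ht x) (t x' y) = ⟪x, x'⟫ • y :=
  tL_adj (te_flip ht) x x' y

theorem te_dense (ht : IsTensorEmbedding t) :
    Dense (Submodule.span ℂ {z | ∃ x y, z = t x y} : Set T) := by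
  rw [dense_iff_closure_eq]
  have := ht.2.2.2.2.2
  rw [← Submodule.topologicalClosure_coe, this]; rfl

theorem te_ext {E : Type*} [NormedAddCommGroup E] [NormedSpace ℂ E] (ht : IsTensorEmbedding t)
    {A B : T →L[ℂ] E}
    (h : ∀ x y, A (t x y) = B (t x y)) : A = B := by
  apply ContinuousLinearMap.ext_on (te_dense ht)
  rintro _ ⟨x, y, rfl⟩
  exact h x y

theorem te_zero (ht : IsTensorEmbedding t) {z : T} (h : ∀ x y, ⟪t x y, z⟫ = 0) : z = 0 := by
  have : innerSL ℂ z = 0 := by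
    apply te_ext ht
    intro x y
    simp [innerSL_apply_apply, ← inner_conj_symm z, h]
  have h2 : innerSL ℂ z z = 0 := by rw [this]; rfl
  simpa using h2

/-- isometric version -/
def tLi (ht : IsTensorEmbedding t) (y : K) (hy : ‖y‖ = 1) : H →ₗᵢ[ℂ] T :=
  { toLinearMap := (tL ht y).toLinearMap
    norm_map' := fun x => by simp [te_norm ht, hy] }

variable {κ : Type*}

theorem isHS (ht : IsTensorEmbedding t) (e : HilbertBasis κ ℂ K) :
    IsHilbertSum ℂ (fun _ : κ => H) (fun k => tLi ht (e k) (e.orthonormal.1 k)) := by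
  apply IsHilbertSum.mk
  · intro i j hij v w
    show ⟪t v (e i), t w (e j)⟫ = 0
    rw [te_inner ht, e.orthonormal.2 hij, mul_zero]
  · rw [← ht.2.2.2.2.2]
    set R := (⨆ i, LinearMap.range (tLi ht (e i) (e.orthonormal.1 i)).toLinearMap).topologicalClosure
    have hc : IsClosed (R : Set T) := Submodule.isClosed_topologicalClosure _
    refine Submodule.topologicalClosure_minimal _ (Submodule.span_le.2 ?_) hc
    rintro _ ⟨x, y, rfl⟩
    have h1 : ∀ y ∈ (Submodule.span ℂ (range e)), t x y ∈ R := by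
      intro y hy
      have : Submodule.span ℂ (range e) ≤ R.comap (tR ht x).toLinearMap := by
        rw [Submodule.span_le]
        rintro _ ⟨i, rfl⟩
        apply Submodule.le_topologicalClosure
        exact Submodule.mem_iSup_of_mem i ⟨x, rfl⟩
      exact this hy
    have h2 : y ∈ closure (Submodule.span ℂ (range e) : Set K) := by
      rw [← Submodule.topologicalClosure_coe, e.dense_span]; trivial
    have h3 : IsClosed ((tR ht x) ⁻¹' (R : Set T)) := hc.preimage (tR ht x).continuous
    exact closure_minimal (fun y hy => h1 y hy) h3 h2

/-- unitary to an `ℓ²` sum -/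
def uni (ht : IsTensorEmbedding t) (e : HilbertBasis κ ℂ K) : T ≃ₗᵢ[ℂ] L2 κ H :=
  (isHS ht e).linearIsometryEquiv

theorem uni_tensor (ht : IsTensorEmbedding t) (e : HilbertBasis κ ℂ K) (x : H) (y : K) (k : κ) :
    uni ht e (t x y) k = ⟪e k, y⟫ • x := by
  classical
  apply ext_inner_left ℂ
  intro v
  rw [← lp.inner_single_left (𝕜 := ℂ) k v (uni ht e (t x y)), ← LinearIsometryEquiv.inner_map_map
    (uni ht e).symm, LinearIsometryEquiv.symm_apply_apply]
  have : (uni ht e).symm (lp.single 2 k v) = t v (e k) :=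
    (isHS ht e).linearIsometryEquiv_symm_apply_single v
  rw [this, te_inner ht, inner_smul_right, mul_comm]

theorem exists_left (ht : IsTensorEmbedding t) (ht' : IsTensorEmbedding t') (S : H →L[ℂ] H') :
    ∃ W : T →L[ℂ] T', ‖W‖ ≤ ‖S‖ ∧ ∀ x y, W (t x y) = t' (S x) y := by
  obtain ⟨w, e, he⟩ := exists_hilbertBasis ℂ K
  refine ⟨((uni ht' e).symm : _ →L[ℂ] T') ∘L amp w S ∘L ((uni ht e : T →L[ℂ] _)), ?_, ?_⟩
  · refine ContinuousLinearMap.opNorm_le_bound _ (norm_nonneg _) fun z => ?_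
    simp only [ContinuousLinearMap.comp_apply]
    erw [LinearIsometryEquiv.norm_map]
    refine ((amp w S).le_opNorm _).trans ?_
    erw [LinearIsometryEquiv.norm_map]
    exact mul_le_mul_of_nonneg_right (amp_norm_le S) (norm_nonneg _)
  · intro x y
    simp only [ContinuousLinearMap.comp_apply]
    change (uni ht' e).symm (amp w S (uni ht e (t x y))) = _
    rw [LinearIsometryEquiv.symm_apply_eq]
    ext k
    rw [amp_apply, uni_tensor, uni_tensor, map_smul]

/-- The standard tensor embedding into `ℓ²(κ, H)`. -/
def stdT (e : HilbertBasis κ ℂ K) (x : H) (y : K) : L2 κ H :=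
  mkL2 (fun k => ⟪e k, y⟫ • x) (by
    have h : Summable fun k => ‖⟪e k, y⟫‖ ^ 2 := by
      have := L2.summable (e.repr y)
      simpa [e.repr_apply_apply] using this
    simpa [norm_smul, mul_pow] using h.mul_right (‖x‖ ^ 2))

theorem stdT_apply (e : HilbertBasis κ ℂ K) (x : H) (y : K) (k : κ) :
    stdT e x y k = ⟪e k, y⟫ • x := rfl

theorem stdT_te (e : HilbertBasis κ ℂ K) : IsTensorEmbedding (stdT e : H → K → L2 κ H) := by
  classical
  refine ⟨?_, ?_, ?_, ?_, ?_, ?_⟩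
  · intro x x' y; ext k; simp [stdT_apply]
  · intro x y y'; ext k; simp [stdT_apply, add_smul, inner_add_right]
  · intro c x y; ext k; simp only [stdT_apply, lp.coeFn_smul, Pi.smul_apply]; rw [smul_comm]
  · intro c x y; ext k; simp [stdT_apply, inner_smul_right, mul_smul]
  · intro x x' y y'
    rw [lp.inner_eq_tsum, ← e.tsum_inner_mul_inner y y', ← tsum_mul_left]
    congr 1; ext k
    rw [stdT_apply, stdT_apply, inner_smul_left, inner_smul_right, inner_conj_symm]
    ring
  · rw [eq_top_iff]
    intro f _
    have hs := lp.hasSum_single (p := 2) (by norm_num) f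
    refine mem_closure_of_tendsto hs (Filter.Eventually.of_forall fun s => ?_)
    refine Submodule.sum_mem _ fun k _ => Submodule.subset_span ⟨f k, e k, ?_⟩
    ext j
    rw [stdT_apply, lp.single_apply]
    by_cases hj : j = k
    · subst hj
      simp [e.orthonormal.1 j]
    · simp [hj, orthonormal_iff_ite.1 e.orthonormal]

theorem countable_basis [TopologicalSpace.SeparableSpace K] (e : HilbertBasis κ ℂ K) :
    Countable κ := by
  refine Pairwise.countable_of_isOpen_disjoint (s := fun k => Metric.ball (e k) (1/2))
    ?_ (fun k => Metric.isOpen_ball) (fun k => ⟨e k, by simp⟩)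
  intro i j hij
  apply Metric.ball_disjoint_ball
  have : dist (e i) (e j) ^ 2 = 2 := by
    rw [dist_eq_norm, @norm_sub_sq ℂ, e.orthonormal.1, e.orthonormal.1, e.orthonormal.2 hij]
    norm_num
  have h0 : 0 ≤ dist (e i) (e j) := dist_nonneg
  nlinarith

theorem normal_amp_aux (ξ : L2 ℕ (L2 κ H)) :
    Summable fun p : ℕ × κ => ‖ξ p.1 p.2‖ ^ 2 := by
  rw [summable_prod_of_nonneg (fun _ => by positivity)]
  refine ⟨fun n => L2.summable (ξ n), ?_⟩
  simp_rw [← L2.norm_sq]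
  exact L2.summable ξ

theorem normal_amp [Countable κ] {f : (L2 κ H →L[ℂ] L2 κ K) → ℂ} (hf : Normal f) :
    Normal (fun R : H →L[ℂ] K => f (amp κ R)) := by
  obtain ⟨ξ, η, h⟩ := hf
  convert normal_of_countable (mkL2 _ (normal_amp_aux ξ)) (mkL2 _ (normal_amp_aux η)) using 2 with R
  rw [h, lp.inner_eq_tsum, lp.inner_eq_tsum, Summable.tsum_prod]
  · congr 1
  · exact lp.summable_inner (𝕜 := ℂ) (mkL2 _ (normal_amp_aux η)) (amp (ℕ × κ) R (mkL2 _ (normal_amp_aux ξ)))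

end Ten
end
end OSH

namespace OSH
noncomputable section
section Ten2
variable {H₁ H₂ K₁ K₂ T₁ T₂ : Type*}
  [NormedAddCommGroup H₁] [InnerProductSpace ℂ H₁] [CompleteSpace H₁]
  [NormedAddCommGroup H₂] [InnerProductSpace ℂ H₂] [CompleteSpace H₂]
  [NormedAddCommGroup K₁] [InnerProductSpace ℂ K₁] [CompleteSpace K₁]
  [NormedAddCommGroup K₂] [InnerProductSpace ℂ K₂] [CompleteSpace K₂]
  [NormedAddCommGroup T₁] [InnerProductSpace ℂ T₁] [CompleteSpace T₁]
  [NormedAddCommGroup T₂] [InnerProductSpace ℂ T₂] [CompleteSpace T₂]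
  {t₁ : H₁ → K₁ → T₁} {t₂ : H₂ → K₂ → T₂}

theorem exists_tens' {κ : Type*} (ht₁ : IsTensorEmbedding t₁) (ht₂ : IsTensorEmbedding t₂)
    (f : HilbertBasis κ ℂ H₂) (S : H₁ →L[ℂ] H₂) :
    ∃ (A : T₁ →L[ℂ] L2 κ K₁) (B : L2 κ K₂ →L[ℂ] T₂), ‖A‖ ≤ ‖S‖ ∧ ‖B‖ ≤ 1 ∧
      ∀ R : K₁ →L[ℂ] K₂, IsElemTensor t₁ t₂ (B ∘L amp κ R ∘L A) S R := by
  obtain ⟨A, hA, hA'⟩ := exists_left ht₁ (te_flip (stdT_te (H := K₁) f)) S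
  refine ⟨A, ((uni (te_flip ht₂) f).symm : _ →L[ℂ] T₂), hA, ?_, fun R x y => ?_⟩
  · refine ContinuousLinearMap.opNorm_le_bound _ zero_le_one fun z => ?_
    erw [LinearIsometryEquiv.norm_map]
    simp
  · change (uni (te_flip ht₂) f).symm (amp κ R (A (t₁ x y))) = _
    rw [LinearIsometryEquiv.symm_apply_eq, hA']
    ext k
    have := uni_tensor (te_flip ht₂) f (R y) (S x) k
    rw [this, amp_apply, stdT_apply, map_smul]

theorem exists_tens (ht₁ : IsTensorEmbedding t₁) (ht₂ : IsTensorEmbedding t₂)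
    (S : H₁ →L[ℂ] H₂) (R : K₁ →L[ℂ] K₂) :
    ∃ W : T₁ →L[ℂ] T₂, IsElemTensor t₁ t₂ W S R ∧ ‖W‖ ≤ ‖S‖ * ‖R‖ := by
  obtain ⟨w, f, -⟩ := exists_hilbertBasis ℂ H₂
  obtain ⟨A, B, hA, hB, h⟩ := exists_tens' ht₁ ht₂ f S
  refine ⟨_, h R, ?_⟩
  calc _ ≤ ‖B‖ * (‖amp w R‖ * ‖A‖) := (ContinuousLinearMap.opNorm_comp_le _ _).trans
          (mul_le_mul_of_nonneg_left (ContinuousLinearMap.opNorm_comp_le _ _) (norm_nonneg _))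
    _ ≤ 1 * (‖R‖ * ‖S‖) := by
        gcongr
        exact amp_norm_le R
    _ = _ := by ring

/-- The elementary tensor operator. -/
def tens (ht₁ : IsTensorEmbedding t₁) (ht₂ : IsTensorEmbedding t₂)
    (S : H₁ →L[ℂ] H₂) (R : K₁ →L[ℂ] K₂) : T₁ →L[ℂ] T₂ := (exists_tens ht₁ ht₂ S R).choose

variable (ht₁ : IsTensorEmbedding t₁) (ht₂ : IsTensorEmbedding t₂)

@[simp] theorem tens_apply (S : H₁ →L[ℂ] H₂) (R : K₁ →L[ℂ] K₂) (x y) :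
    tens ht₁ ht₂ S R (t₁ x y) = t₂ (S x) (R y) := (exists_tens ht₁ ht₂ S R).choose_spec.1 x y

theorem tens_norm (S : H₁ →L[ℂ] H₂) (R : K₁ →L[ℂ] K₂) :
    ‖tens ht₁ ht₂ S R‖ ≤ ‖S‖ * ‖R‖ := (exists_tens ht₁ ht₂ S R).choose_spec.2

theorem elem_eq {W : T₁ →L[ℂ] T₂} {S : H₁ →L[ℂ] H₂} {R : K₁ →L[ℂ] K₂}
    (h : IsElemTensor t₁ t₂ W S R) : W = tens ht₁ ht₂ S R :=
  te_ext ht₁ fun x y => by rw [h x y, tens_apply]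

theorem tens_elem (S : H₁ →L[ℂ] H₂) (R : K₁ →L[ℂ] K₂) :
    IsElemTensor t₁ t₂ (tens ht₁ ht₂ S R) S R := fun x y => tens_apply ht₁ ht₂ S R x y

theorem Elem_eq (V : Set (H₁ →L[ℂ] H₂)) (U : Set (K₁ →L[ℂ] K₂)) :
    Elem t₁ t₂ V U = {W | ∃ S ∈ V, ∃ R ∈ U, W = tens ht₁ ht₂ S R} := by
  ext W
  constructor
  · rintro ⟨S, hS, R, hR, h⟩
    exact ⟨S, hS, R, hR, elem_eq ht₁ ht₂ h⟩
  · rintro ⟨S, hS, R, hR, rfl⟩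
    exact ⟨S, hS, R, hR, tens_elem ht₁ ht₂ S R⟩

theorem tens_mem_Elem {V : Set (H₁ →L[ℂ] H₂)} {U : Set (K₁ →L[ℂ] K₂)} {S R} (hS : S ∈ V)
    (hR : R ∈ U) : tens ht₁ ht₂ S R ∈ Elem t₁ t₂ V U := ⟨S, hS, R, hR, tens_elem ht₁ ht₂ S R⟩

theorem normal_tens [TopologicalSpace.SeparableSpace H₂] (S : H₁ →L[ℂ] H₂)
    {f : (T₁ →L[ℂ] T₂) → ℂ} (hf : Normal f) :
    Normal (fun R : K₁ →L[ℂ] K₂ => f (tens ht₁ ht₂ S R)) := by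
  obtain ⟨w, b, -⟩ := exists_hilbertBasis ℂ H₂
  obtain ⟨A, B, hA, hB, h⟩ := exists_tens' ht₁ ht₂ b S
  haveI := countable_basis b
  have := normal_amp (hf.comp A B)
  convert this using 3 with R
  exact (elem_eq ht₁ ht₂ (h R)).symm

/-- slices -/
def sl (u : H₁) (v : H₂) (T : T₁ →L[ℂ] T₂) : K₁ →L[ℂ] K₂ :=
  adjoint (tR ht₂ v) ∘L T ∘L tR ht₁ u

theorem sl_inner (u : H₁) (v : H₂) (T : T₁ →L[ℂ] T₂) (y : K₁) (z : K₂) :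
    ⟪z, sl ht₁ ht₂ u v T y⟫ = ⟪t₂ v z, T (t₁ u y)⟫ := by
  simp [sl, ContinuousLinearMap.adjoint_inner_right]

theorem sl_tens (u : H₁) (v : H₂) (S : H₁ →L[ℂ] H₂) (R : K₁ →L[ℂ] K₂) :
    sl ht₁ ht₂ u v (tens ht₁ ht₂ S R) = ⟪v, S u⟫ • R := by
  ext y; simp [sl]

theorem sl_norm (u : H₁) (v : H₂) (T : T₁ →L[ℂ] T₂) :
    ‖sl ht₁ ht₂ u v T‖ ≤ ‖T‖ * ‖u‖ * ‖v‖ := by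
  calc _ ≤ ‖adjoint (tR ht₂ v)‖ * (‖T‖ * ‖tR ht₁ u‖) :=
        (ContinuousLinearMap.opNorm_comp_le _ _).trans
          (mul_le_mul_of_nonneg_left (ContinuousLinearMap.opNorm_comp_le _ _) (norm_nonneg _))
    _ ≤ ‖v‖ * (‖T‖ * ‖u‖) := by
        rw [LinearIsometryEquiv.norm_map]
        gcongr
        · exact tR_norm _ _
        · exact tR_norm _ _
    _ = _ := by ring

/-- `a ⊗ 1`. -/
def ap (a : H₁ →L[ℂ] H₁) : T₁ →L[ℂ] T₁ := tens ht₁ ht₁ a 1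

@[simp] theorem ap_apply (a : H₁ →L[ℂ] H₁) (x y) : ap ht₁ a (t₁ x y) = t₁ (a x) y := by
  simp [ap]

theorem ap_mul (a b : H₁ →L[ℂ] H₁) : ap ht₁ (a * b) = ap ht₁ a * ap ht₁ b :=
  te_ext ht₁ fun x y => by simp
theorem ap_add (a b : H₁ →L[ℂ] H₁) : ap ht₁ (a + b) = ap ht₁ a + ap ht₁ b :=
  te_ext ht₁ fun x y => by simp [ht₁.1]
theorem ap_smul (c : ℂ) (b : H₁ →L[ℂ] H₁) : ap ht₁ (c • b) = c • ap ht₁ b :=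
  te_ext ht₁ fun x y => by simp [ht₁.2.2.1]
theorem ap_one : ap ht₁ (1 : H₁ →L[ℂ] H₁) = 1 :=
  te_ext ht₁ fun x y => by simp
theorem ap_sub (a b : H₁ →L[ℂ] H₁) : ap ht₁ (a - b) = ap ht₁ a - ap ht₁ b := by
  rw [eq_sub_iff_add_eq, ← ap_add, sub_add_cancel]
theorem ap_zero : ap ht₁ (0 : H₁ →L[ℂ] H₁) = 0 := by
  have := ap_sub ht₁ 0 0; simpa using this
theorem ap_sum {α : Type*} (s : Finset α) (a : α → (H₁ →L[ℂ] H₁)) :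
    ap ht₁ (∑ i ∈ s, a i) = ∑ i ∈ s, ap ht₁ (a i) :=
  map_sum (AddMonoidHom.mk' (ap ht₁) (ap_add ht₁)) a s

theorem ap_adjoint (a : H₁ →L[ℂ] H₁) : adjoint (ap ht₁ a) = ap ht₁ (adjoint a) := by
  refine te_ext ht₁ fun x y => ?_
  rw [← sub_eq_zero]
  refine te_zero ht₁ fun x' y' => ?_
  rw [inner_sub_right, ContinuousLinearMap.adjoint_inner_right, ap_apply, ap_apply, te_inner ht₁,
    te_inner ht₁, ContinuousLinearMap.adjoint_inner_right, sub_self]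

theorem ap_norm (a : H₁ →L[ℂ] H₁) : ‖ap ht₁ a‖ ≤ ‖a‖ := by
  refine (tens_norm ht₁ ht₁ a 1).trans ?_
  calc _ ≤ ‖a‖ * 1 := mul_le_mul_of_nonneg_left ContinuousLinearMap.norm_id_le (norm_nonneg _)
    _ = _ := mul_one _

theorem ap_tens_ap (b : H₂ →L[ℂ] H₂) (a : H₁ →L[ℂ] H₁) (S : H₁ →L[ℂ] H₂) (R : K₁ →L[ℂ] K₂) :
    ap ht₂ b ∘L tens ht₁ ht₂ S R ∘L ap ht₁ a = tens ht₁ ht₂ (b ∘L S ∘L a) R :=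
  te_ext ht₁ fun x y => by simp

theorem tL_ap (a : H₁ →L[ℂ] H₁) (y : K₁) :
    adjoint (tL ht₁ y) ∘L ap ht₁ a = a ∘L adjoint (tL ht₁ y) :=
  te_ext ht₁ fun x y' => by simp

theorem eq_zero_of_tL {z : T₁} (h : ∀ y, adjoint (tL ht₁ y) z = 0) : z = 0 :=
  te_zero ht₁ fun x y => by
    rw [← tL_apply ht₁, ← ContinuousLinearMap.adjoint_inner_right, h, inner_zero_right]

theorem ap_ker {a b : H₁ →L[ℂ] H₁} (hab : ∀ x, a x = 0 → b x = 0) {z : T₁} (hz : ap ht₁ a z = 0) :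
    ap ht₁ b z = 0 := by
  refine eq_zero_of_tL ht₁ fun y => ?_
  have h1 := congrArg (fun A => A z) (tL_ap ht₁ b y)
  have h2 := congrArg (fun A => A z) (tL_ap ht₁ a y)
  simp only [ContinuousLinearMap.comp_apply, hz, map_zero] at h1 h2
  rw [h1]
  exact hab _ h2.symm

end Ten2
end
end OSH

namespace OSH
noncomputable section
section LL
variable {E F : Type*} [NormedAddCommGroup E] [InnerProductSpace ℂ E] [CompleteSpace E]
  [NormedAddCommGroup F] [InnerProductSpace ℂ F]

/-- closed linear span -/
def cspan (G : Set E) : Submodule ℂ E := (Submodule.span ℂ G).topologicalClosure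

theorem isClosed_cspan (G : Set E) : IsClosed (cspan G : Set E) :=
  Submodule.isClosed_topologicalClosure _

theorem subset_cspan (G : Set E) : G ⊆ cspan G :=
  Submodule.subset_span.trans (Submodule.le_topologicalClosure _)

theorem cspan_le {G : Set E} {M : Submodule ℂ E} (hM : IsClosed (M : Set E)) (h : G ⊆ M) :
    cspan G ≤ M :=
  Submodule.topologicalClosure_minimal _ (Submodule.span_le.2 h) hM

theorem cspan_map {G : Set E} {M : Submodule ℂ F} (hM : IsClosed (M : Set F)) (A : E →L[ℂ] F)
    (h : ∀ x ∈ G, A x ∈ M) {x : E} (hx : x ∈ cspan G) : A x ∈ M := by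
  have : cspan G ≤ M.comap A.toLinearMap :=
    cspan_le (hM.preimage A.continuous) h
  exact this hx

theorem cspan_hasProj (G : Set E) : (cspan G).HasOrthogonalProjection := by
  have : CompleteSpace (cspan G) := (isClosed_cspan G).completeSpace_coe
  infer_instance

theorem L_lemma (𝓑 Q : Set (E →L[ℂ] E)) (h1 : 1 ∈ 𝓑) (hQ : Q ⊆ 𝓑)
    (hmul : ∀ a ∈ 𝓑, ∀ b ∈ 𝓑, a * b ∈ 𝓑) (hadj : ∀ a ∈ 𝓑, adjoint a ∈ 𝓑) (η : E) :
    ∃ v, η - v ∈ cspan {z | ∃ b ∈ 𝓑, ∃ q ∈ Q, z = b (q η)} ∧ ∀ q ∈ Q, q v = 0 := by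
  set G := {z | ∃ b ∈ 𝓑, ∃ q ∈ Q, z = b (q η)} with hG
  have := cspan_hasProj G
  have hinv : ∀ b ∈ 𝓑, ∀ x ∈ cspan G, b x ∈ cspan G := by
    intro b hb x hx
    refine cspan_map (isClosed_cspan G) b ?_ hx
    rintro _ ⟨c, hc, q, hq, rfl⟩
    exact subset_cspan G ⟨b * c, hmul b hb c hc, q, hq, rfl⟩
  refine ⟨η - (cspan G).starProjection η, by simp, fun q hq => ?_⟩
  have hv : η - (cspan G).starProjection η ∈ (cspan G)ᗮ :=
    Submodule.sub_starProjection_mem_orthogonal η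
  have a1 : q (η - (cspan G).starProjection η) ∈ cspan G := by
    rw [map_sub]
    refine sub_mem (subset_cspan G ⟨1, h1, q, hq, rfl⟩) (hinv q (hQ hq) _ ?_)
    exact Submodule.starProjection_apply_mem _ _
  have a2 : q (η - (cspan G).starProjection η) ∈ (cspan G)ᗮ := by
    rw [Submodule.mem_orthogonal]
    intro u hu
    rw [← ContinuousLinearMap.adjoint_inner_left]
    exact (Submodule.mem_orthogonal _ _).1 hv _ (hinv _ (hadj _ (hQ hq)) u hu)
  have := (Submodule.mem_orthogonal _ _).1 a2 _ a1
  exact inner_self_eq_zero.1 this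

end LL

section Erdos
variable {H : Type*} [NormedAddCommGroup H] [InnerProductSpace ℂ H] [CompleteSpace H]

/-- projection as an operator, for arbitrary submodule (meant for closed ones) -/
def pr (M : Submodule ℂ H) : H →L[ℂ] H :=
  haveI : M.topologicalClosure.HasOrthogonalProjection := by
    have : CompleteSpace M.topologicalClosure :=
      (Submodule.isClosed_topologicalClosure M).completeSpace_coe
    infer_instance
  M.topologicalClosure.starProjection

theorem pr_eq (M : Submodule ℂ H) (hM : IsClosed (M : Set H)) [M.HasOrthogonalProjection] :
    pr M = M.starProjection := by
  unfold pr
  congr 1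
  exact IsClosed.submodule_topologicalClosure_eq hM

theorem hasProj_of_closed {M : Submodule ℂ H} (hM : IsClosed (M : Set H)) :
    M.HasOrthogonalProjection := by
  have : CompleteSpace M := hM.completeSpace_coe
  infer_instance

theorem pr_mem {M : Submodule ℂ H} (hM : IsClosed (M : Set H)) (x : H) : pr M x ∈ M := by
  have := hasProj_of_closed hM
  rw [pr_eq M hM]; exact Submodule.starProjection_apply_mem _ _

theorem pr_eq_self {M : Submodule ℂ H} (hM : IsClosed (M : Set H)) {x : H} :
    pr M x = x ↔ x ∈ M := by
  have := hasProj_of_closed hM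
  rw [pr_eq M hM]; exact Submodule.starProjection_eq_self_iff

theorem pr_inner {M : Submodule ℂ H} (hM : IsClosed (M : Set H)) (x y : H) :
    ⟪pr M x, y⟫ = ⟪x, pr M y⟫ := by
  have := hasProj_of_closed hM
  rw [pr_eq M hM]; exact Submodule.inner_starProjection_left_eq_right _ _ _

theorem pr_idem {M : Submodule ℂ H} (hM : IsClosed (M : Set H)) : pr M ∘L pr M = pr M := by
  ext x; exact (pr_eq_self hM).2 (pr_mem hM x)

theorem pr_selfadj {M : Submodule ℂ H} (hM : IsClosed (M : Set H)) : adjoint (pr M) = pr M := by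
  symm
  rw [ContinuousLinearMap.eq_adjoint_iff]
  exact pr_inner hM

theorem pr_comp_of_le {M M' : Submodule ℂ H} (hM : IsClosed (M : Set H))
    (hM' : IsClosed (M' : Set H)) (h : M ≤ M') (x : H) : pr M' (pr M x) = pr M x ∧
      pr M (pr M' x) = pr M x := by
  refine ⟨(pr_eq_self hM').2 (h (pr_mem hM x)), ?_⟩
  apply ext_inner_left ℂ
  intro v
  rw [← pr_inner hM, ← pr_inner hM', (pr_eq_self hM').2 (h (pr_mem hM v)), pr_inner hM]

theorem pr_inner_pr {M : Submodule ℂ H} (hM : IsClosed (M : Set H)) (x y : H) :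
    ⟪pr M x, pr M y⟫ = ⟪x, pr M y⟫ := by
  rw [pr_inner hM, (pr_eq_self hM).2 (pr_mem hM y)]

theorem pr_diff_norm {M M' : Submodule ℂ H} (hM : IsClosed (M : Set H))
    (hM' : IsClosed (M' : Set H)) (h : M ≤ M') (x : H) :
    ‖pr M' x - pr M x‖ ^ 2 = ‖pr M' x‖ ^ 2 - ‖pr M x‖ ^ 2 := by
  rw [@norm_sub_sq ℂ]
  have : ⟪pr M' x, pr M x⟫ = ⟪pr M x, pr M x⟫ := by
    rw [pr_inner hM', (pr_comp_of_le hM hM' h x).1, pr_inner_pr hM]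
  have h2 : RCLike.re ⟪pr M x, pr M x⟫ = ‖pr M x‖ ^ 2 := inner_self_eq_norm_sq (𝕜 := ℂ) _
  rw [this, h2]
  ring

theorem pr_diff_inner {M M' : Submodule ℂ H} (hM : IsClosed (M : Set H))
    (hM' : IsClosed (M' : Set H)) (h : M ≤ M') (x g : H) :
    ⟪x, pr M' g - pr M g⟫ = ⟪pr M' x - pr M x, pr M' g - pr M g⟫ := by
  simp only [inner_sub_left, inner_sub_right]
  rw [pr_inner_pr hM', pr_inner_pr hM, pr_inner hM', (pr_comp_of_le hM hM' h g).1,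
    pr_inner hM x, (pr_comp_of_le hM hM' h g).2]
  ring

/-- Chains: sup continuity. -/
theorem pr_sup_approx {S : Set (Submodule ℂ H)} (hne : S.Nonempty)
    (hc : ∀ M ∈ S, IsClosed (M : Set H)) (hS : IsChain (· ≤ ·) S) (g : H) {ε : ℝ} (hε : 0 < ε) :
    ∃ M ∈ S, ‖pr (sSup S).topologicalClosure g - pr M g‖ ≤ ε := by
  have i1 : ∀ M : S, (M : Submodule ℂ H).HasOrthogonalProjection :=
    fun M => hasProj_of_closed (hc M M.2)
  have hcl := Submodule.isClosed_topologicalClosure (sSup S)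
  have e : sSup S = ⨆ M : S, (M : Submodule ℂ H) := sSup_eq_iSup' S
  rw [e] at hcl ⊢
  have i2 := hasProj_of_closed hcl
  have : Nonempty S := hne.to_subtype
  have : IsDirectedOrder S := ⟨fun a b => by
    rcases hS.total a.2 b.2 with h | h
    · exact ⟨b, h, le_refl _⟩
    · exact ⟨a, le_refl _, h⟩⟩
  have ht := Submodule.starProjection_tendsto_closure_iSup (𝕜 := ℂ)
    (fun M : S => (M : Submodule ℂ H)) (fun _ _ h => h) g
  obtain ⟨M, hM⟩ := (ht.eventually (Metric.ball_mem_nhds _ hε)).exists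
  refine ⟨M, M.2, ?_⟩
  have := Metric.mem_ball.1 hM
  rw [pr_eq _ hcl, pr_eq _ (hc M M.2), ← dist_eq_norm, dist_comm]
  exact this.le

theorem pr_orth {M : Submodule ℂ H} (hM : IsClosed (M : Set H)) (g : H) :
    pr Mᗮ g = g - pr M g := by
  have := hasProj_of_closed hM
  rw [pr_eq M hM, pr_eq _ (Submodule.isClosed_orthogonal M)]
  simp [Submodule.starProjection_orthogonal]

/-- Chains: inf continuity. -/
theorem pr_inf_approx {S : Set (Submodule ℂ H)} (hne : S.Nonempty)
    (hc : ∀ M ∈ S, IsClosed (M : Set H)) (hS : IsChain (· ≤ ·) S) (g : H) {ε : ℝ} (hε : 0 < ε) :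
    ∃ M ∈ S, ‖pr M g - pr (sInf S) g‖ ≤ ε := by
  obtain ⟨_, ⟨M, hM, rfl⟩, h⟩ := pr_sup_approx (S := (fun M => Mᗮ) '' S) (hne.image _)
    (by rintro _ ⟨M, -, rfl⟩; exact Submodule.isClosed_orthogonal M)
    (by
      rintro _ ⟨M, hM, rfl⟩ _ ⟨M', hM', rfl⟩ _
      rcases hS.total hM hM' with h | h
      · exact Or.inr (Submodule.orthogonal_le h)
      · exact Or.inl (Submodule.orthogonal_le h)) g hε
  have hinf : IsClosed ((sInf S : Submodule ℂ H) : Set H) := by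
    rw [Submodule.coe_sInf]
    exact isClosed_biInter fun M hM => hc M hM
  have key : (sSup ((fun M : Submodule ℂ H => Mᗮ) '' S)).topologicalClosure = (sInf S)ᗮ := by
    rw [← Submodule.orthogonal_orthogonal_eq_closure]
    congr 1
    rw [sSup_image, ← Submodule.iInf_orthogonal]
    rw [sInf_eq_iInf]
    refine iInf_congr fun M => ?_
    by_cases hM : M ∈ S
    · have := hasProj_of_closed (hc M hM)
      simp [hM, Submodule.orthogonal_orthogonal M]
    · simp [hM]
  refine ⟨M, hM, ?_⟩
  rw [key, pr_orth hinf, pr_orth (hc M hM)] at h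
  convert h using 2
  abel

end Erdos
end
end OSH

namespace OSH
noncomputable section
section E0
variable {H K : Type*} [NormedAddCommGroup H] [InnerProductSpace ℂ H] [CompleteSpace H]
  [NormedAddCommGroup K] [InnerProductSpace ℂ K] [CompleteSpace K]

def ro (u : K) (x : H) : H →L[ℂ] K := (innerSL ℂ x).smulRight u

@[simp] theorem ro_apply (u : K) (x z : H) : ro u x z = ⟪x, z⟫ • u := rfl

/-- rank-ones of a nest algebra -/
def R1 (N : Set (Submodule ℂ H)) : Set (H →L[ℂ] H) :=
  {A | ∃ u x, A = ro u x ∧ ∃ M ∈ N, u ∈ M ∧ ∀ M' ∈ N, M ≤ M' ∨ ∀ z ∈ M', ⟪x, z⟫ = 0}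

theorem R1_nestAlg {N : Set (Submodule ℂ H)} {A : H →L[ℂ] H} (hA : A ∈ R1 N) : A ∈ nestAlg N := by
  obtain ⟨u, x, rfl, M, hM, hu, h⟩ := hA
  intro p hp z hz
  rw [ro_apply]
  rcases h p hp with h | h
  · exact p.smul_mem _ (h hu)
  · rw [h z hz, zero_smul]; exact p.zero_mem

theorem nest_bot {N : Set (Submodule ℂ H)} (hN : IsNest N) : ⊥ ∈ N := by
  have := (hN.2.2 ∅ (empty_subset _)).2
  rwa [sSup_empty, IsClosed.submodule_topologicalClosure_eq] at this
  exact isClosed_singleton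

theorem nest_top {N : Set (Submodule ℂ H)} (hN : IsNest N) : ⊤ ∈ N := by
  have := (hN.2.2 ∅ (empty_subset _)).1
  rwa [sInf_empty] at this

theorem R1_mul {N : Set (Submodule ℂ H)} (hN : IsNest N) {A B : H →L[ℂ] H} (hA : A ∈ R1 N)
    (hB : B ∈ R1 N) : A ∘L B ∈ R1 N := by
  obtain ⟨u, x, rfl, M, hM, hu, h⟩ := hA
  obtain ⟨u', x', rfl, M2, hM2, hu', h'⟩ := hB
  have e : ro u x ∘L ro u' x' = ro (⟪x, u'⟫ • u) x' := by
    ext z; simp [smul_smul]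
  rw [e]
  by_cases h0 : ⟪x, u'⟫ = 0
  · refine ⟨_, _, rfl, ⊥, nest_bot hN, by simp [h0], fun M' _ => Or.inl bot_le⟩
  · refine ⟨_, _, rfl, M, hM, M.smul_mem _ hu, fun M' hM' => ?_⟩
    rcases h' M' hM' with h1 | h1
    · rcases h M2 hM2 with h2 | h2
      · exact Or.inl (h2.trans h1)
      · exact absurd (h2 _ hu') h0
    · exact Or.inr h1

def Good (N : Set (Submodule ℂ H)) (g : H) (δ : ℝ) : Set (Submodule ℂ H) :=
  {M | M ∈ N ∧ ∃ A ∈ Submodule.span ℂ (R1 N), ∀ w,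
    ‖⟪w, pr M g⟫‖ ^ 2 / 2 - δ * ‖pr M w‖ ^ 2 / 2 ≤ (⟪w, A w⟫).re}

theorem dperp {M M' M'' : Submodule ℂ H} (hM : IsClosed (M : Set H))
    (hM' : IsClosed (M' : Set H)) (h : M ≤ M') (h2 : M'' ≤ M) (g : H) :
    ∀ z ∈ M'', ⟪pr M' g - pr M g, z⟫ = 0 := by
  intro z hz
  rw [inner_sub_left, pr_inner hM', pr_inner hM, (pr_eq_self hM).2 (h2 hz),
    (pr_eq_self hM').2 (h (h2 hz)), sub_self]

theorem dbound {M M' : Submodule ℂ H} (hM : IsClosed (M : Set H))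
    (hM' : IsClosed (M' : Set H)) (h : M ≤ M') (g w : H) :
    ‖⟪w, pr M' g⟫ - ⟪w, pr M g⟫‖ ^ 2 ≤
      ‖pr M' g - pr M g‖ ^ 2 * (‖pr M' w‖ ^ 2 - ‖pr M w‖ ^ 2) := by
  rw [← inner_sub_right, pr_diff_inner hM hM' h, ← pr_diff_norm hM hM' h, ← mul_pow, mul_comm]
  gcongr
  exact norm_inner_le_norm _ _

theorem good_small {N : Set (Submodule ℂ H)} (hN : IsNest N) {g : H} {δ : ℝ}
    {M M' : Submodule ℂ H} (hM : M ∈ Good N g δ) (hM' : M' ∈ N) (h : M ≤ M')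
    (hd : ‖pr M' g - pr M g‖ ^ 2 ≤ δ) : M' ∈ Good N g δ := by
  obtain ⟨hMN, A, hA, hw⟩ := hM
  have c := hN.1 M hMN
  have c' := hN.1 M' hM'
  refine ⟨hM', A + ro (pr M g) (pr M' g - pr M g), add_mem hA (Submodule.subset_span
    ⟨_, _, rfl, M, hMN, pr_mem c g, fun M'' h'' => ?_⟩), fun w => ?_⟩
  · rcases hN.2.1.total hMN h'' with h1 | h1
    · exact Or.inl h1
    · exact Or.inr (dperp c c' h h1 g)
  · have b := dbound c c' h g w
    have b0 : 0 ≤ ‖pr M' w‖ ^ 2 - ‖pr M w‖ ^ 2 := by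
      rw [← pr_diff_norm c c' h]; positivity
    have b1 := b.trans (mul_le_mul_of_nonneg_right hd b0)
    have hA := hw w
    rw [add_apply, inner_add_right, ro_apply, inner_smul_right,
      ← inner_conj_symm _ w, inner_sub_right]
    set α := ⟪w, pr M g⟫
    set α' := ⟪w, pr M' g⟫
    rw [Complex.sq_norm, Complex.normSq_apply] at hA b1 ⊢
    simp only [Complex.add_re, Complex.mul_re, Complex.conj_re, Complex.conj_im, Complex.sub_re,
      Complex.sub_im] at hA b1 ⊢
    nlinarith

theorem good_gap {N : Set (Submodule ℂ H)} (hN : IsNest N) {g : H} {δ : ℝ} (hδ : 0 ≤ δ)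
    {M M' : Submodule ℂ H} (hM : M ∈ Good N g δ) (hM' : M' ∈ N) (h : M ≤ M')
    (hd : ∀ M'' ∈ N, M'' ≤ M ∨ M' ≤ M'') : M' ∈ Good N g δ := by
  obtain ⟨hMN, A, hA, hw⟩ := hM
  have c := hN.1 M hMN
  have c' := hN.1 M' hM'
  refine ⟨hM', A + ro (pr M' g) (pr M' g - pr M g), add_mem hA (Submodule.subset_span
    ⟨_, _, rfl, M', hM', pr_mem c' g, fun M'' h'' => ?_⟩), fun w => ?_⟩
  · rcases hd M'' h'' with h1 | h1
    · exact Or.inr (dperp c c' h h1 g)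
    · exact Or.inl h1
  · have b0 : 0 ≤ ‖pr M' w‖ ^ 2 - ‖pr M w‖ ^ 2 := by
      rw [← pr_diff_norm c c' h]; positivity
    have b1 := mul_nonneg hδ b0
    have hA := hw w
    rw [add_apply, inner_add_right, ro_apply, inner_smul_right,
      ← inner_conj_symm _ w, inner_sub_right]
    set α := ⟪w, pr M g⟫
    set α' := ⟪w, pr M' g⟫
    rw [Complex.sq_norm, Complex.normSq_apply] at hA ⊢
    simp only [Complex.add_re, Complex.mul_re, Complex.conj_re, Complex.conj_im, Complex.sub_re,
      Complex.sub_im] at hA ⊢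
    nlinarith [sq_nonneg (α'.re - α.re), sq_nonneg (α'.im - α.im)]

theorem good_top {N : Set (Submodule ℂ H)} (hN : IsNest N) (g : H) {δ : ℝ} (hδ : 0 < δ) :
    ⊤ ∈ Good N g δ := by
  have hs : 0 < Real.sqrt δ := Real.sqrt_pos.2 hδ
  have hsq : ∀ x : ℝ, 0 ≤ x → x ≤ Real.sqrt δ → x ^ 2 ≤ δ := fun x h0 hx => by
    have := Real.sq_sqrt hδ.le
    nlinarith
  have hRN : Good N g δ ⊆ N := fun M h => h.1
  have hbot : ⊥ ∈ Good N g δ := by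
    refine ⟨nest_bot hN, 0, zero_mem _, fun w => ?_⟩
    have hb : IsClosed ((⊥ : Submodule ℂ H) : Set H) := hN.1 _ (nest_bot hN)
    have e : ∀ x : H, pr ⊥ x = 0 := fun x => by simpa using pr_mem hb x
    simp [e]
  set Mi := (sSup (Good N g δ)).topologicalClosure with hMi
  have hMiN : Mi ∈ N := (hN.2.2 _ hRN).2
  have hle : ∀ M ∈ Good N g δ, M ≤ Mi := fun M h =>
    (le_sSup h).trans (Submodule.le_topologicalClosure _)
  have hMiR : Mi ∈ Good N g δ := by
    obtain ⟨M, hM, h⟩ := pr_sup_approx ⟨⊥, hbot⟩ (fun M h => hN.1 M (hRN h))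
      (hN.2.1.mono hRN) g hs
    exact good_small hN hM hMiN (hle M hM) (hsq _ (norm_nonneg _) h)
  by_contra htop
  set S := {M | M ∈ N ∧ ¬ M ≤ Mi} with hS
  have hSN : S ⊆ N := fun M h => h.1
  have hSge : ∀ M ∈ S, Mi ≤ M := fun M h => (hN.2.1.total h.1 hMiN).resolve_left h.2
  have htS : ⊤ ∈ S := ⟨nest_top hN, fun h => htop (by rwa [top_le_iff.1 h] at hMiR)⟩
  have hpN : sInf S ∈ N := (hN.2.2 S hSN).1
  have hpge : Mi ≤ sInf S := le_sInf hSge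
  by_cases hp : sInf S ≤ Mi
  · obtain ⟨M, hM, h⟩ := pr_inf_approx ⟨_, htS⟩ (fun M h => hN.1 M (hSN h))
      (hN.2.1.mono hSN) g hs
    rw [le_antisymm hp hpge] at h
    exact hM.2 (hle M (good_small hN hMiR hM.1 (hSge M hM) (hsq _ (norm_nonneg _) h)))
  · refine hp (hle _ (good_gap hN hδ.le hMiR hpN hpge fun M hM => ?_))
    by_cases h : M ≤ Mi
    · exact Or.inl h
    · exact Or.inr (sInf_le ⟨hM, h⟩)

theorem ro_norm (u : K) (x : H) : ‖ro u x‖ ≤ ‖x‖ * ‖u‖ := by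
  unfold ro
  rw [ContinuousLinearMap.norm_smulRight_apply, innerSL_apply_norm]

theorem ro_functional (x : H) (ξ : L2 ℕ H) (η : L2 ℕ K) :
    ∃ Φ : K →L[ℂ] ℂ, ∀ y, Φ y = ⟪η, amp ℕ (ro y x) ξ⟫ := by
  have h1 : ∀ y y', ro (y + y') x = ro y x + (ro y' x : H →L[ℂ] K) := by
    intros; ext z; simp
  have h2 : ∀ (c : ℂ) y, ro (c • y) x = c • (ro y x : H →L[ℂ] K) := by
    intros; ext z; simp [smul_smul, mul_comm]
  let f : K →ₗ[ℂ] ℂ :=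
    { toFun := fun y => ⟪η, amp ℕ (ro y x) ξ⟫
      map_add' := fun y y' => by rw [h1, amp_add, add_apply, inner_add_right]
      map_smul' := fun c y => by rw [h2, amp_smul, smul_apply, inner_smul_right]; rfl }
  refine ⟨f.mkContinuous (‖η‖ * ‖x‖ * ‖ξ‖) fun y => ?_, fun y => rfl⟩
  calc ‖⟪η, amp ℕ (ro y x) ξ⟫‖ ≤ ‖η‖ * ‖amp ℕ (ro y x) ξ‖ := norm_inner_le_norm _ _
    _ ≤ ‖η‖ * (‖amp ℕ (ro y x)‖ * ‖ξ‖) := by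
        gcongr; exact ContinuousLinearMap.le_opNorm _ _
    _ ≤ ‖η‖ * ((‖x‖ * ‖y‖) * ‖ξ‖) := by
        gcongr; exact (amp_norm_le _).trans (ro_norm _ _)
    _ = _ := by ring

theorem E0 {N : Set (Submodule ℂ H)} (hN : IsNest N) (ξ : L2 ℕ H) :
    ξ ∈ cspan {z | ∃ A ∈ R1 N, z = amp ℕ A ξ} := by
  set G := {z | ∃ A ∈ R1 N, z = amp ℕ A ξ} with hG
  have := cspan_hasProj G
  set v := ξ - (cspan G).starProjection ξ with hv
  have hvo : v ∈ (cspan G)ᗮ := Submodule.sub_starProjection_mem_orthogonal ξ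
  have h1 : ∀ A ∈ R1 N, ⟪v, amp ℕ A v⟫ = 0 := by
    intro A hA
    refine Submodule.inner_left_of_mem_orthogonal ?_ hvo
    rw [hv, map_sub]
    refine sub_mem (subset_cspan G ⟨A, hA, rfl⟩) ?_
    refine cspan_map (isClosed_cspan G) (amp ℕ A) ?_ (Submodule.starProjection_apply_mem _ ξ)
    rintro _ ⟨B, hB, rfl⟩
    refine subset_cspan G ⟨A ∘L B, R1_mul hN hA hB, ?_⟩
    rw [amp_comp]; rfl
  have h2 : ∀ A ∈ Submodule.span ℂ (R1 N), ⟪v, amp ℕ A v⟫ = 0 := by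
    intro A hA
    induction hA using Submodule.span_induction with
    | mem A hA => exact h1 A hA
    | zero => simp [amp_zero]
    | add A B _ _ a b => rw [amp_add, add_apply, inner_add_right, a, b, add_zero]
    | smul c A _ a => rw [amp_smul, smul_apply, inner_smul_right, a, mul_zero]
  have h3 : ∀ (i : ℕ) (g : H) (δ : ℝ), 0 < δ → ‖⟪v i, g⟫‖ ^ 2 ≤ δ * ‖v‖ ^ 2 := by
    intro i g δ hδ
    obtain ⟨-, A, hA, h⟩ := good_top hN g hδ
    have ht : ∀ x : H, pr ⊤ x = x := fun x => (pr_eq_self isClosed_univ).2 trivial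
    simp only [ht] at h
    have s1 := lp.hasSum_inner (𝕜 := ℂ) v (amp ℕ A v)
    rw [h2 A hA] at s1
    simp only [amp_apply] at s1
    have s2 := Complex.hasSum_re s1
    have s3 := (L2.summable v)
    have hs3 := s3.hasSum
    rw [← L2.norm_sq] at hs3
    have s4 := ((hs3.mul_left (δ/2)).add s2)
    have hnn : ∀ j, ‖⟪v j, g⟫‖ ^ 2 / 2 ≤ δ / 2 * ‖v j‖ ^ 2 + (⟪v j, A (v j)⟫).re := by
      intro j; linarith [h (v j)]
    have := le_hasSum s4 i (fun j _ => le_trans (by positivity) (hnn j))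
    have := (hnn i).trans this
    simp at this
    linarith
  have h4 : v = 0 := by
    ext i
    have : ‖⟪v i, v i⟫‖ ^ 2 ≤ 0 := by
      refine le_of_forall_pos_le_add fun ε hε => ?_
      have := h3 i (v i) (ε / (‖v‖ ^ 2 + 1)) (by positivity)
      refine this.trans ?_
      rw [zero_add, div_mul_eq_mul_div, div_le_iff₀ (by positivity)]
      nlinarith
    have : ⟪v i, v i⟫ = 0 := by
      have := pow_eq_zero_iff (two_ne_zero) |>.1 (le_antisymm this (by positivity))
      exact norm_eq_zero.1 this
    exact inner_self_eq_zero.1 this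
  rw [sub_eq_zero] at h4
  rw [h4]
  exact Submodule.starProjection_apply_mem _ ξ

theorem lemE {N : Set (Submodule ℂ H)} (hN : IsNest N) {V : Set (H →L[ℂ] K)}
    (hV : (Hull V : Set (H →L[ℂ] K)) = V) (hmod : ∀ v ∈ V, ∀ A ∈ nestAlg N, v ∘L A ∈ V)
    (S : H →L[ℂ] K) (hS : ∀ M ∈ N, ∀ x ∈ M, S x ∈ cspan {y | ∃ v ∈ V, ∃ z ∈ M, y = v z}) :
    S ∈ V := by
  rw [← hV]
  refine (mem_Hull' ).2 fun ξ η h => ?_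
  have key : ∀ A ∈ R1 N, ⟪η, amp ℕ (S ∘L A) ξ⟫ = 0 := by
    rintro A ⟨u, x, rfl, M, hM, hu, hx⟩
    have e : S ∘L ro u x = ro (S u) x := by ext z; simp
    rw [e]
    obtain ⟨Φ, hΦ⟩ := ro_functional (K := K) x ξ η
    rw [← hΦ]
    have := cspan_map (M := (⊥ : Submodule ℂ ℂ)) isClosed_singleton Φ ?_ (hS M hM u hu)
    · simpa using this
    rintro _ ⟨v, hv, z, hz, rfl⟩
    rw [hΦ]
    have e : ro (v z) x = v ∘L ro z x := by ext z; simp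
    rw [e]
    simp only [Submodule.mem_bot]
    exact h _ (hmod v hv _ (R1_nestAlg ⟨z, x, rfl, M, hM, hz, hx⟩))
  have := cspan_map (M := (⊥ : Submodule ℂ ℂ)) isClosed_singleton ((innerSL ℂ η) ∘L amp ℕ S) ?_
    (E0 hN ξ)
  · simpa using this
  rintro _ ⟨A, hA, rfl⟩
  have := key A hA
  rw [amp_comp] at this
  simpa using this

end E0
end
end OSH

namespace OSH
noncomputable section
section Pairs
variable {H H₁ H₂ : Type*} [NormedAddCommGroup H] [InnerProductSpace ℂ H] [CompleteSpace H]
  [NormedAddCommGroup H₁] [InnerProductSpace ℂ H₁] [CompleteSpace H₁]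
  [NormedAddCommGroup H₂] [InnerProductSpace ℂ H₂] [CompleteSpace H₂]

theorem masa_mem {D : StarSubalgebra ℂ (H →L[ℂ] H)} (hD : IsMasa D) {p : H →L[ℂ] H}
    (hp : star p = p) (hc : ∀ a ∈ D, a * p = p * a) : p ∈ D := by
  have h1 : ∀ a ∈ (D : Set (H →L[ℂ] H)) ∪ {p}, ∀ b ∈ (D : Set (H →L[ℂ] H)) ∪ {p},
      a * b = b * a := by
    rintro a (ha | rfl) b (hb | rfl)
    · exact hD.1 a ha b hb
    · exact hc a ha
    · exact (hc b hb).symm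
    · rfl
  have h2 : ∀ a ∈ (D : Set (H →L[ℂ] H)) ∪ {p}, ∀ b ∈ (D : Set (H →L[ℂ] H)) ∪ {p},
      a * star b = star b * a := by
    intro a ha b hb
    refine h1 a ha (star b) ?_
    rcases hb with hb | rfl
    · exact Or.inl (star_mem hb)
    · right; exact hp
  have hE := hD.2 (StarAlgebra.adjoin ℂ ((D : Set (H →L[ℂ] H)) ∪ {p})) ?_ ?_
  · rw [← hE]
    exact StarAlgebra.subset_adjoin ℂ _ (Or.inr rfl)
  · intro a ha b hb
    have i := StarAlgebra.isMulCommutative_adjoin ℂ h1 h2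
    have := i.is_comm.comm ⟨a, ha⟩ ⟨b, hb⟩
    exact congrArg Subtype.val this
  · intro a ha
    exact StarAlgebra.subset_adjoin ℂ _ (Or.inl ha)

theorem pr_masa {D : StarSubalgebra ℂ (H →L[ℂ] H)} (hD : IsMasa D) {M : Submodule ℂ H}
    (hM : IsClosed (M : Set H)) (hinv : ∀ a ∈ D, ∀ x ∈ M, a x ∈ M) : pr M ∈ D := by
  refine masa_mem hD (pr_selfadj hM) fun a ha => ?_
  have h : ∀ b ∈ D, ∀ x, pr M (b (pr M x)) = b (pr M x) := fun b hb x =>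
    (pr_eq_self hM).2 (hinv b hb _ (pr_mem hM x))
  ext x
  simp only [mul_apply_eq_comp]
  rw [← h a ha]
  apply ext_inner_left ℂ
  intro y
  rw [← pr_inner hM, ← ContinuousLinearMap.adjoint_inner_left, ← pr_inner hM,
    show pr M (adjoint a (pr M y)) = adjoint a (pr M y) from h _ (star_mem ha) y,
    ContinuousLinearMap.adjoint_inner_left, pr_inner hM]

theorem pairs {D₁ : StarSubalgebra ℂ (H₁ →L[ℂ] H₁)} {D₂ : StarSubalgebra ℂ (H₂ →L[ℂ] H₂)}
    (hD₁ : IsMasa D₁) (hD₂ : IsMasa D₂) {V : Set (H₁ →L[ℂ] H₂)} (hV : IsMasaBimodule D₁ D₂ V)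
    (hVn : IsNestBimodule V) : ∃ PP : Set ((H₁ →L[ℂ] H₁) × (H₂ →L[ℂ] H₂)),
      (∀ p ∈ PP, p.1 ∈ D₁ ∧ IsProj p.1 ∧ p.2 ∈ D₂ ∧ IsProj p.2 ∧
        (∀ v ∈ V, (1 - p.2) ∘L v ∘L p.1 = 0) ∧ ∀ X, p.2 ∘L X ∘L (1 - p.1) ∈ V) ∧
      ∀ S, (∀ p ∈ PP, p.2 ∘L S = S ∘L p.1) → S ∈ V := by
  obtain ⟨-, N₁, N₂, hN₁, hN₂, hmod⟩ := hVn
  have hHull := Hull_eq_of_wkClosed hV.1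
  have hmodr : ∀ v ∈ V, ∀ A ∈ nestAlg N₁, v ∘L A ∈ V := fun v hv A hA => 
    hmod v hv A hA 1 (fun p _ x hx => hx)
  let φ : Submodule ℂ H₁ → Submodule ℂ H₂ := fun N => cspan {y | ∃ v ∈ V, ∃ z ∈ N, y = v z}
  have hφc : ∀ N, IsClosed (φ N : Set H₂) := fun N => isClosed_cspan _
  have hφ : ∀ N, ∀ v ∈ V, ∀ z ∈ N, v z ∈ φ N := fun N v hv z hz =>
    subset_cspan _ ⟨v, hv, z, hz, rfl⟩
  have hφm : ∀ N M, N ≤ M → φ N ≤ φ M := by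
    intro N M h
    refine cspan_le (hφc M) ?_
    rintro _ ⟨v, hv, z, hz, rfl⟩
    exact hφ M v hv z (h hz)
  let ψ : Submodule ℂ H₁ → Submodule ℂ H₁ := fun N => ⨅ v : V, (φ N).comap v.1.toLinearMap
  have hψ : ∀ N x, x ∈ ψ N ↔ ∀ v ∈ V, v x ∈ φ N := by
    intro N x; simp [ψ, Submodule.mem_iInf]
  have hψc : ∀ N, IsClosed (ψ N : Set H₁) := by
    intro N
    simp only [ψ, Submodule.coe_iInf]
    exact isClosed_iInter fun v => (hφc N).preimage v.1.continuous
  have hle : ∀ N, N ≤ ψ N := fun N x hx => (hψ N x).2 fun v hv => hφ N v hv x hx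
  refine ⟨{p | ∃ N ∈ N₁, p = (pr (ψ N), pr (φ N))}, ?_, ?_⟩
  · rintro _ ⟨N, hN, rfl⟩
    refine ⟨pr_masa hD₁ (hψc N) ?_, ⟨pr_idem (hψc N), pr_selfadj (hψc N)⟩,
      pr_masa hD₂ (hφc N) ?_, ⟨pr_idem (hφc N), pr_selfadj (hφc N)⟩, ?_, ?_⟩
    · intro a ha x hx
      rw [hψ] at hx ⊢
      intro v hv
      have := hV.2 v hv a ha 1 (one_mem _)
      exact hx _ this
    · intro b hb x hx
      refine cspan_map (hφc N) b ?_ hx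
      rintro _ ⟨v, hv, z, hz, rfl⟩
      exact subset_cspan _ ⟨b ∘L v, hV.2 v hv 1 (one_mem _) b hb, z, hz, rfl⟩
    · intro v hv
      ext x
      have := (pr_eq_self (hφc N)).2 ((hψ N _).1 (pr_mem (hψc N) x) v hv)
      simp [this]
    · intro X
      refine lemE hN₁ hHull hmodr _ fun M hM x hx => ?_
      rcases hN₁.2.1.total hM hN with h | h
      · have := (pr_eq_self (hψc N)).2 (hle N (h hx))
        simp [this]
      · exact hφm N M h (pr_mem (hφc N) _)
  · intro S hS
    refine lemE hN₁ hHull hmodr _ fun M hM x hx => ?_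
    have h1 := congrArg (fun A => A x) (hS _ ⟨M, hM, rfl⟩)
    have h2 := (pr_eq_self (hψc M)).2 (hle M hx)
    simp only [ContinuousLinearMap.comp_apply, h2] at h1
    rw [← h1]
    exact pr_mem (hφc M) _

end Pairs

section Ult
open Filter Topology
variable {E F ι : Type*} [NormedAddCommGroup E] [InnerProductSpace ℂ E] [CompleteSpace E]
  [NormedAddCommGroup F] [InnerProductSpace ℂ F] [CompleteSpace F]

theorem wot_limit (𝒰 : Ultrafilter ι) (S : ι → E →L[ℂ] F) (C : ℝ) (hC : ∀ i, ‖S i‖ ≤ C) :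
    ∃ S₀ : E →L[ℂ] F, ∀ x y, Tendsto (fun i => ⟪S i x, y⟫) 𝒰 (𝓝 ⟪S₀ x, y⟫) := by
  have hb : ∀ i x y, ‖⟪S i x, y⟫‖ ≤ C * ‖x‖ * ‖y‖ := by
    intro i x y
    refine (norm_inner_le_norm _ _).trans ?_
    gcongr
    refine (ContinuousLinearMap.le_opNorm _ _).trans ?_
    gcongr; exact hC i
  have hl : ∀ x y, ∃ l : ℂ, Tendsto (fun i => ⟪S i x, y⟫) 𝒰 (𝓝 l) := by
    intro x y
    obtain ⟨l, -, h⟩ := (isCompact_closedBall (0 : ℂ) (C * ‖x‖ * ‖y‖)).ultrafilter_le_nhds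
      (𝒰.map (fun i => ⟪S i x, y⟫)) (by
        simp only [Ultrafilter.coe_map, le_principal_iff, mem_map]
        exact Filter.univ_mem' fun i => by simpa using hb i x y)
    exact ⟨l, h⟩
  choose l hl using hl
  have hu : ∀ {x y a}, Tendsto (fun i => ⟪S i x, y⟫) 𝒰 (𝓝 a) → l x y = a := fun h =>
    tendsto_nhds_unique (hl _ _) h
  have lb : ∀ x y, ‖l x y‖ ≤ C * ‖x‖ * ‖y‖ := fun x y =>
    le_of_tendsto (hl x y).norm (Filter.Eventually.of_forall fun i => hb i x y)
  let f : E → F →L[ℂ] ℂ := fun x => LinearMap.mkContinuous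
    { toFun := l x
      map_add' := fun y y' => hu (by simpa only [inner_add_right] using (hl x y).add (hl x y'))
      map_smul' := fun c y => hu (by
        simpa only [inner_smul_right, RingHom.id_apply, smul_eq_mul] using (hl x y).const_mul c) } (C * ‖x‖) (lb x)
  have hf : ∀ x y, f x y = l x y := fun _ _ => rfl
  let s : E → F := fun x => (InnerProductSpace.toDual ℂ F).symm (f x)
  have hs : ∀ x y, ⟪s x, y⟫ = l x y := fun x y => by
    simp only [s, InnerProductSpace.toDual_symm_apply]; exact hf x y
  let S₀ : E →ₗ[ℂ] F :=
    { toFun := s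
      map_add' := fun x x' => by
        apply ext_inner_right ℂ
        intro y
        rw [inner_add_left, hs, hs, hs]
        exact hu (by simpa only [map_add, inner_add_left] using (hl x y).add (hl x' y))
      map_smul' := fun c x => by
        apply ext_inner_right ℂ
        intro y
        rw [inner_smul_left, hs, hs]
        exact hu (by simpa only [map_smul, inner_smul_left, RingHom.id_apply] using
          (hl x y).const_mul _) }
  have sb : ∀ x, ‖S₀ x‖ ≤ C * ‖x‖ := by
    intro x
    change ‖s x‖ ≤ _
    simp only [s, LinearIsometryEquiv.norm_map]
    refine LinearMap.mkContinuous_norm_le _ ?_ _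
    rcases isEmpty_or_nonempty ι with h | ⟨⟨i⟩⟩
    · exact absurd (𝒰.neBot) (by rw [Filter.filter_eq_bot_of_isEmpty (𝒰 : Filter ι)]; simp)
    · have := (norm_nonneg _).trans (hC i)
      positivity
  refine ⟨S₀.mkContinuous C sb, fun x y => ?_⟩
  have : (⟪S₀.mkContinuous C sb x, y⟫ : ℂ) = l x y := hs x y
  rw [this]
  exact hl x y

theorem normal_limit (𝒰 : Filter ι) (S : ι → E →L[ℂ] F) (C : ℝ) (hC : ∀ i, ‖S i‖ ≤ C)
    (S₀ : E →L[ℂ] F) (h : ∀ x y, Tendsto (fun i => ⟪S i x, y⟫) 𝒰 (𝓝 ⟪S₀ x, y⟫))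
    {f : (E →L[ℂ] F) → ℂ} (hf : Normal f) : Tendsto (fun i => f (S i)) 𝒰 (𝓝 (f S₀)) := by
  obtain ⟨ξ, η, hf⟩ := hf
  simp only [hf, lp.inner_eq_tsum, amp_apply]
  have hsum : Summable fun n => C * (‖ξ n‖ ^ 2 + ‖η n‖ ^ 2) :=
    ((L2.summable ξ).add (L2.summable η)).mul_left C
  refine tendsto_tsum_of_dominated_convergence hsum (fun n => ?_) (Filter.Eventually.of_forall
    fun i n => ?_)
  · have := (h (ξ n) (η n)).star
    simpa only [RCLike.star_def, inner_conj_symm] using this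
  · have hC0 := (norm_nonneg _).trans (hC i)
    have h1 : ‖S i (ξ n)‖ ≤ C * ‖ξ n‖ := (ContinuousLinearMap.le_opNorm _ _).trans (by
      gcongr; exact hC i)
    calc ‖⟪η n, S i (ξ n)⟫‖ ≤ ‖η n‖ * ‖S i (ξ n)‖ := norm_inner_le_norm _ _
      _ ≤ ‖η n‖ * (C * ‖ξ n‖) := by gcongr
      _ = C * (‖ξ n‖ * ‖η n‖) := by ring
      _ ≤ _ := by
        gcongr
        nlinarith [sq_nonneg (‖ξ n‖ - ‖η n‖), sq_nonneg (‖ξ n‖), sq_nonneg (‖η n‖)]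

end Ult
end
end OSH

namespace OSH
noncomputable section
section Part

theorem partition {A : Type*} [Ring A] [StarRing A] (PP : Set A) (hidem : ∀ p ∈ PP, p * p = p)
    (hstar : ∀ p ∈ PP, star p = p) (hcomm : ∀ p ∈ PP, ∀ q ∈ PP, p * q = q * p)
    (F : Finset PP) : ∃ (ι : Type) (_ : Fintype ι) (e : ι → A),
      (∀ i, e i ∈ Subring.closure PP) ∧ (∀ i, star (e i) = e i) ∧ (∀ i, e i * e i = e i) ∧
      (∀ i j, i ≠ j → e i * e j = 0) ∧ ∑ i, e i = 1 ∧
      ∀ p ∈ F, ∀ i, p.1 * e i = e i ∨ p.1 * e i = 0 := by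
  classical
  have hc : ∀ x ∈ Subring.closure PP, ∀ y ∈ Subring.closure PP, x * y = y * x := by
    intro x hx y hy
    have i := Subring.isMulCommutative_closure (s := PP) hcomm
    exact congrArg Subtype.val (i.is_comm.comm ⟨x, hx⟩ ⟨y, hy⟩)
  induction F using Finset.induction_on with
  | empty =>
    refine ⟨Unit, inferInstance, fun _ => 1, fun _ => one_mem _, by simp, by simp, ?_, by simp,
      by simp⟩
    intro i j h; exact absurd (Subsingleton.elim i j) h
  | insert p F hp ih =>
    obtain ⟨ι, hι, e, h1, h2, h3, h4, h5, h6⟩ := ih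
    have pc : p.1 ∈ Subring.closure PP := Subring.subset_closure p.2
    let c : Bool → A := fun b => if b then p.1 else 1 - p.1
    have cc : ∀ b, c b ∈ Subring.closure PP := by
      intro b; cases b
      · exact sub_mem (one_mem _) pc
      · exact pc
    have ci : ∀ b, c b * c b = c b := by
      have := hidem p.1 p.2
      intro b; cases b
      · simp [c, sub_mul, mul_sub, this]
      · simpa [c] using this
    have c0 : ∀ b b', b ≠ b' → c b * c b' = 0 := by
      have := hidem p.1 p.2
      intro b b' h
      cases b <;> cases b' <;> simp_all [c, sub_mul, mul_sub]
    have cs : ∀ b, star (c b) = c b := by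
      have := hstar p.1 p.2
      intro b; cases b <;> simp [c, this]
    have sw : ∀ i b, e i * c b = c b * e i := fun i b => hc _ (h1 i) _ (cc b)
    refine ⟨ι × Bool, inferInstance, fun k => c k.2 * e k.1, fun k => mul_mem (cc _) (h1 _), ?_, ?_,
      ?_, ?_, ?_⟩
    · intro k; rw [star_mul, cs, h2, sw]
    · intro k
      rw [mul_assoc, ← mul_assoc (e k.1), sw, mul_assoc, h3, ← mul_assoc, ci]
    · rintro ⟨i, b⟩ ⟨j, b'⟩ h
      dsimp only
      rw [mul_assoc, ← mul_assoc (e i), sw, mul_assoc, ← mul_assoc]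
      by_cases hij : i = j
      · have : b ≠ b' := fun hb => h (by rw [hij, hb])
        rw [c0 b b' this, zero_mul]
      · rw [h4 i j hij, mul_zero]
    · rw [Fintype.sum_prod_type]
      simp [c, sub_mul, h5]
    · intro q hq k
      rw [Finset.mem_insert] at hq
      rcases hq with rfl | hq
      · rcases k with ⟨i, b⟩
        have := hidem q.1 q.2
        cases b
        · right; simp [c, ← mul_assoc, mul_sub, this]
        · left; simp [c, ← mul_assoc, this]
      · have : q.1 * (c k.2 * e k.1) = c k.2 * (q.1 * e k.1) := by
          rw [← mul_assoc, hc _ (Subring.subset_closure q.2) _ (cc k.2), mul_assoc]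
        dsimp only
        rw [this]
        rcases h6 q hq k.1 with h | h
        · left; rw [h]
        · right; rw [h, mul_zero]

variable {E F ι : Type*} [NormedAddCommGroup E] [InnerProductSpace ℂ E] [CompleteSpace E]
  [NormedAddCommGroup F] [InnerProductSpace ℂ F] [CompleteSpace F]

theorem proj_sum_norm [Fintype ι] (P : ι → E →L[ℂ] E) (hP : ∀ k, P k ∘L P k = P k)
    (hPs : ∀ k, adjoint (P k) = P k) (h1 : ∑ k, P k = 1) (x : E) : ∑ k, ‖P k x‖ ^ 2 = ‖x‖ ^ 2 := by
  have h2 : ∀ k, ‖P k x‖ ^ 2 = (⟪x, P k x⟫).re := by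
    intro k
    have := inner_self_eq_norm_sq (𝕜 := ℂ) (P k x)
    rw [← this, ← ContinuousLinearMap.adjoint_inner_right, hPs, ← ContinuousLinearMap.comp_apply, hP]
    rfl
  simp_rw [h2]
  rw [← Complex.re_sum, ← inner_sum, ← sum_apply, h1, ← inner_self_eq_norm_sq (𝕜 := ℂ)]
  rfl

theorem blockdiag [Fintype ι] (P : ι → E →L[ℂ] E) (hP : ∀ k, P k ∘L P k = P k)
    (hPs : ∀ k, adjoint (P k) = P k) (h1 : ∑ k, P k = 1)
    (Q : ι → F →L[ℂ] F) (hQ : ∀ k, Q k ∘L Q k = Q k)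
    (hQs : ∀ k, adjoint (Q k) = Q k) (h2 : ∑ k, Q k = 1) (Y : ι → E →L[ℂ] F) {C : ℝ} (hC0 : 0 ≤ C)
    (hC : ∀ k, ‖Y k‖ ≤ C) : ‖∑ k, Q k ∘L Y k ∘L P k‖ ≤ C := by
  refine ContinuousLinearMap.opNorm_le_bound _ hC0 fun x => ?_
  set X := ∑ k, Q k ∘L Y k ∘L P k with hX
  have key : ‖X x‖ ^ 2 ≤ C * (‖X x‖ * ‖x‖) := by
    set y := X x with hy
    calc ‖y‖ ^ 2 = ‖⟪y, X x⟫‖ := by rw [← hy, inner_self_eq_norm_sq_to_K]; simp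
      _ = ‖∑ k, ⟪Q k y, Y k (P k x)⟫‖ := by
        rw [hX, sum_apply, inner_sum]
        congr 1
        refine Finset.sum_congr rfl fun k _ => ?_
        have := ContinuousLinearMap.adjoint_inner_left (Q k) (Y k (P k x)) y
        rw [hQs] at this
        rw [this]
        rfl
      _ ≤ ∑ k, ‖⟪Q k y, Y k (P k x)⟫‖ := norm_sum_le _ _
      _ ≤ ∑ k, C * (‖Q k y‖ * ‖P k x‖) := by
        gcongr with k
        refine (norm_inner_le_norm _ _).trans ?_
        have : ‖Y k (P k x)‖ ≤ C * ‖P k x‖ := (ContinuousLinearMap.le_opNorm _ _).trans (by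
          gcongr; exact hC k)
        calc ‖Q k y‖ * ‖Y k (P k x)‖ ≤ ‖Q k y‖ * (C * ‖P k x‖) := by gcongr
          _ = _ := by ring
      _ = C * ∑ k, (‖Q k y‖ * ‖P k x‖) := by rw [Finset.mul_sum]
      _ ≤ C * (√(∑ k, ‖Q k y‖ ^ 2) * √(∑ k, ‖P k x‖ ^ 2)) := by
        gcongr; exact Real.sum_mul_le_sqrt_mul_sqrt _ _ _
      _ = C * (‖y‖ * ‖x‖) := by
        rw [proj_sum_norm P hP hPs h1, proj_sum_norm Q hQ hQs h2, Real.sqrt_sq (norm_nonneg _),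
          Real.sqrt_sq (norm_nonneg _)]
  rcases (norm_nonneg (X x)).eq_or_lt with h | h
  · rw [← h]; positivity
  · refine le_of_mul_le_mul_left ?_ h
    calc _ = ‖X x‖ ^ 2 := by ring
      _ ≤ _ := key
      _ = _ := by ring

end Part

section DS
variable (H₁ H₂ : Type*) [NormedAddCommGroup H₁] [InnerProductSpace ℂ H₁] [CompleteSpace H₁]
  [NormedAddCommGroup H₂] [InnerProductSpace ℂ H₂] [CompleteSpace H₂]

abbrev DS := WithLp 2 (H₁ × H₂)

theorem exists_ds : ∃ (i₁ : H₁ →L[ℂ] DS H₁ H₂) (i₂ : H₂ →L[ℂ] DS H₁ H₂),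
    adjoint i₁ ∘L i₁ = 1 ∧ adjoint i₂ ∘L i₂ = 1 ∧ adjoint i₁ ∘L i₂ = 0 ∧ adjoint i₂ ∘L i₁ = 0 ∧
    i₁ ∘L adjoint i₁ + i₂ ∘L adjoint i₂ = 1 := by
  let e := WithLp.prodContinuousLinearEquiv 2 ℂ H₁ H₂
  let i₁ : H₁ →L[ℂ] DS H₁ H₂ := e.symm.toContinuousLinearMap ∘L ContinuousLinearMap.inl ℂ H₁ H₂
  let i₂ : H₂ →L[ℂ] DS H₁ H₂ := e.symm.toContinuousLinearMap ∘L ContinuousLinearMap.inr ℂ H₁ H₂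
  have a1 : adjoint i₁ = ContinuousLinearMap.fst ℂ H₁ H₂ ∘L e.toContinuousLinearMap := by
    symm
    rw [ContinuousLinearMap.eq_adjoint_iff]
    intro x y
    simp [i₁, e, WithLp.prod_inner_apply]
  have a2 : adjoint i₂ = ContinuousLinearMap.snd ℂ H₁ H₂ ∘L e.toContinuousLinearMap := by
    symm
    rw [ContinuousLinearMap.eq_adjoint_iff]
    intro x y
    simp [i₂, e, WithLp.prod_inner_apply]
  refine ⟨i₁, i₂, ?_, ?_, ?_, ?_, ?_⟩
  · rw [a1]; ext x; simp [i₁]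
  · rw [a2]; ext x; simp [i₂]
  · rw [a1]; ext x; simp [i₂]
  · rw [a2]; ext x; simp [i₁]
  · rw [a1, a2]
    ext x
    simp only [i₁, i₂, e, add_apply, ContinuousLinearMap.comp_apply]
    simp
    rw [← WithLp.toLp_add]
    simp
    rfl

end DS
end
end OSH

namespace OSH
noncomputable section
section Rho
variable {H₁ H₂ W : Type*}
  [NormedAddCommGroup H₁] [InnerProductSpace ℂ H₁] [CompleteSpace H₁]
  [NormedAddCommGroup H₂] [InnerProductSpace ℂ H₂] [CompleteSpace H₂]
  [NormedAddCommGroup W] [InnerProductSpace ℂ W] [CompleteSpace W]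

structure DSum (i₁ : H₁ →L[ℂ] W) (i₂ : H₂ →L[ℂ] W) : Prop where
  h11 : ∀ x, adjoint i₁ (i₁ x) = x
  h22 : ∀ x, adjoint i₂ (i₂ x) = x
  h12 : ∀ x, adjoint i₁ (i₂ x) = 0
  h21 : ∀ x, adjoint i₂ (i₁ x) = 0
  hs : ∀ x, i₁ (adjoint i₁ x) + i₂ (adjoint i₂ x) = x

def rho (i₁ : H₁ →L[ℂ] W) (i₂ : H₂ →L[ℂ] W) (a : (H₁ →L[ℂ] H₁) × (H₂ →L[ℂ] H₂)) : W →L[ℂ] W :=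
  i₁ ∘L a.1 ∘L adjoint i₁ + i₂ ∘L a.2 ∘L adjoint i₂

variable {i₁ : H₁ →L[ℂ] W} {i₂ : H₂ →L[ℂ] W}

theorem rho_mul (h : DSum i₁ i₂) (a b) : rho i₁ i₂ (a * b) = rho i₁ i₂ a * rho i₁ i₂ b := by
  ext x; simp [rho, h.h11, h.h22, h.h12, h.h21]
theorem rho_one (h : DSum i₁ i₂) : rho i₁ i₂ 1 = 1 := by
  ext x; simp [rho, h.hs]
theorem rho_zero : rho i₁ i₂ 0 = 0 := by
  ext x; simp [rho]
theorem rho_add (a b) : rho i₁ i₂ (a + b) = rho i₁ i₂ a + rho i₁ i₂ b := by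
  ext x; simp [rho]; abel
theorem rho_neg (a) : rho i₁ i₂ (-a) = - rho i₁ i₂ a := by
  ext x; simp [rho]; abel
theorem rho_sum {α : Type*} (s : Finset α) (a : α → _) :
    rho i₁ i₂ (∑ i ∈ s, a i) = ∑ i ∈ s, rho i₁ i₂ (a i) :=
  map_sum (AddMonoidHom.mk' (rho i₁ i₂) (rho_add)) a s
theorem rho_star (a) : rho i₁ i₂ (star a) = adjoint (rho i₁ i₂ a) := by
  simp [rho, ContinuousLinearMap.adjoint_comp, ContinuousLinearMap.star_eq_adjoint,
    ContinuousLinearMap.comp_assoc]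
theorem rho_i1 (h : DSum i₁ i₂) (a) (x) : rho i₁ i₂ a (i₁ x) = i₁ (a.1 x) := by
  simp [rho, h.h11, h.h21]
theorem rho_i2 (h : DSum i₁ i₂) (a) (x) : rho i₁ i₂ a (i₂ x) = i₂ (a.2 x) := by
  simp [rho, h.h12, h.h22]
theorem i1_rho (h : DSum i₁ i₂) (a) (x) : adjoint i₁ (rho i₁ i₂ a x) = a.1 (adjoint i₁ x) := by
  simp [rho, h.h11, h.h12]
theorem i2_rho (h : DSum i₁ i₂) (a) (x) : adjoint i₂ (rho i₁ i₂ a x) = a.2 (adjoint i₂ x) := by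
  simp [rho, h.h21, h.h22]

theorem exists_dsum (H₁ H₂ : Type*)
  [NormedAddCommGroup H₁] [InnerProductSpace ℂ H₁] [CompleteSpace H₁]
  [NormedAddCommGroup H₂] [InnerProductSpace ℂ H₂] [CompleteSpace H₂] :
    ∃ (i₁ : H₁ →L[ℂ] DS H₁ H₂) (i₂ : H₂ →L[ℂ] DS H₁ H₂), DSum i₁ i₂ := by
  obtain ⟨i₁, i₂, a, b, c, d, e⟩ := exists_ds H₁ H₂
  refine ⟨i₁, i₂, ?_, ?_, ?_, ?_, ?_⟩ <;> intro x
  · exact congrArg (fun A => A x) a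
  · exact congrArg (fun A => A x) b
  · exact congrArg (fun A => A x) c
  · exact congrArg (fun A => A x) d
  · exact congrArg (fun A => A x) e

/-- norm of vector -/
theorem dsum_inner (h : DSum i₁ i₂) (x y x' y') :
    ⟪i₁ x + i₂ y, i₁ x' + i₂ y'⟫ = ⟪x, x'⟫ + ⟪y, y'⟫ := by
  simp only [inner_add_left, inner_add_right]
  rw [← ContinuousLinearMap.adjoint_inner_right, ← ContinuousLinearMap.adjoint_inner_right,
    ← ContinuousLinearMap.adjoint_inner_right, ← ContinuousLinearMap.adjoint_inner_right,
    h.h11, h.h21, h.h12, h.h22]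
  simp

/-- If `M` is invariant under selfadjoint `A` then `pr M` commutes with `A`. -/
theorem pr_comm {M : Submodule ℂ W} (hM : IsClosed (M : Set W)) {A : W →L[ℂ] W}
    (hA : adjoint A = A) (h : ∀ x ∈ M, A x ∈ M) (x : W) : pr M (A x) = A (pr M x) := by
  have h1 : ∀ z, pr M (A (pr M z)) = A (pr M z) := fun z => (pr_eq_self hM).2 (h _ (pr_mem hM z))
  rw [← h1]
  apply ext_inner_left ℂ
  intro v
  have adj : ∀ a b, ⟪a, A b⟫ = ⟪A a, b⟫ := by
    intro a b
    rw [← ContinuousLinearMap.adjoint_inner_left, hA]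
  rw [← pr_inner hM, ← pr_inner hM, adj, adj, ← pr_inner hM, h1]

variable (i₁ i₂) in
def GG (PP : Set ((H₁ →L[ℂ] H₁) × (H₂ →L[ℂ] H₂))) (x : H₁) (y : H₂) : Submodule ℂ W :=
  cspan {z | ∃ a ∈ Submonoid.closure PP, z = rho i₁ i₂ a (i₁ x + i₂ y)}

theorem GG_closed (PP : Set ((H₁ →L[ℂ] H₁) × (H₂ →L[ℂ] H₂))) (x : H₁) (y : H₂) :
    IsClosed (GG i₁ i₂ PP x y : Set W) := isClosed_cspan _

theorem GG_comm (h : DSum i₁ i₂) {PP : Set ((H₁ →L[ℂ] H₁) × (H₂ →L[ℂ] H₂))}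
    (hstar : ∀ p ∈ PP, star p = p) (x : H₁) (y : H₂) {a} (ha : a ∈ Subring.closure PP) :
    ∀ z, pr (GG i₁ i₂ PP x y) (rho i₁ i₂ a z) = rho i₁ i₂ a (pr (GG i₁ i₂ PP x y) z) := by
  induction ha using Subring.closure_induction with
  | mem p hp =>
    refine pr_comm (GG_closed _ _ _) (by rw [← rho_star, hstar p hp]) fun z hz => ?_
    refine cspan_map (GG_closed PP x y) _ ?_ hz
    rintro _ ⟨b, hb, rfl⟩
    refine subset_cspan _ ⟨p * b, mul_mem (Submonoid.subset_closure hp) hb, ?_⟩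
    rw [rho_mul h]; rfl
  | zero => intro z; simp [rho_zero]
  | one => intro z; simp [rho_one h]
  | add a b _ _ ha hb => intro z; simp [rho_add, ha, hb]
  | neg a _ ha => intro z; simp [rho_neg, ha]
  | mul a b _ _ ha hb => intro z; simp [rho_mul h, ha, hb]

end Rho
end
end OSH

namespace OSH
noncomputable section
section B0
variable {H₁ H₂ K₁ K₂ T₁ T₂ W : Type*}
  [NormedAddCommGroup H₁] [InnerProductSpace ℂ H₁] [CompleteSpace H₁]
  [NormedAddCommGroup H₂] [InnerProductSpace ℂ H₂] [CompleteSpace H₂]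
  [NormedAddCommGroup K₁] [InnerProductSpace ℂ K₁] [CompleteSpace K₁]
  [NormedAddCommGroup K₂] [InnerProductSpace ℂ K₂] [CompleteSpace K₂]
  [NormedAddCommGroup T₁] [InnerProductSpace ℂ T₁] [CompleteSpace T₁]
  [NormedAddCommGroup T₂] [InnerProductSpace ℂ T₂] [CompleteSpace T₂]
  [NormedAddCommGroup W] [InnerProductSpace ℂ W] [CompleteSpace W]
  {t₁ : H₁ → K₁ → T₁} {t₂ : H₂ → K₂ → T₂}
  (ht₁ : IsTensorEmbedding t₁) (ht₂ : IsTensorEmbedding t₂)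
  {i₁ : H₁ →L[ℂ] W} {i₂ : H₂ →L[ℂ] W}

def Delta (PP : Set ((H₁ →L[ℂ] H₁) × (H₂ →L[ℂ] H₂))) : Set (H₁ →L[ℂ] H₂) :=
  {S | ∀ p ∈ PP, p.2 ∘L S = S ∘L p.1}

theorem intertw {PP : Set ((H₁ →L[ℂ] H₁) × (H₂ →L[ℂ] H₂))} {T : T₁ →L[ℂ] T₂}
    (hT : ∀ p ∈ PP, ap ht₂ p.2 ∘L T = T ∘L ap ht₁ p.1) {a} (ha : a ∈ Subring.closure PP) :
    ∀ z, ap ht₂ a.2 (T z) = T (ap ht₁ a.1 z) := by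
  induction ha using Subring.closure_induction with
  | mem p hp => intro z; exact congrArg (fun A => A z) (hT p hp)
  | zero => intro z; simp [ap_zero]
  | one => intro z; simp [ap_one]
  | add a b _ _ ha hb => intro z; simp [ap_add, ha, hb]
  | neg a _ ha =>
    intro z
    have e1 : ap ht₁ (-a.1) = - ap ht₁ a.1 := by
      have := ap_sub ht₁ 0 a.1
      simpa [ap_zero] using this
    have e2 : ap ht₂ (-a.2) = - ap ht₂ a.2 := by
      have := ap_sub ht₂ 0 a.2
      simpa [ap_zero] using this
    simp [e1, e2, ha]
  | mul a b _ _ ha hb => intro z; simp [ap_mul, ha, hb]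

theorem B0a (h : DSum i₁ i₂) (PP : Set ((H₁ →L[ℂ] H₁) × (H₂ →L[ℂ] H₂)))
    (hidem : ∀ p ∈ PP, p * p = p)
    (hstar : ∀ p ∈ PP, star p = p) (hcomm : ∀ p ∈ PP, ∀ q ∈ PP, p * q = q * p)
    (U' : Submodule ℂ (K₁ →L[ℂ] K₂)) (T : T₁ →L[ℂ] T₂)
    (hT : ∀ p ∈ PP, ap ht₂ p.2 ∘L T = T ∘L ap ht₁ p.1)
    (hsl : ∀ u v, sl ht₁ ht₂ u v T ∈ U') (x : H₁) (y : H₂) (F : Finset PP) :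
    ∃ X ∈ Hull (Elem t₁ t₂ (Delta PP) (U' : Set _)),
      ‖X‖ ≤ ‖adjoint i₂ ∘L pr (GG i₁ i₂ PP x y) ∘L i₁‖ * ‖T‖ ∧
      ∀ z w, ∃ Y : W →L[ℂ] W, ‖Y‖ ≤ ‖T‖ * ‖z‖ * ‖w‖ ∧
        (∀ u v, ⟪t₂ v z, X (t₁ u w)⟫ =
          ⟪pr (GG i₁ i₂ PP x y) (i₂ v), Y (pr (GG i₁ i₂ PP x y) (i₁ u))⟫) ∧
        ∀ a ∈ Submonoid.closure (Subtype.val '' (F : Set PP)),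
        ∀ b ∈ Submonoid.closure (Subtype.val '' (F : Set PP)),
          ⟪rho i₁ i₂ b (i₁ x + i₂ y), Y (rho i₁ i₂ a (i₁ x + i₂ y))⟫ =
            ⟪t₂ (b.2 y) z, T (t₁ (a.1 x) w)⟫ := by
  obtain ⟨ι, hι, e, h1, h2, h3, h4, h5, h6⟩ := partition PP hidem hstar hcomm F
  have hc : ∀ x ∈ Subring.closure PP, ∀ y ∈ Subring.closure PP, x * y = y * x := by
    intro x hx y hy
    have i := Subring.isMulCommutative_closure (s := PP) hcomm
    exact congrArg Subtype.val (i.is_comm.comm ⟨x, hx⟩ ⟨y, hy⟩)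
  set p := pr (GG i₁ i₂ PP x y) with hp
  have hpc := fun {a} (ha : a ∈ Subring.closure PP) => GG_comm h hstar x y ha
  rw [← hp] at hpc
  have hpi : ∀ z, p (p z) = p z := fun z =>
    congrArg (fun A => A z) (pr_idem (GG_closed (i₁ := i₁) (i₂ := i₂) PP x y))
  have hps : ∀ z z', ⟪p z, z'⟫ = ⟪z, p z'⟫ := pr_inner (GG_closed (i₁ := i₁) (i₂ := i₂) PP x y)
  set R := adjoint i₂ ∘L p ∘L i₁ with hR
  have hRc : ∀ {a}, a ∈ Subring.closure PP → ∀ z, a.2 (R z) = R (a.1 z) := by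
    intro a ha z
    simp only [hR, ContinuousLinearMap.comp_apply]
    rw [← i2_rho h, ← hpc ha, rho_i1 h]
  set g := i₁ x + i₂ y with hg
  let n : ι → ℝ := fun k => ‖(e k).1 x‖ ^ 2 + ‖(e k).2 y‖ ^ 2
  let τ : ι → (K₁ →L[ℂ] K₂) := fun k =>
    ((n k : ℂ))⁻¹ • sl ht₁ ht₂ ((e k).1 x) ((e k).2 y) T
  have hn0 : ∀ k, 0 ≤ n k := fun k => by positivity
  have hτ : ∀ k, ‖τ k‖ ≤ ‖T‖ := by
    intro k
    simp only [τ]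
    rw [norm_smul, norm_inv, Complex.norm_real, Real.norm_of_nonneg (hn0 k)]
    have h8 : ‖sl ht₁ ht₂ ((e k).1 x) ((e k).2 y) T‖ ≤ ‖T‖ * n k := by
      refine (sl_norm ht₁ ht₂ _ _ _).trans ?_
      rw [mul_assoc]
      gcongr
      simp only [n]
      nlinarith [sq_nonneg (‖(e k).1 x‖ - ‖(e k).2 y‖), sq_nonneg ‖(e k).1 x‖,
        sq_nonneg ‖(e k).2 y‖]
    rcases (hn0 k).eq_or_lt with h0 | h0
    · rw [← h0]; simp
    · rw [inv_mul_le_iff₀ h0]; linarith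
  have hτU : ∀ k, τ k ∈ U' := fun k => U'.smul_mem _ (hsl _ _)
  have c1 : ∀ k, (e k).1 * (e k).1 = (e k).1 := fun k => congrArg Prod.fst (h3 k)
  have c2 : ∀ k, (e k).2 * (e k).2 = (e k).2 := fun k => congrArg Prod.snd (h3 k)
  have s1 : ∀ k, adjoint (e k).1 = (e k).1 := fun k => congrArg Prod.fst (h2 k)
  have s2 : ∀ k, adjoint (e k).2 = (e k).2 := fun k => congrArg Prod.snd (h2 k)
  have u1 : ∑ k, (e k).1 = 1 := by
    have := congrArg Prod.fst h5
    rwa [Prod.fst_sum] at this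
  have u2 : ∑ k, (e k).2 = 1 := by
    have := congrArg Prod.snd h5
    rwa [Prod.snd_sum] at this
  refine ⟨∑ k, tens ht₁ ht₂ ((e k).2 ∘L R ∘L (e k).1) (τ k), ?_, ?_, ?_⟩
  · refine Submodule.sum_mem _ fun k _ => subset_Hull _ (tens_mem_Elem ht₁ ht₂ ?_ (hτU k))
    intro q hq
    have hq' := Subring.subset_closure hq
    ext z
    simp only [ContinuousLinearMap.comp_apply]
    have d1 : ∀ z, q.1 ((e k).1 z) = (e k).1 (q.1 z) := fun z =>
      congrArg (fun A => A.1 z) (hc _ hq' _ (h1 k))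
    have d2 : ∀ z, q.2 ((e k).2 z) = (e k).2 (q.2 z) := fun z =>
      congrArg (fun A => A.2 z) (hc _ hq' _ (h1 k))
    rw [d2, hRc hq', d1]
  · have := blockdiag (fun k => ap ht₁ (e k).1)
      (fun k => by rw [← ContinuousLinearMap.mul_def, ← ap_mul, c1])
      (fun k => by rw [ap_adjoint, s1])
      (by rw [← ap_sum, u1, ap_one])
      (fun k => ap ht₂ (e k).2)
      (fun k => by rw [← ContinuousLinearMap.mul_def, ← ap_mul, c2])
      (fun k => by rw [ap_adjoint, s2])
      (by rw [← ap_sum, u2, ap_one])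
      (fun k => tens ht₁ ht₂ R (τ k)) (C := ‖R‖ * ‖T‖) (by positivity)
      (fun k => (tens_norm ht₁ ht₂ _ _).trans (by gcongr; exact hτ k))
    simpa only [ap_tens_ap] using this
  · intro z w
    have r1 : ∀ k, rho i₁ i₂ (e k) ∘L rho i₁ i₂ (e k) = rho i₁ i₂ (e k) := fun k => by
      rw [← ContinuousLinearMap.mul_def, ← rho_mul h, h3]
    have r2 : ∀ k, adjoint (rho i₁ i₂ (e k)) = rho i₁ i₂ (e k) := fun k => by
      rw [← rho_star, h2]
    have r3 : ∑ k, rho i₁ i₂ (e k) = 1 := by rw [← rho_sum, h5, rho_one h]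
    have r1' : ∀ k v, rho i₁ i₂ (e k) (rho i₁ i₂ (e k) v) = rho i₁ i₂ (e k) v := fun k v =>
      congrArg (fun A => A v) (r1 k)
    have r2' : ∀ k v v', ⟪v, rho i₁ i₂ (e k) v'⟫ = ⟪rho i₁ i₂ (e k) v, v'⟫ := fun k v v' => by
      rw [← ContinuousLinearMap.adjoint_inner_left, r2]
    refine ⟨∑ k, ⟪z, τ k w⟫ • rho i₁ i₂ (e k), ?_, ?_, ?_⟩
    · have := blockdiag (fun k => rho i₁ i₂ (e k)) r1 r2 r3 (fun k => rho i₁ i₂ (e k)) r1 r2 r3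
        (fun k => ⟪z, τ k w⟫ • (1 : W →L[ℂ] W)) (C := ‖T‖ * ‖z‖ * ‖w‖) (by positivity) ?_
      · convert this using 3 with k
        ext v
        simp [r1']
      · intro k
        rw [norm_smul]
        calc _ ≤ ‖⟪z, τ k w⟫‖ * 1 := by
              gcongr; exact ContinuousLinearMap.norm_id_le
          _ ≤ ‖z‖ * (‖T‖ * ‖w‖) := by
              rw [mul_one]
              refine (norm_inner_le_norm _ _).trans ?_
              gcongr
              exact (ContinuousLinearMap.le_opNorm _ _).trans (by gcongr; exact hτ k)
          _ = _ := by ring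
    · intro u v
      clear_value τ
      rw [sum_apply, sum_apply, inner_sum, inner_sum]
      refine Finset.sum_congr rfl fun k _ => ?_
      rw [tens_apply, te_inner ht₂, smul_apply, inner_smul_right, mul_comm]
      congr 1
      simp only [hR, ContinuousLinearMap.comp_apply]
      rw [← i2_rho h, ← rho_i1 h, ContinuousLinearMap.adjoint_inner_right, ← hpc (h1 k), r1',
        hpc (h1 k), hps, hpc (h1 k), hpi]
    · have key : ∀ a ∈ Submonoid.closure (Subtype.val '' (F : Set PP)),
          a ∈ Subring.closure PP ∧ ∀ k, a * e k = e k ∨ a * e k = 0 := by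
        intro a ha
        induction ha using Submonoid.closure_induction with
        | mem q hq =>
          obtain ⟨q, hq, rfl⟩ := hq
          exact ⟨Subring.subset_closure q.2, h6 q hq⟩
        | one => exact ⟨one_mem _, fun k => Or.inl (one_mul _)⟩
        | mul a b _ _ ha hb =>
          refine ⟨mul_mem ha.1 hb.1, fun k => ?_⟩
          rw [mul_assoc]
          rcases hb.2 k with h' | h'
          · rw [h']; exact ha.2 k
          · rw [h', mul_zero]; exact Or.inr rfl
      intro a ha b hb
      obtain ⟨ha1, ha2⟩ := key a ha
      obtain ⟨hb1, hb2⟩ := key b hb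
      have hr : ⟪t₂ (b.2 y) z, T (t₁ (a.1 x) w)⟫ =
          ∑ k, ⟪t₂ ((b * e k).2 y) z, T (t₁ ((a * e k).1 x) w)⟫ := by
        have : t₁ (a.1 x) w = ∑ k, ap ht₁ (e k).1 (ap ht₁ (e k).1 (t₁ (a.1 x) w)) := by
          have e1 : ∀ k, ap ht₁ (e k).1 (ap ht₁ (e k).1 (t₁ (a.1 x) w))
              = ap ht₁ (e k).1 (t₁ (a.1 x) w) := by
            intro k
            rw [← ContinuousLinearMap.comp_apply, ← ContinuousLinearMap.mul_def, ← ap_mul, c1]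
          simp_rw [e1]
          rw [← sum_apply, ← ap_sum, u1, ap_one]; rfl
        rw [this, map_sum, inner_sum]
        refine Finset.sum_congr rfl fun k _ => ?_
        rw [← intertw ht₁ ht₂ hT (h1 k), ← ContinuousLinearMap.adjoint_inner_left, ap_adjoint, s2,
          ap_apply, ap_apply, hc _ ha1 _ (h1 k), hc _ hb1 _ (h1 k)]
        rfl
      rw [hr, sum_apply, inner_sum]
      refine Finset.sum_congr rfl fun k _ => ?_
      rw [smul_apply, inner_smul_right, ← r1', r2']
      have e1 : ∀ {a}, a ∈ Subring.closure PP →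
          rho i₁ i₂ (e k) (rho i₁ i₂ a g) = rho i₁ i₂ (a * e k) g := by
        intro a ha
        rw [hc _ ha _ (h1 k), rho_mul h]; rfl
      rw [e1 ha1, e1 hb1]
      rcases ha2 k with h7 | h7
      · rcases hb2 k with h8 | h8
        · rw [h7, h8]
          have e3 : rho i₁ i₂ (e k) g = i₁ ((e k).1 x) + i₂ ((e k).2 y) := by
            rw [hg, map_add, rho_i1 h, rho_i2 h]
          have e2 : ⟪rho i₁ i₂ (e k) g, rho i₁ i₂ (e k) g⟫ = (n k : ℂ) := by
            rw [e3, dsum_inner h, inner_self_eq_norm_sq_to_K, inner_self_eq_norm_sq_to_K]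
            simp [n]
          rw [e2, ← sl_inner ht₁ ht₂]
          simp only [τ, smul_apply, inner_smul_right]
          by_cases h0 : n k = 0
          · have : (e k).1 x = 0 := by
              have h9 : ‖(e k).1 x‖ ^ 2 = 0 := by
                have := sq_nonneg ‖(e k).2 y‖
                have := sq_nonneg ‖(e k).1 x‖
                simp only [n] at h0
                linarith
              simpa using h9
            rw [h0, sl_inner, this]
            have t0 : t₁ 0 w = 0 := by rw [← tL_apply ht₁, map_zero]
            simp [t0]
          · have : (n k : ℂ) ≠ 0 := by exact_mod_cast h0
            field_simp
        · rw [h8, rho_zero]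
          have t0 : t₂ 0 z = 0 := by rw [← tL_apply ht₂, map_zero]
          simp [t0]
      · rw [h7, rho_zero]
        have t0 : t₁ 0 w = 0 := by rw [← tL_apply ht₁, map_zero]
        simp [t0]

end B0
end
end OSH

namespace OSH
noncomputable section
open Filter Topology in
theorem wot_limit' {ι E F : Type*} [NormedAddCommGroup E] [InnerProductSpace ℂ E] [CompleteSpace E]
    [NormedAddCommGroup F] [InnerProductSpace ℂ F] [CompleteSpace F]
    (𝒰 : Ultrafilter ι) (S : ι → E →L[ℂ] F) (C : ℝ) (hC : ∀ i, ‖S i‖ ≤ C) :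
    ∃ S₀ : E →L[ℂ] F, (∀ x y, Tendsto (fun i => ⟪y, S i x⟫) 𝒰 (𝓝 ⟪y, S₀ x⟫)) ∧
      ∀ f : (E →L[ℂ] F) → ℂ, Normal f → Tendsto (fun i => f (S i)) 𝒰 (𝓝 (f S₀)) := by
  obtain ⟨S₀, h⟩ := wot_limit 𝒰 S C hC
  refine ⟨S₀, fun x y => ?_, fun f hf => normal_limit 𝒰 S C hC S₀ h hf⟩
  have := (Complex.continuous_conj.tendsto _).comp (h x y)
  simpa [Function.comp_def] using this

section B1
variable {H₁ H₂ K₁ K₂ T₁ T₂ W : Type*}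
  [NormedAddCommGroup H₁] [InnerProductSpace ℂ H₁] [CompleteSpace H₁]
  [NormedAddCommGroup H₂] [InnerProductSpace ℂ H₂] [CompleteSpace H₂]
  [NormedAddCommGroup K₁] [InnerProductSpace ℂ K₁] [CompleteSpace K₁]
  [NormedAddCommGroup K₂] [InnerProductSpace ℂ K₂] [CompleteSpace K₂]
  [NormedAddCommGroup T₁] [InnerProductSpace ℂ T₁] [CompleteSpace T₁]
  [NormedAddCommGroup T₂] [InnerProductSpace ℂ T₂] [CompleteSpace T₂]
  [NormedAddCommGroup W] [InnerProductSpace ℂ W] [CompleteSpace W]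
  {t₁ : H₁ → K₁ → T₁} {t₂ : H₂ → K₂ → T₂}
  (ht₁ : IsTensorEmbedding t₁) (ht₂ : IsTensorEmbedding t₂)
  {i₁ : H₁ →L[ℂ] W} {i₂ : H₂ →L[ℂ] W}

theorem cspan_orth {E F : Type*} [NormedAddCommGroup E] [InnerProductSpace ℂ E] [CompleteSpace E]
    [NormedAddCommGroup F] [InnerProductSpace ℂ F] [CompleteSpace F] {G : Set E} {G' : Set F}
    (A : E →L[ℂ] F) (h : ∀ g ∈ G, ∀ g' ∈ G', ⟪g', A g⟫ = 0) {x y} (hx : x ∈ cspan G)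
    (hy : y ∈ cspan G') : ⟪y, A x⟫ = 0 := by
  have h1 : ∀ g' ∈ G', ⟪g', A x⟫ = 0 := by
    intro g' hg'
    have := cspan_map (M := (⊥ : Submodule ℂ ℂ)) (by simp) (innerSL ℂ g' ∘L A)
      (fun x hx => by simpa using h x hx g' hg') hx
    simpa using this
  have := cspan_map (M := (⊥ : Submodule ℂ ℂ)) (by simp) (innerSL ℂ (A x))
      (fun x hx => by simpa [inner_eq_zero_symm] using h1 x hx) hy
  simpa [inner_eq_zero_symm] using this

open Filter Topology in
theorem B0b (h : DSum i₁ i₂) (PP : Set ((H₁ →L[ℂ] H₁) × (H₂ →L[ℂ] H₂)))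
    (hidem : ∀ p ∈ PP, p * p = p)
    (hstar : ∀ p ∈ PP, star p = p) (hcomm : ∀ p ∈ PP, ∀ q ∈ PP, p * q = q * p)
    (U' : Submodule ℂ (K₁ →L[ℂ] K₂)) (T : T₁ →L[ℂ] T₂)
    (hT : ∀ p ∈ PP, ap ht₂ p.2 ∘L T = T ∘L ap ht₁ p.1)
    (hsl : ∀ u v, sl ht₁ ht₂ u v T ∈ U') (x : H₁) (y : H₂) :
    ap ht₂ (adjoint i₂ ∘L pr (GG i₁ i₂ PP x y) ∘L i₂) ∘L T ∘L
      ap ht₁ (adjoint i₁ ∘L pr (GG i₁ i₂ PP x y) ∘L i₁) ∈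
        Hull (Elem t₁ t₂ (Delta PP) (U' : Set _)) := by
  classical
  choose X hX hXn hY using B0a ht₁ ht₂ h PP hidem hstar hcomm U' T hT hsl x y
  set p := pr (GG i₁ i₂ PP x y) with hp
  have hps : ∀ z z', ⟪p z, z'⟫ = ⟪z, p z'⟫ := pr_inner (GG_closed (i₁ := i₁) (i₂ := i₂) PP x y)
  let 𝒰 : Ultrafilter (Finset PP) := Ultrafilter.of atTop
  have h𝒰 : (𝒰 : Filter (Finset PP)) ≤ atTop := Ultrafilter.of_le _
  obtain ⟨X₀, hX₀, hX₀'⟩ := wot_limit' 𝒰 X _ hXn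
  have hmem : X₀ ∈ Hull (Elem t₁ t₂ (Delta PP) (U' : Set _)) := by
    intro f hf h0
    have h1 := hX₀' f hf
    have h2 : (fun i => f (X i)) = fun _ => 0 := by
      funext i; exact hX i f hf h0
    rw [h2] at h1
    exact tendsto_nhds_unique h1 tendsto_const_nhds
  convert hmem using 1
  refine te_ext ht₁ fun u w => ?_
  rw [← sub_eq_zero]
  refine te_zero ht₂ fun v z => ?_
  rw [inner_sub_right, sub_eq_zero]
  choose Y hYn hY1 hY2 using fun F => hY F z w
  obtain ⟨Y₀, hY₀, -⟩ := wot_limit' 𝒰 Y _ hYn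
  have e1 : ⟪t₂ v z, X₀ (t₁ u w)⟫ = ⟪p (i₂ v), Y₀ (p (i₁ u))⟫ := by
    refine tendsto_nhds_unique (hX₀ (t₁ u w) (t₂ v z)) ?_
    simp_rw [hY1]
    exact hY₀ _ _
  let S := adjoint (tL ht₂ z) ∘L T ∘L tL ht₁ w
  have hev : ∀ a ∈ Submonoid.closure PP, ∀ᶠ F : Finset PP in 𝒰,
      a ∈ Submonoid.closure (Subtype.val '' (F : Set PP)) := by
    intro a ha
    refine h𝒰 ?_
    induction ha using Submonoid.closure_induction with
    | mem q hq =>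
      filter_upwards [eventually_ge_atTop ({⟨q, hq⟩} : Finset PP)] with F hF
      exact Submonoid.subset_closure ⟨⟨q, hq⟩, hF (Finset.mem_singleton_self _), rfl⟩
    | one => exact Eventually.of_forall fun F => one_mem _
    | mul a b _ _ ha hb =>
      filter_upwards [ha, hb] with F h1 h2
      exact mul_mem h1 h2
  have e2 : ∀ k ∈ GG i₁ i₂ PP x y, ∀ k' ∈ GG i₁ i₂ PP x y,
      ⟪k', (Y₀ - i₂ ∘L S ∘L adjoint i₁) k⟫ = 0 := by
    intro k hk k' hk'
    refine cspan_orth _ ?_ hk hk'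
    rintro _ ⟨a, ha, rfl⟩ _ ⟨b, hb, rfl⟩
    rw [sub_apply, inner_sub_right, sub_eq_zero]
    refine tendsto_nhds_unique (hY₀ _ _) ?_
    refine (tendsto_const_nhds).congr' ?_
    filter_upwards [hev a ha, hev b hb] with F h1 h2
    rw [hY2 F a h1 b h2]
    simp only [ContinuousLinearMap.comp_apply, S]
    rw [i1_rho h, ← ContinuousLinearMap.adjoint_inner_left, i2_rho h,
      ContinuousLinearMap.adjoint_inner_right]
    simp [h.h11, h.h22, h.h12, h.h21]
  have e3 := e2 (p (i₁ u)) (pr_mem (GG_closed _ _ _) _) (p (i₂ v)) (pr_mem (GG_closed _ _ _) _)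
  rw [sub_apply, inner_sub_right, sub_eq_zero] at e3
  rw [e1, e3]
  simp only [ContinuousLinearMap.comp_apply, S, ap_apply]
  rw [← ContinuousLinearMap.adjoint_inner_left (ap ht₂ _), ap_adjoint, ap_apply,
    ← ContinuousLinearMap.adjoint_inner_left i₂, ContinuousLinearMap.adjoint_inner_right]
  simp only [tL_apply, ContinuousLinearMap.adjoint_comp, ContinuousLinearMap.adjoint_adjoint]
  rw [hp, pr_selfadj (GG_closed _ _ _)]
  rfl

def CC (P : Set (H₁ →L[ℂ] H₁)) : Set (H₁ →L[ℂ] H₁) := {c | ∀ p ∈ P, c * p = p * c}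

def BB (P : Set (H₁ →L[ℂ] H₁)) : Set (L2 ℕ T₁ →L[ℂ] L2 ℕ T₁) :=
  {A | ∃ c ∈ CC P, A = amp ℕ (ap ht₁ c)}

def px (P : Set (H₁ →L[ℂ] H₁)) (x : H₁) : H₁ →L[ℂ] H₁ :=
  pr (cspan {z | ∃ a ∈ Submonoid.closure P, z = a x})

theorem px_self (P : Set (H₁ →L[ℂ] H₁)) (x : H₁) : px P x x = x :=
  (pr_eq_self (isClosed_cspan _)).2 (subset_cspan _ ⟨1, one_mem _, rfl⟩)

theorem px_CC {P : Set (H₁ →L[ℂ] H₁)} (hs : ∀ p ∈ P, adjoint p = p) (x : H₁) : px P x ∈ CC P := by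
  intro p hp
  ext z
  refine pr_comm (isClosed_cspan _) (hs p hp) (fun z hz => ?_) z
  refine cspan_map (isClosed_cspan _) _ ?_ hz
  rintro _ ⟨a, ha, rfl⟩
  exact subset_cspan _ ⟨p * a, mul_mem (Submonoid.subset_closure hp) ha, rfl⟩

theorem CC_adj {P : Set (H₁ →L[ℂ] H₁)} (hs : ∀ p ∈ P, adjoint p = p) {c} (hc : c ∈ CC P) :
    adjoint c ∈ CC P := by
  intro p hp
  have := congrArg adjoint (hc p hp)
  simp only [ContinuousLinearMap.mul_def, ContinuousLinearMap.adjoint_comp, hs p hp] at this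
  exact this.symm

theorem CC_mul {P : Set (H₁ →L[ℂ] H₁)} {a b} (ha : a ∈ CC P) (hb : b ∈ CC P) : a * b ∈ CC P := by
  intro p hp
  rw [mul_assoc, hb p hp, ← mul_assoc, ha p hp, mul_assoc]

theorem CC_one {P : Set (H₁ →L[ℂ] H₁)} : 1 ∈ CC P := fun p _ => by simp

theorem BB_one (P : Set (H₁ →L[ℂ] H₁)) : 1 ∈ BB ht₁ P := ⟨1, CC_one, by rw [ap_one, amp_one]⟩
theorem BB_mul {P : Set (H₁ →L[ℂ] H₁)} : ∀ a ∈ BB ht₁ P, ∀ b ∈ BB ht₁ P, a * b ∈ BB ht₁ P := by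
  rintro _ ⟨a, ha, rfl⟩ _ ⟨b, hb, rfl⟩
  refine ⟨a * b, CC_mul ha hb, ?_⟩
  rw [ap_mul, ContinuousLinearMap.mul_def, ContinuousLinearMap.mul_def, amp_comp]
theorem BB_adj {P : Set (H₁ →L[ℂ] H₁)} (hs : ∀ p ∈ P, adjoint p = p) :
    ∀ a ∈ BB ht₁ P, adjoint a ∈ BB ht₁ P := by
  rintro _ ⟨a, ha, rfl⟩
  exact ⟨adjoint a, CC_adj hs ha, by rw [amp_adjoint, ap_adjoint]⟩

theorem step1 {P : Set (H₁ →L[ℂ] H₁)} (hs : ∀ p ∈ P, adjoint p = p) {q p' : H₁ →L[ℂ] H₁}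
    (hq : q ∈ CC P) (hp' : p' ∈ CC P) (hk : ∀ x, q x = 0 → p' x = 0) (ξ : L2 ℕ T₁) {b}
    (hb : b ∈ BB ht₁ P) :
    b (amp ℕ (ap ht₁ p') ξ) ∈ cspan {z | ∃ c ∈ CC P, z = amp ℕ (ap ht₁ c) (amp ℕ (ap ht₁ q) ξ)} := by
  obtain ⟨v, h1, h2⟩ := L_lemma (BB ht₁ P) {amp ℕ (ap ht₁ q)} (BB_one ht₁ P)
    (by rintro _ rfl; exact ⟨q, hq, rfl⟩) (BB_mul ht₁) (BB_adj ht₁ hs) ξ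
  have h3 := h2 _ rfl
  have h4 : amp ℕ (ap ht₁ p') v = 0 := by
    ext n
    have : amp ℕ (ap ht₁ q) v n = 0 := by rw [h3]; rfl
    exact ap_ker ht₁ hk this
  have h5 : amp ℕ (ap ht₁ p') ξ = amp ℕ (ap ht₁ p') (ξ - v) := by rw [map_sub, h4, sub_zero]
  rw [h5]
  refine cspan_map (isClosed_cspan _) (b * amp ℕ (ap ht₁ p')) ?_ h1
  rintro _ ⟨c, hc, _, rfl, rfl⟩
  obtain ⟨d, hd, h6⟩ := BB_mul ht₁ _ (BB_mul ht₁ _ hb _ ⟨p', hp', rfl⟩) _ hc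
  refine subset_cspan _ ⟨d, hd, ?_⟩
  rw [← h6]; rfl

theorem step2 {P : Set (H₁ →L[ℂ] H₁)} (hs : ∀ p ∈ P, adjoint p = p) (ξ : L2 ℕ T₁) :
    ξ ∈ cspan {z | ∃ b ∈ BB ht₁ P, ∃ x, z = b (amp ℕ (ap ht₁ (px P x)) ξ)} := by
  obtain ⟨v, h1, h2⟩ := L_lemma (BB ht₁ P) {A | ∃ x, A = amp ℕ (ap ht₁ (px P x))} (BB_one ht₁ P)
    (by rintro _ ⟨x, rfl⟩; exact ⟨_, px_CC hs x, rfl⟩) (BB_mul ht₁) (BB_adj ht₁ hs) ξ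
  have h3 : v = 0 := by
    ext n
    refine eq_zero_of_tL ht₁ fun y => ?_
    have h4 : ∀ x, px P x (adjoint (tL ht₁ y) (v n)) = 0 := by
      intro x
      have h5 : amp ℕ (ap ht₁ (px P x)) v n = 0 := by rw [h2 _ ⟨x, rfl⟩]; rfl
      rw [amp_apply] at h5
      have := congrArg (fun A => A (v n)) (tL_ap ht₁ (px P x) y)
      simp only [ContinuousLinearMap.comp_apply, h5, map_zero] at this
      exact this.symm
    have := h4 (adjoint (tL ht₁ y) (v n))
    rwa [px_self] at this
  rw [h3, sub_zero] at h1
  refine cspan_le (isClosed_cspan _) ?_ h1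
  rintro _ ⟨b, hb, _, ⟨x, rfl⟩, rfl⟩
  exact subset_cspan _ ⟨b, hb, x, rfl⟩

end B1
end
end OSH

namespace OSH
noncomputable section
section B2
variable {H₁ H₂ K₁ K₂ T₁ T₂ W : Type*}
  [NormedAddCommGroup H₁] [InnerProductSpace ℂ H₁] [CompleteSpace H₁]
  [NormedAddCommGroup H₂] [InnerProductSpace ℂ H₂] [CompleteSpace H₂]
  [NormedAddCommGroup K₁] [InnerProductSpace ℂ K₁] [CompleteSpace K₁]
  [NormedAddCommGroup K₂] [InnerProductSpace ℂ K₂] [CompleteSpace K₂]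
  [NormedAddCommGroup T₁] [InnerProductSpace ℂ T₁] [CompleteSpace T₁]
  [NormedAddCommGroup T₂] [InnerProductSpace ℂ T₂] [CompleteSpace T₂]
  [NormedAddCommGroup W] [InnerProductSpace ℂ W] [CompleteSpace W]
  {t₁ : H₁ → K₁ → T₁} {t₂ : H₂ → K₂ → T₂}
  (ht₁ : IsTensorEmbedding t₁) (ht₂ : IsTensorEmbedding t₂)
  {i₁ : H₁ →L[ℂ] W} {i₂ : H₂ →L[ℂ] W}

theorem q_ker {M : Submodule ℂ W} (hM : IsClosed (M : Set W)) (i : H₁ →L[ℂ] W) {u : H₁}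
    (h : (adjoint i ∘L pr M ∘L i) u = 0) : pr M (i u) = 0 := by
  have h1 : ⟪u, (adjoint i ∘L pr M ∘L i) u⟫ = 0 := by rw [h, inner_zero_right]
  simp only [ContinuousLinearMap.comp_apply] at h1
  rw [ContinuousLinearMap.adjoint_inner_right, ← pr_inner_pr hM] at h1
  exact inner_self_eq_zero.1 h1

theorem px_zero {P : Set (H₁ →L[ℂ] H₁)} {x u : H₁}
    (h : ∀ a ∈ Submonoid.closure P, ⟪a x, u⟫ = 0) : px P x u = 0 := by
  have hM := isClosed_cspan {z | ∃ a ∈ Submonoid.closure P, z = a x}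
  have h2 : ⟪px P x u, (1 : H₁ →L[ℂ] H₁) u⟫ = 0 := by
    refine cspan_orth (G := {u}) (G' := {z | ∃ a ∈ Submonoid.closure P, z = a x}) 1 ?_
      (subset_cspan _ rfl) (pr_mem hM u)
    rintro _ rfl _ ⟨a, ha, rfl⟩
    exact h a ha
  have h3 : ⟪px P x u, px P x u⟫ = 0 := by
    have := pr_inner_pr hM u u
    unfold px
    rw [this, ← pr_inner hM]
    exact h2
  exact inner_self_eq_zero.1 h3

theorem lemmaB (PP : Set ((H₁ →L[ℂ] H₁) × (H₂ →L[ℂ] H₂)))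
    (hidem : ∀ p ∈ PP, p * p = p)
    (hstar : ∀ p ∈ PP, star p = p) (hcomm : ∀ p ∈ PP, ∀ q ∈ PP, p * q = q * p)
    (U' : Submodule ℂ (K₁ →L[ℂ] K₂)) (T : T₁ →L[ℂ] T₂)
    (hT : ∀ p ∈ PP, ap ht₂ p.2 ∘L T = T ∘L ap ht₁ p.1)
    (hsl : ∀ u v, sl ht₁ ht₂ u v T ∈ U') :
    T ∈ Hull (Elem t₁ t₂ (Delta PP) (U' : Set _)) := by
  obtain ⟨i₁, i₂, h⟩ := exists_dsum H₁ H₂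
  set P₁ : Set (H₁ →L[ℂ] H₁) := Prod.fst '' PP with hP₁
  set P₂ : Set (H₂ →L[ℂ] H₂) := Prod.snd '' PP with hP₂
  have hs₁ : ∀ p ∈ P₁, adjoint p = p := by
    rintro _ ⟨p, hp, rfl⟩
    exact congrArg Prod.fst (hstar p hp)
  have hs₂ : ∀ p ∈ P₂, adjoint p = p := by
    rintro _ ⟨p, hp, rfl⟩
    exact congrArg Prod.snd (hstar p hp)
  have hcl₁ : ∀ a ∈ Submonoid.closure P₁, ∃ a' ∈ Submonoid.closure PP, a'.1 = a := by
    intro a ha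
    have := MonoidHom.map_mclosure (MonoidHom.fst (H₁ →L[ℂ] H₁) (H₂ →L[ℂ] H₂)) PP
    have h2 : a ∈ Submonoid.closure ((MonoidHom.fst (H₁ →L[ℂ] H₁) (H₂ →L[ℂ] H₂)) '' PP) := ha
    rw [← this] at h2
    exact h2
  have hcl₂ : ∀ a ∈ Submonoid.closure P₂, ∃ a' ∈ Submonoid.closure PP, a'.2 = a := by
    intro a ha
    have := MonoidHom.map_mclosure (MonoidHom.snd (H₁ →L[ℂ] H₁) (H₂ →L[ℂ] H₂)) PP
    have h2 : a ∈ Submonoid.closure ((MonoidHom.snd (H₁ →L[ℂ] H₁) (H₂ →L[ℂ] H₂)) '' PP) := ha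
    rw [← this] at h2
    exact h2
  rw [mem_Hull']
  intro ξ η hω
  let q1 := fun x y => adjoint i₁ ∘L pr (GG i₁ i₂ PP x y) ∘L i₁
  let q2 := fun x y => adjoint i₂ ∘L pr (GG i₁ i₂ PP x y) ∘L i₂
  have hq1 : ∀ x y, q1 x y ∈ CC P₁ := by
    rintro x y _ ⟨p, hp, rfl⟩
    ext z
    simp only [q1, ContinuousLinearMap.mul_def, ContinuousLinearMap.comp_apply]
    rw [← rho_i1 h, GG_comm h hstar x y (Subring.subset_closure hp), i1_rho h]
  have hq2 : ∀ x y, q2 x y ∈ CC P₂ := by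
    rintro x y _ ⟨p, hp, rfl⟩
    ext z
    simp only [q2, ContinuousLinearMap.mul_def, ContinuousLinearMap.comp_apply]
    rw [← rho_i2 h, GG_comm h hstar x y (Subring.subset_closure hp), i2_rho h]
  have hq2a : ∀ x y, adjoint (q2 x y) = q2 x y := by
    intro x y
    simp only [q2, ContinuousLinearMap.adjoint_comp, ContinuousLinearMap.adjoint_adjoint,
      pr_selfadj (GG_closed _ _ _)]
    rfl
  have orth : ∀ x y a, a ∈ Submonoid.closure PP → ∀ w, pr (GG i₁ i₂ PP x y) w = 0 →
      ⟪rho i₁ i₂ a (i₁ x + i₂ y), w⟫ = 0 := by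
    intro x y a ha w hw
    have hm : rho i₁ i₂ a (i₁ x + i₂ y) ∈ GG i₁ i₂ PP x y := subset_cspan _ ⟨a, ha, rfl⟩
    rw [← (pr_eq_self (GG_closed _ _ _)).2 hm, pr_inner (GG_closed _ _ _), hw, inner_zero_right]
  have k1 : ∀ x y u, q1 x y u = 0 → px P₁ x u = 0 := by
    intro x y u hu
    have h1 := q_ker (GG_closed _ _ _) _ hu
    refine px_zero fun a ha => ?_
    obtain ⟨a, ha', rfl⟩ := hcl₁ a ha
    have h2 := orth x y a ha' _ h1
    rw [← ContinuousLinearMap.adjoint_inner_left, i1_rho h, map_add, h.h11, h.h12, add_zero] at h2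
    exact h2
  have k2 : ∀ x y u, q2 x y u = 0 → px P₂ y u = 0 := by
    intro x y u hu
    have h1 := q_ker (GG_closed _ _ _) _ hu
    refine px_zero fun a ha => ?_
    obtain ⟨a, ha', rfl⟩ := hcl₂ a ha
    have h2 := orth x y a ha' _ h1
    rw [← ContinuousLinearMap.adjoint_inner_left, i2_rho h, map_add, h.h22, h.h21, zero_add] at h2
    exact h2
  have base : ∀ x y, ∀ c ∈ CC P₁, ∀ b ∈ CC P₂,
      ⟪amp ℕ (ap ht₂ b) (amp ℕ (ap ht₂ (q2 x y)) η),
        amp ℕ T (amp ℕ (ap ht₁ c) (amp ℕ (ap ht₁ (q1 x y)) ξ))⟫ = 0 := by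
    intro x y c hc b hb
    have hb' := CC_adj hs₂ hb
    have hm := B0b ht₁ ht₂ h PP hidem hstar hcomm U' (ap ht₂ (adjoint b) ∘L T ∘L ap ht₁ c) ?_ ?_ x y
    · have := mem_Hull'.1 hm ξ η hω
      rw [← this]
      change _ = ⟪η, amp ℕ (ap ht₂ (q2 x y) ∘L (ap ht₂ (adjoint b) ∘L T ∘L ap ht₁ c) ∘L
        ap ht₁ (q1 x y)) ξ⟫
      simp only [amp_comp, ContinuousLinearMap.comp_apply]
      rw [amp_inner_adj (ap ht₂ (q2 x y)), ap_adjoint, hq2a, amp_inner_adj (ap ht₂ (adjoint b)), ap_adjoint,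
        ContinuousLinearMap.adjoint_adjoint]
    · intro p hp
      have e1 : ∀ z, ap ht₂ p.2 (ap ht₂ (adjoint b) z) = ap ht₂ (adjoint b) (ap ht₂ p.2 z) := by
        intro z
        have := congrArg (fun A => ap ht₂ A z) (hb' p.2 ⟨p, hp, rfl⟩)
        simp only [ap_mul] at this
        exact this.symm
      have e2 : ∀ z, ap ht₁ p.1 (ap ht₁ c z) = ap ht₁ c (ap ht₁ p.1 z) := by
        intro z
        have := congrArg (fun A => ap ht₁ A z) (hc p.1 ⟨p, hp, rfl⟩)
        simp only [ap_mul] at this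
        exact this.symm
      ext z
      simp only [ContinuousLinearMap.comp_apply]
      rw [e1, intertw ht₁ ht₂ hT (Subring.subset_closure hp), e2]
    · intro u v
      have : sl ht₁ ht₂ u v (ap ht₂ (adjoint b) ∘L T ∘L ap ht₁ c) = sl ht₁ ht₂ (c u) (b v) T := by
        ext w
        apply ext_inner_left ℂ
        intro z
        rw [sl_inner, sl_inner]
        simp only [ContinuousLinearMap.comp_apply, ap_apply]
        rw [← ap_adjoint, ContinuousLinearMap.adjoint_inner_right, ap_apply]
      rw [this]
      exact hsl _ _
  refine cspan_orth (amp ℕ T) ?_ (step2 ht₁ hs₁ ξ) (step2 ht₂ hs₂ η)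
  rintro _ ⟨c, hc, x, rfl⟩ _ ⟨b, hb, y, rfl⟩
  refine cspan_orth (amp ℕ T) ?_ (step1 ht₁ hs₁ (hq1 x y) (px_CC hs₁ x) (k1 x y) ξ hc)
    (step1 ht₂ hs₂ (hq2 x y) (px_CC hs₂ y) (k2 x y) η hb)
  rintro _ ⟨c, hc, rfl⟩ _ ⟨b, hb, rfl⟩
  exact base x y c hc b hb

end B2
end
end OSH

namespace OSH
noncomputable section
section Main
variable {H₁ H₂ K₁ K₂ T₁ T₂ : Type*}
  [NormedAddCommGroup H₁] [InnerProductSpace ℂ H₁] [CompleteSpace H₁]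
  [NormedAddCommGroup H₂] [InnerProductSpace ℂ H₂] [CompleteSpace H₂]
  [NormedAddCommGroup K₁] [InnerProductSpace ℂ K₁] [CompleteSpace K₁]
  [NormedAddCommGroup K₂] [InnerProductSpace ℂ K₂] [CompleteSpace K₂]
  [NormedAddCommGroup T₁] [InnerProductSpace ℂ T₁] [CompleteSpace T₁]
  [NormedAddCommGroup T₂] [InnerProductSpace ℂ T₂] [CompleteSpace T₂]
  {t₁ : H₁ → K₁ → T₁} {t₂ : H₂ → K₂ → T₂}
  (ht₁ : IsTensorEmbedding t₁) (ht₂ : IsTensorEmbedding t₂)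
  {α : Type*} {r : ℕ}

def IS (V : α → Set (H₁ →L[ℂ] H₂)) (S : Finset α) : Set (H₁ →L[ℂ] H₂) := {v | ∀ a ∈ S, v ∈ V a}

variable (t₁ t₂) in
def Gen (V : α → Set (H₁ →L[ℂ] H₂)) (U : Set (K₁ →L[ℂ] K₂)) (S : Finset α) (R : Fin r → Finset α)
    (Us : Fin r → Set (K₁ →L[ℂ] K₂)) : Set (T₁ →L[ℂ] T₂) :=
  Elem t₁ t₂ (IS V S) U ∪ ⋃ i, Elem t₁ t₂ (IS V (R i)) (Us i)

theorem gcut {V : α → Set (H₁ →L[ℂ] H₂)} {U : Set (K₁ →L[ℂ] K₂)} {S : Finset α}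
    {R : Fin r → Finset α} {Us : Fin r → Set (K₁ →L[ℂ] K₂)} {G' : Set (T₁ →L[ℂ] T₂)}
    (b : H₂ →L[ℂ] H₂) (a : H₁ →L[ℂ] H₁)
    (h1 : ∀ s ∈ IS V S, ∀ u ∈ U, tens ht₁ ht₂ (b ∘L s ∘L a) u ∈ Hull G')
    (h2 : ∀ i, ∀ s ∈ IS V (R i), ∀ u ∈ Us i, tens ht₁ ht₂ (b ∘L s ∘L a) u ∈ Hull G')
    {T : T₁ →L[ℂ] T₂} (hT : T ∈ Hull (Gen t₁ t₂ V U S R Us)) :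
    ap ht₂ b ∘L T ∘L ap ht₁ a ∈ Hull G' := by
  refine Hull_cut _ _ ?_ hT
  rintro X (hX | hX)
  · rw [Elem_eq ht₁ ht₂] at hX
    obtain ⟨s, hs, u, hu, rfl⟩ := hX
    rw [ap_tens_ap]; exact h1 s hs u hu
  · rw [mem_iUnion] at hX
    obtain ⟨i, hX⟩ := hX
    rw [Elem_eq ht₁ ht₂] at hX
    obtain ⟨s, hs, u, hu, rfl⟩ := hX
    rw [ap_tens_ap]; exact h2 i s hs u hu

theorem mem_C {V : α → Set (H₁ →L[ℂ] H₂)} {U : Set (K₁ →L[ℂ] K₂)} {S : Finset α}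
    {R : Fin r → Finset α} {Us : Fin r → Set (K₁ →L[ℂ] K₂)} {s u} (hs : s ∈ IS V S) (hu : u ∈ U) :
    tens ht₁ ht₂ s u ∈ Hull (Gen t₁ t₂ V U S R Us) :=
  subset_Hull _ (Or.inl (tens_mem_Elem ht₁ ht₂ hs hu))

theorem mem_B {V : α → Set (H₁ →L[ℂ] H₂)} {U : Set (K₁ →L[ℂ] K₂)} {S : Finset α}
    {R : Fin r → Finset α} {Us : Fin r → Set (K₁ →L[ℂ] K₂)} {s u} (i : Fin r)
    (hs : s ∈ IS V (R i)) (hu : u ∈ Us i) :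
    tens ht₁ ht₂ s u ∈ Hull (Gen t₁ t₂ V U S R Us) :=
  subset_Hull _ (Or.inr (mem_iUnion.2 ⟨i, tens_mem_Elem ht₁ ht₂ hs hu⟩))

theorem tens_zero_left (u : K₁ →L[ℂ] K₂) : tens ht₁ ht₂ (0 : H₁ →L[ℂ] H₂) u = 0 :=
  te_ext ht₁ fun x y => by
    rw [tens_apply, zero_apply, ← tL_apply ht₂, map_zero]; rfl

theorem tens_zero_right (s : H₁ →L[ℂ] H₂) : tens ht₁ ht₂ s (0 : K₁ →L[ℂ] K₂) = 0 :=
  norm_le_zero_iff.1 ((tens_norm ht₁ ht₂ s 0).trans (by simp))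

/-- cells -/
theorem cells [DecidableEq α] {D₁ : StarSubalgebra ℂ (H₁ →L[ℂ] H₁)}
    {D₂ : StarSubalgebra ℂ (H₂ →L[ℂ] H₂)}
    {V : α → Set (H₁ →L[ℂ] H₂)} (hV : ∀ a, IsMasaBimodule D₁ D₂ (V a))
    {m : ℕ} (U : Set (K₁ →L[ℂ] K₂)) (A : Finset α)
    (IH : ∀ a ∈ A, ∀ (S : Fin m → Finset α) (R : Fin r → Finset α) (Us : Fin r → Set (K₁ →L[ℂ] K₂)),
      (∀ j, S j ⊆ A.erase a) → (∀ i, R i ⊆ A.erase a) → ∀ T : T₁ →L[ℂ] T₂,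
      (∀ j, T ∈ Hull (Gen t₁ t₂ V U (S j) R Us)) →
        T ∈ Hull (Gen t₁ t₂ V U (Finset.univ.biUnion S) R Us))
    (S : Fin m → Finset α) (R : Fin r → Finset α) (Us : Fin r → Set (K₁ →L[ℂ] K₂))
    (hS : ∀ j, S j ⊆ A) (hR : ∀ i, R i ⊆ A) (T : T₁ →L[ℂ] T₂)
    (hT : ∀ j, T ∈ Hull (Gen t₁ t₂ V U (S j) R Us)) (a : α) (ha : a ∈ A)
    (P : H₁ →L[ℂ] H₁) (Q : H₂ →L[ℂ] H₂) (hP : P ∈ D₁) (hQ : Q ∈ D₂)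
    (hl : ∀ v ∈ V a, (1 - Q) ∘L v ∘L P = 0) (hu : ∀ X, Q ∘L X ∘L (1 - P) ∈ V a) :
    ap ht₂ Q ∘L T ∘L ap ht₁ (1 - P) ∈ Hull (Gen t₁ t₂ V U (Finset.univ.biUnion S) R Us) ∧
    ap ht₂ (1 - Q) ∘L T ∘L ap ht₁ P ∈ Hull (Gen t₁ t₂ V U (Finset.univ.biUnion S) R Us) := by
  have hP' : 1 - P ∈ D₁ := sub_mem (one_mem _) hP
  have hQ' : 1 - Q ∈ D₂ := sub_mem (one_mem _) hQ
  have hIS : ∀ (S : Finset α) s, s ∈ IS V S → ∀ A ∈ D₁, ∀ B ∈ D₂, B ∘L s ∘L A ∈ IS V S :=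
    fun S s hs A hA B hB a ha => (hV a).2 s (hs a ha) A hA B hB
  have hmono : ∀ {S S' : Finset α}, S ⊆ S' → IS V S' ⊆ IS V S := fun h v hv a ha => hv a (h ha)
  constructor
  · have h1 := IH a ha (fun j => (S j).erase a) (fun i => (R i).erase a) Us
      (fun j => Finset.erase_subset_erase _ (hS j)) (fun i => Finset.erase_subset_erase _ (hR i)) T
      (fun j => by
        refine Hull_mono ?_ (hT j)
        refine union_subset_union ?_ (iUnion_mono fun i => ?_)
        · rintro X ⟨s, hs, u, hu, h⟩
          exact ⟨s, hmono (Finset.erase_subset _ _) hs, u, hu, h⟩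
        · rintro X ⟨s, hs, u, hu, h⟩
          exact ⟨s, hmono (Finset.erase_subset _ _) hs, u, hu, h⟩)
    refine gcut ht₁ ht₂ Q (1 - P) ?_ ?_ h1
    · intro s hs u hU
      refine mem_C ht₁ ht₂ ?_ hU
      intro b hb
      by_cases hba : b = a
      · subst hba; exact hu s
      · obtain ⟨j, -, hj⟩ := Finset.mem_biUnion.1 hb
        exact hIS _ s hs _ hP' _ hQ b (Finset.mem_biUnion.2 ⟨j, Finset.mem_univ _,
          Finset.mem_erase.2 ⟨hba, hj⟩⟩)
    · intro i s hs u hU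
      refine mem_B ht₁ ht₂ i ?_ hU
      intro b hb
      by_cases hba : b = a
      · subst hba; exact hu s
      · exact hIS _ s hs _ hP' _ hQ b (Finset.mem_erase.2 ⟨hba, hb⟩)
  · by_cases hj : ∃ j, a ∈ S j
    · obtain ⟨j, hj⟩ := hj
      refine gcut ht₁ ht₂ (1 - Q) P ?_ ?_ (hT j)
      · intro s hs u hU
        rw [hl s (hs a hj), tens_zero_left]
        exact zero_mem _
      · intro i s hs u hU
        exact mem_B ht₁ ht₂ i (hIS _ s hs _ hP _ hQ') hU
    · push Not at hj
      have h1 := IH a ha S (fun i => (R i).erase a) (fun i => if a ∈ R i then {0} else Us i)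
        (fun j => Finset.subset_erase.2 ⟨hS j, hj j⟩)
        (fun i => Finset.erase_subset_erase _ (hR i)) (ap ht₂ (1 - Q) ∘L T ∘L ap ht₁ P)
        (fun j => by
          refine gcut ht₁ ht₂ (1 - Q) P ?_ ?_ (hT j)
          · intro s hs u hU
            exact mem_C ht₁ ht₂ (hIS _ s hs _ hP _ hQ') hU
          · intro i s hs u hU
            by_cases hi : a ∈ R i
            · rw [hl s (hs a hi), tens_zero_left]
              exact zero_mem _
            · refine mem_B ht₁ ht₂ i (hmono (Finset.erase_subset _ _) (hIS _ s hs _ hP _ hQ')) ?_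
              rw [if_neg hi]; exact hU)
      refine Hull_le ?_ h1
      rintro X (hX | hX)
      · exact subset_Hull _ (Or.inl hX)
      · rw [mem_iUnion] at hX
        obtain ⟨i, hX⟩ := hX
        rw [Elem_eq ht₁ ht₂] at hX
        obtain ⟨s, hs, u, hU, rfl⟩ := hX
        beta_reduce at hs hU
        by_cases hi : a ∈ R i
        · rw [if_pos hi] at hU
          rw [hU, tens_zero_right]
          exact zero_mem _
        · rw [if_neg hi] at hU
          rw [Finset.erase_eq_of_notMem hi] at hs
          exact mem_B ht₁ ht₂ i hs hU

end Main
end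
end OSH

namespace OSH
noncomputable section
section Dg
variable {E F : Type*} [NormedAddCommGroup E] [InnerProductSpace ℂ E] [CompleteSpace E]
  [NormedAddCommGroup F] [InnerProductSpace ℂ F] [CompleteSpace F]

def dg (p : E →L[ℂ] E) (q : F →L[ℂ] F) (X : E →L[ℂ] F) : E →L[ℂ] F :=
  q ∘L X ∘L p + (1 - q) ∘L X ∘L (1 - p)

theorem dg_apply (p : E →L[ℂ] E) (q : F →L[ℂ] F) (X : E →L[ℂ] F) (x : E) :
    dg p q X x = q (X (p x)) + (X (x - p x) - q (X (x - p x))) := by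
  simp only [dg, add_apply, ContinuousLinearMap.comp_apply, sub_apply,
    ContinuousLinearMap.one_apply]

theorem sub_dg (p : E →L[ℂ] E) (q : F →L[ℂ] F) (X : E →L[ℂ] F) :
    X - dg p q X = q ∘L X ∘L (1 - p) + (1 - q) ∘L X ∘L p := by
  ext x
  simp only [sub_apply, dg_apply, add_apply, ContinuousLinearMap.comp_apply,
    ContinuousLinearMap.one_apply, map_sub]
  abel

theorem dg_comm {p : E →L[ℂ] E} {q : F →L[ℂ] F} (X : E →L[ℂ] F) (hp : ∀ x, p (p x) = p x)
    (hq : ∀ x, q (q x) = q x) : q ∘L dg p q X = dg p q X ∘L p := by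
  ext x
  simp only [dg_apply, ContinuousLinearMap.comp_apply, map_add, map_sub, hp, hq]
  abel

theorem dg_comm' {p p' : E →L[ℂ] E} {q q' : F →L[ℂ] F} (X : E →L[ℂ] F)
    (hp : ∀ x, p (p' x) = p' (p x)) (hq : ∀ x, q (q' x) = q' (q x)) 
    (h : q' ∘L X = X ∘L p') : q' ∘L dg p q X = dg p q X ∘L p' := by
  have h' : ∀ x, q' (X x) = X (p' x) := fun x => DFunLike.congr_fun h x
  ext x
  simp only [dg_apply, ContinuousLinearMap.comp_apply, map_add, map_sub, hp, ← hq, h']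

theorem dg_norm {p : E →L[ℂ] E} {q : F →L[ℂ] F} (X : E →L[ℂ] F) (hp : p ∘L p = p)
    (hq : q ∘L q = q) (hp' : adjoint p = p) (hq' : adjoint q = q) : ‖dg p q X‖ ≤ ‖X‖ := by
  have one_sub : ∀ {G : Type _} [NormedAddCommGroup G] [InnerProductSpace ℂ G] [CompleteSpace G]
      (p : G →L[ℂ] G), p ∘L p = p → (1 - p) ∘L (1 - p) = 1 - p := by
    intro G _ _ _ p hp
    have : ∀ x, p (p x) = p x := fun x => DFunLike.congr_fun hp x
    ext x
    simp [this]
  have hadj : ∀ {G : Type _} [NormedAddCommGroup G] [InnerProductSpace ℂ G] [CompleteSpace G]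
      (p : G →L[ℂ] G), adjoint p = p → adjoint (1 - p) = 1 - p := by
    intro G _ _ _ p hp
    rw [map_sub, hp, ← ContinuousLinearMap.star_eq_adjoint, star_one]
  have one_sub' : (1 - q) ∘L (1 - q) = 1 - q := by
    have : ∀ x, q (q x) = q x := fun x => DFunLike.congr_fun hq x
    ext x
    simp [this]
  have hadj' : adjoint (1 - q) = 1 - q := by
    rw [map_sub, hq', ← ContinuousLinearMap.star_eq_adjoint, star_one]
  have h := blockdiag (fun k : Bool => if k then p else 1 - p)
    (by intro k; cases k <;> simp only [if_true, Bool.false_eq_true, if_false] <;>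
          [exact one_sub p hp; exact hp])
    (by intro k; cases k <;> simp only [if_true, Bool.false_eq_true, if_false] <;>
          [exact hadj p hp'; exact hp'])
    (by simp)
    (fun k : Bool => if k then q else 1 - q)
    (by intro k; cases k <;> simp only [if_true, Bool.false_eq_true, if_false] <;>
          [exact one_sub'; exact hq])
    (by intro k; cases k <;> simp only [if_true, Bool.false_eq_true, if_false] <;>
          [exact hadj'; exact hq'])
    (by simp)
    (fun _ => X) (norm_nonneg X) (fun _ => le_rfl)
  rw [Fintype.sum_bool] at h
  simpa [dg] using h

end Dg
section Main
variable {H₁ H₂ K₁ K₂ T₁ T₂ : Type*}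
  [NormedAddCommGroup H₁] [InnerProductSpace ℂ H₁] [CompleteSpace H₁]
  [NormedAddCommGroup H₂] [InnerProductSpace ℂ H₂] [CompleteSpace H₂]
  [NormedAddCommGroup K₁] [InnerProductSpace ℂ K₁] [CompleteSpace K₁]
  [NormedAddCommGroup K₂] [InnerProductSpace ℂ K₂] [CompleteSpace K₂]
  [NormedAddCommGroup T₁] [InnerProductSpace ℂ T₁] [CompleteSpace T₁]
  [NormedAddCommGroup T₂] [InnerProductSpace ℂ T₂] [CompleteSpace T₂]
  {t₁ : H₁ → K₁ → T₁} {t₂ : H₂ → K₂ → T₂}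
  (ht₁ : IsTensorEmbedding t₁) (ht₂ : IsTensorEmbedding t₂)
  {α : Type*} {r : ℕ}

theorem ap_idem {p : H₁ →L[ℂ] H₁} (hp : IsProj p) : ap ht₁ p ∘L ap ht₁ p = ap ht₁ p :=
  (ap_mul ht₁ p p).symm.trans (congrArg _ hp.1)

theorem ap_sa {p : H₁ →L[ℂ] H₁} (hp : IsProj p) : adjoint (ap ht₁ p) = ap ht₁ p := by
  rw [ap_adjoint]; exact congrArg _ hp.2

theorem ap_commute {p q : H₁ →L[ℂ] H₁} (h : p * q = q * p) (x : T₁) :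
    ap ht₁ p (ap ht₁ q x) = ap ht₁ q (ap ht₁ p x) := by
  have := (ap_mul ht₁ p q).symm.trans ((congrArg _ h).trans (ap_mul ht₁ q p))
  exact DFunLike.congr_fun this x

theorem sl_hull {V : α → Set (H₁ →L[ℂ] H₂)} {U : Set (K₁ →L[ℂ] K₂)} {S : Finset α}
    {R : Fin r → Finset α} {Us : Fin r → Set (K₁ →L[ℂ] K₂)} {T : T₁ →L[ℂ] T₂}
    (hT : T ∈ Hull (Gen t₁ t₂ V U S R Us)) (u : H₁) (v : H₂) :
    sl ht₁ ht₂ u v T ∈ Hull (U ∪ ⋃ i, Us i) := by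
  refine Hull_cut _ _ ?_ hT
  intro X hX
  change sl ht₁ ht₂ u v X ∈ _
  rcases hX with hX | hX
  · rw [Elem_eq ht₁ ht₂] at hX
    obtain ⟨s, hs, w, hw, rfl⟩ := hX
    rw [sl_tens]
    exact Submodule.smul_mem _ _ (subset_Hull _ (Or.inl hw))
  · rw [mem_iUnion] at hX
    obtain ⟨i, hX⟩ := hX
    rw [Elem_eq ht₁ ht₂] at hX
    obtain ⟨s, hs, w, hw, rfl⟩ := hX
    rw [sl_tens]
    exact Submodule.smul_mem _ _ (subset_Hull _ (Or.inr (mem_iUnion.2 ⟨i, hw⟩)))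

theorem Hull_lim {E F ι : Type*} [NormedAddCommGroup E] [InnerProductSpace ℂ E]
    [NormedAddCommGroup F] [InnerProductSpace ℂ F] {𝒰 : Ultrafilter ι} {S : ι → E →L[ℂ] F}
    {S₀ : E →L[ℂ] F} {G : Set (E →L[ℂ] F)}
    (h : ∀ f, Normal f → Filter.Tendsto (fun i => f (S i)) 𝒰 (nhds (f S₀)))
    (hS : ∀ i, S i ∈ Hull G) : S₀ ∈ Hull G := by
  intro f hf h0
  have h1 := h f hf
  have h2 : (fun i => f (S i)) = fun _ => 0 := funext fun i => hS i f hf h0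
  rw [h2] at h1
  exact tendsto_nhds_unique h1 tendsto_const_nhds

theorem main_claim (ht₁ : IsTensorEmbedding t₁) (ht₂ : IsTensorEmbedding t₂) [DecidableEq α] [TopologicalSpace.SeparableSpace H₂]
    {D₁ : StarSubalgebra ℂ (H₁ →L[ℂ] H₁)}
    {D₂ : StarSubalgebra ℂ (H₂ →L[ℂ] H₂)} (hD₁ : IsMasa D₁) (hD₂ : IsMasa D₂)
    {V : α → Set (H₁ →L[ℂ] H₂)} (hV : ∀ a, IsMasaBimodule D₁ D₂ (V a))
    (hVn : ∀ a, IsNestBimodule (V a))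
    {m : ℕ} (hm : 0 < m) (U : Set (K₁ →L[ℂ] K₂)) (A : Finset α) :
    ∀ (S : Fin m → Finset α) (R : Fin r → Finset α) (Us : Fin r → Set (K₁ →L[ℂ] K₂)),
      (∀ j, S j ⊆ A) → (∀ i, R i ⊆ A) → ∀ T : T₁ →L[ℂ] T₂,
      (∀ j, T ∈ Hull (Gen t₁ t₂ V U (S j) R Us)) →
        T ∈ Hull (Gen t₁ t₂ V U (Finset.univ.biUnion S) R Us) := by
  classical
  induction A using Finset.strongInduction with
  | H A IH0 =>
  have IH := fun a ha => IH0 (A.erase a) (Finset.erase_ssubset ha)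
  intro S R Us hS hR T hT
  choose PP hPP hPP2 using fun a => pairs hD₁ hD₂ (hV a) (hVn a)
  set Q : Set ((H₁ →L[ℂ] H₁) × (H₂ →L[ℂ] H₂)) := {p | ∃ a ∈ A, p ∈ PP a} with hQ
  have hIS : ∀ (S : Finset α) s, s ∈ IS V S → ∀ A ∈ D₁, ∀ B ∈ D₂, B ∘L s ∘L A ∈ IS V S :=
    fun S s hs A hA B hB a ha => (hV a).2 s (hs a ha) A hA B hB
  have key : ∀ F : Finset Q, ∃ X : T₁ →L[ℂ] T₂, ‖X‖ ≤ ‖T‖ ∧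
      (∀ j, X ∈ Hull (Gen t₁ t₂ V U (S j) R Us)) ∧
      T - X ∈ Hull (Gen t₁ t₂ V U (Finset.univ.biUnion S) R Us) ∧
      ∀ p ∈ F, ap ht₂ p.1.2 ∘L X = X ∘L ap ht₁ p.1.1 := by
    intro F
    induction F using Finset.induction_on with
    | empty => exact ⟨T, le_rfl, hT, by simp, by simp⟩
    | insert p F hpF ih =>
      obtain ⟨X, hX1, hX2, hX3, hX4⟩ := ih
      obtain ⟨a, ha, hpa⟩ := p.2
      obtain ⟨h1, h2, h3, h4, h5, h6⟩ := hPP a _ hpa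
      have hc := cells ht₁ ht₂ hV U A IH S R Us hS hR X hX2 a ha p.1.1 p.1.2 h1 h3 h5 h6
      refine ⟨dg (ap ht₁ p.1.1) (ap ht₂ p.1.2) X, ?_, ?_, ?_, ?_⟩
      · exact (dg_norm X (ap_idem ht₁ h2) (ap_idem ht₂ h4) (ap_sa ht₁ h2) (ap_sa ht₂ h4)).trans hX1
      · intro j
        have hg : ∀ a ∈ D₁, ∀ b ∈ D₂, ap ht₂ b ∘L X ∘L ap ht₁ a ∈
            Hull (Gen t₁ t₂ V U (S j) R Us) := fun a ha b hb => by
          refine gcut ht₁ ht₂ b a ?_ ?_ (hX2 j)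
          · intro s hs u hu
            exact mem_C ht₁ ht₂ (hIS _ s hs _ ha _ hb) hu
          · intro i s hs u hu
            exact mem_B ht₁ ht₂ i (hIS _ s hs _ ha _ hb) hu
        refine add_mem (hg _ h1 _ h3) ?_
        have := hg _ (sub_mem (one_mem _) h1) _ (sub_mem (one_mem _) h3)
        rwa [ap_sub, ap_sub, ap_one, ap_one] at this
      · rw [ap_sub, ap_sub, ap_one, ap_one] at hc
        have h := add_mem hX3 (add_mem hc.1 hc.2)
        rw [← sub_dg] at h
        simpa using h
      · intro q hq
        rw [Finset.mem_insert] at hq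
        rcases hq with rfl | hq
        · exact dg_comm X (fun x => DFunLike.congr_fun (ap_idem ht₁ h2) x)
            (fun x => DFunLike.congr_fun (ap_idem ht₂ h4) x)
        · obtain ⟨b, hb, hqb⟩ := q.2
          obtain ⟨g1, g2, g3, g4, g5, g6⟩ := hPP b _ hqb
          exact dg_comm' X (ap_commute ht₁ (hD₁.1 _ h1 _ g1)) (ap_commute ht₂ (hD₂.1 _ h3 _ g3))
            (hX4 q hq)
  choose X hX1 hX2 hX3 hX4 using key
  let 𝒰 : Ultrafilter (Finset Q) := Ultrafilter.of Filter.atTop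
  obtain ⟨S₀, hw, hn⟩ := wot_limit' 𝒰 X ‖T‖ hX1
  have hS0 : ∀ j, S₀ ∈ Hull (Gen t₁ t₂ V U (S j) R Us) := fun j => Hull_lim hn (fun F => hX2 F j)
  have hM : T - S₀ ∈ Hull (Gen t₁ t₂ V U (Finset.univ.biUnion S) R Us) := by
    intro f hf h0
    have e : ∀ x y, f (x - y) = f x - f y := fun x y => by
      have := hf.map_add (x - y) y
      rw [sub_add_cancel] at this
      rw [this]; ring
    have h1 := hn f hf
    have h2 : (fun F => f (X F)) = fun _ => f T := funext fun F => by
      have := hX3 F f hf h0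
      rw [e, sub_eq_zero] at this
      exact this.symm
    rw [h2] at h1
    rw [e, tendsto_nhds_unique h1 tendsto_const_nhds, sub_self]
  have hint : ∀ p ∈ Q, ap ht₂ p.2 ∘L S₀ = S₀ ∘L ap ht₁ p.1 := by
    intro p hp
    ext x
    refine ext_inner_left ℂ fun y => ?_
    have l1 := hw (ap ht₁ p.1 x) y
    have l2 := hw x (adjoint (ap ht₂ p.2) y)
    simp only [ContinuousLinearMap.adjoint_inner_left] at l2
    have ev : ∀ᶠ F in (𝒰 : Filter (Finset Q)), (⟨p, hp⟩ : Q) ∈ F := by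
      refine Ultrafilter.of_le _ ?_
      filter_upwards [Filter.eventually_ge_atTop {(⟨p, hp⟩ : Q)}] with F hF
      exact hF (Finset.mem_singleton_self _)
    refine tendsto_nhds_unique l2 (l1.congr' ?_)
    filter_upwards [ev] with F hF
    have := DFunLike.congr_fun (hX4 F _ hF) x
    exact congrArg _ this.symm
  have hB := lemmaB ht₁ ht₂ Q
    (by
      rintro p ⟨a, ha, hpa⟩
      obtain ⟨h1, h2, h3, h4, h5, h6⟩ := hPP a _ hpa
      exact Prod.ext h2.1 h4.1)
    (by
      rintro p ⟨a, ha, hpa⟩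
      obtain ⟨h1, h2, h3, h4, h5, h6⟩ := hPP a _ hpa
      exact Prod.ext h2.2 h4.2)
    (by
      rintro p ⟨a, ha, hpa⟩ q ⟨b, hb, hqb⟩
      obtain ⟨h1, h2, h3, h4, h5, h6⟩ := hPP a _ hpa
      obtain ⟨g1, g2, g3, g4, g5, g6⟩ := hPP b _ hqb
      exact Prod.ext (hD₁.1 _ h1 _ g1) (hD₂.1 _ h3 _ g3))
    (Hull (U ∪ ⋃ i, Us i)) S₀ hint (fun u v => sl_hull ht₁ ht₂ (hS0 ⟨0, hm⟩) u v)
  have hS0M : S₀ ∈ Hull (Gen t₁ t₂ V U (Finset.univ.biUnion S) R Us) := by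
    refine Hull_le ?_ hB
    intro Y hY
    rw [Elem_eq ht₁ ht₂] at hY
    obtain ⟨d, hd, w, hw, rfl⟩ := hY
    have hdV : ∀ a ∈ A, d ∈ V a := fun a ha => hPP2 a d fun p hp => hd p ⟨a, ha, hp⟩
    refine Hull_map (tens ht₁ ht₂ d) (fun f hf => normal_tens ht₁ ht₂ d hf) ?_ hw
    rintro w (hw | hw)
    · refine mem_C ht₁ ht₂ (fun a ha => ?_) hw
      obtain ⟨j, -, hj⟩ := Finset.mem_biUnion.1 ha
      exact hdV a (hS j hj)
    · obtain ⟨i, hw⟩ := mem_iUnion.1 hw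
      exact mem_B ht₁ ht₂ i (fun a ha => hdV a (hR i ha)) hw
  simpa using add_mem hM hS0M

end Main
end
end OSH

/-- Theorem `epsilon`. -/
theorem statement10
    {H₁ H₂ K₁ K₂ T₁ T₂ : Type*}
    [NormedAddCommGroup H₁] [InnerProductSpace ℂ H₁] [CompleteSpace H₁]
    [NormedAddCommGroup H₂] [InnerProductSpace ℂ H₂] [CompleteSpace H₂]
    [NormedAddCommGroup K₁] [InnerProductSpace ℂ K₁] [CompleteSpace K₁]
    [NormedAddCommGroup K₂] [InnerProductSpace ℂ K₂] [CompleteSpace K₂]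
    [NormedAddCommGroup T₁] [InnerProductSpace ℂ T₁] [CompleteSpace T₁]
    [NormedAddCommGroup T₂] [InnerProductSpace ℂ T₂] [CompleteSpace T₂]
    [TopologicalSpace.SeparableSpace H₁] [TopologicalSpace.SeparableSpace H₂]
    (D₁ : StarSubalgebra ℂ (H₁ →L[ℂ] H₁)) (D₂ : StarSubalgebra ℂ (H₂ →L[ℂ] H₂))
    (hD₁ : IsMasa D₁) (hD₂ : IsMasa D₂)
    {r : ℕ} (Bs : Fin r → Set (H₁ →L[ℂ] H₂))
    (hBs : ∀ i, HasFiniteWidth D₁ D₂ (Bs i))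
    (U : Set (K₁ →L[ℂ] K₂)) (Us : Fin r → Set (K₁ →L[ℂ] K₂))
    (hU : IsWkClosedSubspace U) (hUs : ∀ i, IsWkClosedSubspace (Us i))
    (t₁ : H₁ → K₁ → T₁) (t₂ : H₂ → K₂ → T₂)
    (ht₁ : IsTensorEmbedding t₁) (ht₂ : IsTensorEmbedding t₂)
    {m : ℕ} (hm : 0 < m) (Cs : Fin m → Set (H₁ →L[ℂ] H₂))
    (hCs : ∀ j, HasFiniteWidth D₁ D₂ (Cs j)) :
    (⋂ j : Fin m, wkClosure (wTensor t₁ t₂ (Cs j) U +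
        setSum fun i => wTensor t₁ t₂ (Bs i) (Us i))) =
      wkClosure (wTensor t₁ t₂ (⋂ j : Fin m, Cs j) U +
        setSum fun i => wTensor t₁ t₂ (Bs i) (Us i)) := by
  classical
  choose k Vs hVs hCe using hCs
  choose l Ws hWs hBe using hBs
  let V : ((Σ j, Fin (k j)) ⊕ (Σ i, Fin (l i))) → Set (H₁ →L[ℂ] H₂) :=
    Sum.elim (fun x => Vs x.1 x.2) (fun x => Ws x.1 x.2)
  let S : Fin m → Finset ((Σ j, Fin (k j)) ⊕ (Σ i, Fin (l i))) :=
    fun j => Finset.univ.image fun b : Fin (k j) => Sum.inl ⟨j, b⟩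
  let R : Fin r → Finset ((Σ j, Fin (k j)) ⊕ (Σ i, Fin (l i))) :=
    fun i => Finset.univ.image fun b : Fin (l i) => Sum.inr ⟨i, b⟩
  have hC : ∀ j, Cs j = OSH.IS V (S j) := by
    intro j
    rw [hCe j]
    ext v
    simp [OSH.IS, S, V]
  have hB : ∀ i, Bs i = OSH.IS V (R i) := by
    intro i
    rw [hBe i]
    ext v
    simp [OSH.IS, R, V]
  have hCC : (⋂ j, Cs j) = OSH.IS V (Finset.univ.biUnion S) := by
    ext v
    rw [mem_iInter]
    simp only [hC]
    constructor
    · intro h a ha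
      obtain ⟨j, -, hj⟩ := Finset.mem_biUnion.1 ha
      exact h j a hj
    · intro h j a ha
      exact h a (Finset.mem_biUnion.2 ⟨j, Finset.mem_univ _, ha⟩)
  have hVm : ∀ a, IsMasaBimodule D₁ D₂ (V a) := by
    rintro (x | x)
    · exact (hVs x.1 x.2).1
    · exact (hWs x.1 x.2).1
  have hVn : ∀ a, IsNestBimodule (V a) := by
    rintro (x | x)
    · exact (hVs x.1 x.2).2
    · exact (hWs x.1 x.2).2
  simp only [OSH.big_eq]
  refine Subset.antisymm ?_ ?_
  · intro T hT
    rw [mem_iInter] at hT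
    have h := OSH.main_claim ht₁ ht₂ hD₁ hD₂ hVm hVn hm U Finset.univ S R Us
      (fun j => Finset.subset_univ _) (fun i => Finset.subset_univ _) T
      (fun j => by
        have := hT j
        rw [hC j, funext hB] at this
        exact this)
    rw [hCC, funext hB]
    exact h
  · refine subset_iInter fun j => ?_
    refine OSH.Hull_mono ?_
    refine union_subset_union ?_ subset_rfl
    rintro X ⟨s, hs, u, hu, h⟩
    exact ⟨s, mem_iInter.1 hs j, u, hu, h⟩
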